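/- Let u ∈ C²(cl Ω) be a bounded solution of −Δu = f(u) in Ω = ω × ℝ with u = 0 on ∂ω × ℝ, and assume ∂u/∂x_N ≥ 0 in Ω. Then the pointwise limit ū(x') = lim_{t → +∞} u(x', t) exists for every x' ∈ cl ω, the convergence is uniform on cl ω, and ū ∈ C²(cl ω) satisfies −Δū = f(ū) in ω and ū = 0 on ∂ω. -/

import Mathlib

open MeasureTheory

/-- Partial derivative of `g : ℝ^m → ℝ` in the `i`-th coordinate direction. -/
noncomputable def pd {m : ℕ} (g : (Fin m → ℝ) → ℝ) (i : Fin m) (x : Fin m → ℝ) : ℝ :=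
  fderiv ℝ g x (Pi.single i 1)

/-- Laplacian of `g : ℝ^m → ℝ`. -/
noncomputable def lap {m : ℕ} (g : (Fin m → ℝ) → ℝ) (x : Fin m → ℝ) : ℝ :=
  ∑ i, fderiv ℝ (pd g i) x (Pi.single i 1)

/-- Partial derivative of `u : ℝ^m × ℝ → ℝ` in the `i`-th horizontal direction. -/
noncomputable def pdX {m : ℕ} (u : (Fin m → ℝ) × ℝ → ℝ) (i : Fin m)
    (p : (Fin m → ℝ) × ℝ) : ℝ :=
  fderiv ℝ u p (Pi.single i 1, 0)

/-- Partial derivative of `u : ℝ^m × ℝ → ℝ` in the last (vertical) direction. -/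
noncomputable def pdT {m : ℕ} (u : (Fin m → ℝ) × ℝ → ℝ) (p : (Fin m → ℝ) × ℝ) : ℝ :=
  fderiv ℝ u p (0, 1)

/-- Laplacian of `u : ℝ^m × ℝ → ℝ`. -/
noncomputable def lapC {m : ℕ} (u : (Fin m → ℝ) × ℝ → ℝ) (p : (Fin m → ℝ) × ℝ) : ℝ :=
  (∑ i, fderiv ℝ (pdX u i) p (Pi.single i 1, 0)) + fderiv ℝ (pdT u) p (0, 1)

/-- Primitive `F(t) = ∫₀ᵗ f(s) ds`. -/
noncomputable def primF (f : ℝ → ℝ) (t : ℝ) : ℝ := ∫ s in (0:ℝ)..t, f s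

/-- The action functional `I(v) = ∫_ω (½|∇v|² − F(v))`. -/
noncomputable def action {m : ℕ} (f : ℝ → ℝ) (ω : Set (Fin m → ℝ))
    (v : (Fin m → ℝ) → ℝ) : ℝ :=
  ∫ x in ω, ((1/2) * (∑ i, (pd v i x)^2) - primF f (v x))

/-- A set has smooth boundary if it is the strict sublevel set of a smooth defining function
whose gradient does not vanish on the boundary. -/
def HasSmoothBoundary {m : ℕ} (ω : Set (Fin m → ℝ)) : Prop :=
  ∃ ρ : (Fin m → ℝ) → ℝ, ContDiff ℝ (⊤ : ℕ∞) ρ ∧ ω = {x | ρ x < 0} ∧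
    frontier ω = {x | ρ x = 0} ∧ ∀ x ∈ frontier ω, fderiv ℝ ρ x ≠ 0

/-- Hypothesis (H1'): `f(0) = 0`, the action is nonnegative on Lipschitz functions vanishing
outside `ω`, and `0` is an isolated minimizer. -/
def H1' {m : ℕ} (f : ℝ → ℝ) (ω : Set (Fin m → ℝ)) : Prop :=
  f 0 = 0 ∧
  (∀ v : (Fin m → ℝ) → ℝ, (∃ K, LipschitzWith K v) → (∀ x ∉ ω, v x = 0) →
    0 ≤ action f ω v) ∧
  (∃ ε > (0:ℝ), ∀ v : (Fin m → ℝ) → ℝ, (∃ K, LipschitzWith K v) → (∀ x ∉ ω, v x = 0) →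
    0 < (∫ x in ω, ((∑ i, (pd v i x)^2) + (v x)^2)) →
    (∫ x in ω, ((∑ i, (pd v i x)^2) + (v x)^2)) ≤ ε → 0 < action f ω v)

/-- Hypothesis (H2'): there is a positive `C²` solution of `-Δψ = f(ψ)`, vanishing on `∂ω`,
with zero action. -/
def H2' {m : ℕ} (f : ℝ → ℝ) (ω : Set (Fin m → ℝ)) : Prop :=
  ∃ ψ : (Fin m → ℝ) → ℝ, ContDiffOn ℝ 2 ψ (closure ω) ∧ (∀ x ∈ ω, 0 < ψ x) ∧
    (∀ x ∈ frontier ω, ψ x = 0) ∧ (∀ x ∈ ω, -lap ψ x = f (ψ x)) ∧ action f ω ψ = 0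

/-- The Hamiltonian `H(t)` associated to `u` on the cylinder over `ω`. -/
noncomputable def Ham {m : ℕ} (f : ℝ → ℝ) (ω : Set (Fin m → ℝ))
    (u : (Fin m → ℝ) × ℝ → ℝ) (t : ℝ) : ℝ :=
  ∫ x' in ω, ((1/2) * ((∑ i, (pdX u i (x', t))^2) - (pdT u (x', t))^2) - primF f (u (x', t)))

section

open Filter Topology Set Metric
open scoped RealInnerProductSpace

set_option linter.unusedSectionVars false

/-- The second derivative of a function, as a bilinear map. -/
noncomputable abbrev hess {E : Type*} [NormedAddCommGroup E] [NormedSpace ℝ E] (w : E → ℝ) (x : E) :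
    E →L[ℝ] E →L[ℝ] ℝ := fderiv ℝ (fderiv ℝ w) x

/-- The Laplacian of a function on a Euclidean space. -/
noncomputable def lapl {ι : Type*} [Fintype ι] (w : EuclideanSpace ℝ ι → ℝ)
    (x : EuclideanSpace ℝ ι) : ℝ :=
  ∑ i, hess w x (EuclideanSpace.basisFun ι ℝ i) (EuclideanSpace.basisFun ι ℝ i)

section calculus

variable {E : Type*} [NormedAddCommGroup E] [NormedSpace ℝ E] {f g w : E → ℝ} {x : E}

theorem ContDiffAt.hasFDerivAt_fderiv (hw : ContDiffAt ℝ 2 w x) :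
    HasFDerivAt (fderiv ℝ w) (hess w x) x :=
  ((hw.fderiv_right (m := 1) (by norm_num)).differentiableAt (by norm_num)).hasFDerivAt

theorem ContDiffAt.eventually_differentiableAt (hw : ContDiffAt ℝ 2 w x) :
    ∀ᶠ y in 𝓝 x, DifferentiableAt ℝ w y := by
  filter_upwards [hw.eventually (by simp)] with y hy using hy.differentiableAt (by norm_num)

theorem hess_eq_of_hasFDerivAt {w' : E → E →L[ℝ] ℝ} {w'' : E →L[ℝ] E →L[ℝ] ℝ}
    (h1 : ∀ᶠ y in 𝓝 x, HasFDerivAt w (w' y) y) (h2 : HasFDerivAt w' w'' x) : hess w x = w'' := by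
  have : fderiv ℝ w =ᶠ[𝓝 x] w' := by
    filter_upwards [h1] with y hy using hy.fderiv
  exact (this.fderiv_eq).trans h2.fderiv

theorem hess_congr (h : f =ᶠ[𝓝 x] g) : hess f x = hess g x :=
  (h.fderiv).fderiv_eq

theorem hess_add (hf : ContDiffAt ℝ 2 f x) (hg : ContDiffAt ℝ 2 g x) :
    hess (fun y => f y + g y) x = hess f x + hess g x := by
  refine hess_eq_of_hasFDerivAt (w' := fun y => fderiv ℝ f y + fderiv ℝ g y) ?_
    (hf.hasFDerivAt_fderiv.add hg.hasFDerivAt_fderiv)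
  filter_upwards [hf.eventually_differentiableAt, hg.eventually_differentiableAt] with y h1 h2
  exact h1.hasFDerivAt.add h2.hasFDerivAt

theorem hess_sub (hf : ContDiffAt ℝ 2 f x) (hg : ContDiffAt ℝ 2 g x) :
    hess (fun y => f y - g y) x = hess f x - hess g x := by
  refine hess_eq_of_hasFDerivAt (w' := fun y => fderiv ℝ f y - fderiv ℝ g y) ?_
    (hf.hasFDerivAt_fderiv.sub hg.hasFDerivAt_fderiv)
  filter_upwards [hf.eventually_differentiableAt, hg.eventually_differentiableAt] with y h1 h2
  exact h1.hasFDerivAt.sub h2.hasFDerivAt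

theorem hess_const_mul (c : ℝ) (hf : ContDiffAt ℝ 2 f x) :
    hess (fun y => c * f y) x = c • hess f x := by
  refine hess_eq_of_hasFDerivAt (w' := fun y => c • fderiv ℝ f y) ?_
    (hf.hasFDerivAt_fderiv.const_smul c)
  filter_upwards [hf.eventually_differentiableAt] with y h1
  exact h1.hasFDerivAt.const_mul c

theorem hess_mul_apply (hf : ContDiffAt ℝ 2 f x) (hg : ContDiffAt ℝ 2 g x) (u v : E) :
    hess (fun y => f y * g y) x u v = f x * hess g x u v + g x * hess f x u v
      + fderiv ℝ f x u * fderiv ℝ g x v + fderiv ℝ g x u * fderiv ℝ f x v := by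
  have h := hess_eq_of_hasFDerivAt (w := fun y => f y * g y) (x := x)
    (w' := fun y => f y • fderiv ℝ g y + g y • fderiv ℝ f y)
    (by
      filter_upwards [hf.eventually_differentiableAt, hg.eventually_differentiableAt] with y h1 h2
      exact h1.hasFDerivAt.mul h2.hasFDerivAt)
    ((hf.differentiableAt (by norm_num)).hasFDerivAt.smul hg.hasFDerivAt_fderiv |>.add
      ((hg.differentiableAt (by norm_num)).hasFDerivAt.smul hf.hasFDerivAt_fderiv))
  rw [h]
  simp
  ring

theorem hess_comp_affine (x₀ : E) (r : ℝ) (hw : ContDiffAt ℝ 2 w (x₀ + r • x)) (u v : E) :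
    hess (fun y => w (x₀ + r • y)) x u v = r ^ 2 * hess w (x₀ + r • x) u v := by
  have hA : ∀ y : E, HasFDerivAt (fun y : E => x₀ + r • y) (r • ContinuousLinearMap.id ℝ E) y :=
    fun y => ((hasFDerivAt_id y).const_smul r).const_add x₀
  have hc : ContinuousAt (fun y : E => x₀ + r • y) x := by fun_prop
  have h := hess_eq_of_hasFDerivAt (w := fun y => w (x₀ + r • y)) (x := x)
    (w' := fun y => r • fderiv ℝ w (x₀ + r • y))
    (w'' := r • (hess w (x₀ + r • x)).comp (r • ContinuousLinearMap.id ℝ E))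
    (by
      filter_upwards [hc.eventually hw.eventually_differentiableAt] with y h1
      have := h1.hasFDerivAt.comp y (hA y)
      refine HasFDerivAt.congr_fderiv this ?_
      ext z; simp)
    (by
      have := hw.hasFDerivAt_fderiv.comp x (hA x)
      exact this.const_smul r)
  rw [h]
  simp
  ring

theorem hess_comp_clm {G : Type*} [NormedAddCommGroup G] [NormedSpace ℝ G] (T : G →L[ℝ] E) {x : G}
    (hw : ContDiffAt ℝ 2 w (T x)) (u v : G) :
    hess (fun y => w (T y)) x u v = hess w (T x) (T u) (T v) := by
  have hc : ContinuousAt T x := by fun_prop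
  have h := hess_eq_of_hasFDerivAt (w := fun y => w (T y)) (x := x)
    (w' := fun y => (fderiv ℝ w (T y)).comp T)
    (w'' := ((ContinuousLinearMap.compL ℝ G E ℝ).flip T).comp ((hess w (T x)).comp T))
    (by
      filter_upwards [hc.eventually hw.eventually_differentiableAt] with y h1
      exact h1.hasFDerivAt.comp y T.hasFDerivAt)
    (by
      have := hw.hasFDerivAt_fderiv.comp x T.hasFDerivAt
      exact ((ContinuousLinearMap.compL ℝ G E ℝ).flip T).hasFDerivAt.comp x this)
  rw [h]
  simp

theorem hess_comp_real {φ : ℝ → ℝ} (hφ : ContDiff ℝ 2 φ) (ℓ : E →L[ℝ] ℝ) (x u v : E) :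
    hess (fun y => φ (ℓ y)) x u v = deriv (deriv φ) (ℓ x) * ℓ u * ℓ v := by
  have h := hess_eq_of_hasFDerivAt (w := fun y => φ (ℓ y)) (x := x)
    (w' := fun y => deriv φ (ℓ y) • ℓ)
    (w'' := (deriv (deriv φ) (ℓ x) • ℓ).smulRight ℓ)
    (by
      refine Eventually.of_forall fun y => ?_
      exact ((hφ.differentiable (by norm_num)) (ℓ y)).hasDerivAt.comp_hasFDerivAt y ℓ.hasFDerivAt)
    (by
      have h2 : DifferentiableAt ℝ (deriv φ) (ℓ x) :=
        ((contDiff_succ_iff_deriv (n := 1)).1 hφ).2.2.differentiable (by norm_num) _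
      exact (h2.hasDerivAt.comp_hasFDerivAt x ℓ.hasFDerivAt).smul_const ℓ)
  rw [h]
  simp

theorem IsLocalMax.hess_nonpos (hm : IsLocalMax w x) (hw : ContDiffAt ℝ 2 w x) (v : E) :
    hess w x v v ≤ 0 := by
  by_contra! hpos
  set φ : ℝ → ℝ := fun t => w (x + t • v) with hφ
  have hA : ∀ t : ℝ, HasDerivAt (fun t : ℝ => x + t • v) v t := fun t => by
    simpa using ((hasDerivAt_id t).smul_const v).const_add x
  have hc : ContinuousAt (fun t : ℝ => x + t • v) 0 := by fun_prop
  have hx0 : x + (0:ℝ) • v = x := by simp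
  have h1 : ∀ᶠ t in 𝓝 (0:ℝ), HasDerivAt φ (fderiv ℝ w (x + t • v) v) t := by
    have := hc.eventually (p := fun y => DifferentiableAt ℝ w y)
      (by simpa [hx0] using hw.eventually_differentiableAt)
    filter_upwards [this] with t ht
    exact ht.hasFDerivAt.comp_hasDerivAt t (hA t)
  have hd1 : deriv φ =ᶠ[𝓝 0] fun t => fderiv ℝ w (x + t • v) v := by
    filter_upwards [h1] with t ht using ht.deriv
  have h2 : HasDerivAt (fun t : ℝ => fderiv ℝ w (x + t • v) v) (hess w x v v) 0 := by
    have h3 : HasFDerivAt (fderiv ℝ w) (hess w x) (x + (0:ℝ) • v) := by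
      rw [hx0]; exact hw.hasFDerivAt_fderiv
    have := h3.comp_hasDerivAt (0:ℝ) (hA 0)
    exact this.clm_apply (hasDerivAt_const _ v) |>.congr_deriv (by simp)
  have hd2 : deriv (deriv φ) 0 = hess w x v v := (hd1.deriv_eq).trans h2.deriv
  have hmax : IsLocalMax φ 0 := by
    have : ∀ᶠ y in 𝓝 (x + (0:ℝ) • v), w y ≤ w x := by rw [hx0]; exact hm
    have := hc.eventually this
    filter_upwards [this] with t ht
    simpa [hφ] using ht
  have hd0 : deriv φ 0 = 0 := hmax.deriv_eq_zero
  have hcont : ContinuousAt φ 0 := h1.self_of_nhds.continuousAt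
  have hmin : IsLocalMin φ 0 :=
    isLocalMin_of_deriv_deriv_pos (by rw [hd2]; exact hpos) hd0 hcont
  have hconst : φ =ᶠ[𝓝 0] fun _ => φ 0 := by
    filter_upwards [hmax, hmin] with t h1 h2 using le_antisymm h1 h2
  have : deriv (deriv φ) 0 = 0 := by
    have h4 : deriv φ =ᶠ[𝓝 0] deriv (fun _ => φ 0) := hconst.deriv
    rw [h4.deriv_eq]; simp
  linarith

end calculus

section laplacian

variable {ι : Type*} [Fintype ι] {f g w : EuclideanSpace ℝ ι → ℝ} {x : EuclideanSpace ℝ ι}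

theorem lapl_congr (h : f =ᶠ[𝓝 x] g) : lapl f x = lapl g x := by
  simp only [lapl, hess_congr h]

theorem lapl_add (hf : ContDiffAt ℝ 2 f x) (hg : ContDiffAt ℝ 2 g x) :
    lapl (fun y => f y + g y) x = lapl f x + lapl g x := by
  simp [lapl, hess_add hf hg, Finset.sum_add_distrib]

theorem lapl_sub (hf : ContDiffAt ℝ 2 f x) (hg : ContDiffAt ℝ 2 g x) :
    lapl (fun y => f y - g y) x = lapl f x - lapl g x := by
  simp [lapl, hess_sub hf hg]

theorem lapl_const_mul (c : ℝ) (hf : ContDiffAt ℝ 2 f x) :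
    lapl (fun y => c * f y) x = c * lapl f x := by
  simp [lapl, hess_const_mul c hf, Finset.mul_sum]

theorem lapl_mul (hf : ContDiffAt ℝ 2 f x) (hg : ContDiffAt ℝ 2 g x) :
    lapl (fun y => f y * g y) x = f x * lapl g x + g x * lapl f x
      + 2 * ∑ i, fderiv ℝ f x (EuclideanSpace.basisFun ι ℝ i)
        * fderiv ℝ g x (EuclideanSpace.basisFun ι ℝ i) := by
  simp only [lapl, hess_mul_apply hf hg, Finset.sum_add_distrib, Finset.mul_sum]
  rw [add_assoc, ← Finset.sum_add_distrib]
  congr 1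
  rw [← Finset.sum_add_distrib]
  exact Finset.sum_congr rfl fun i _ => by ring

theorem lapl_comp_affine (x₀ : EuclideanSpace ℝ ι) (r : ℝ) (hw : ContDiffAt ℝ 2 w (x₀ + r • x)) :
    lapl (fun y => w (x₀ + r • y)) x = r ^ 2 * lapl w (x₀ + r • x) := by
  simp only [lapl, hess_comp_affine x₀ r hw, Finset.mul_sum]

theorem IsLocalMax.lapl_nonpos (hm : IsLocalMax w x) (hw : ContDiffAt ℝ 2 w x) :
    lapl w x ≤ 0 :=
  Finset.sum_nonpos fun _ _ => hm.hess_nonpos hw _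

theorem sum_clm_sq (ℓ : EuclideanSpace ℝ ι →L[ℝ] ℝ) :
    ∑ i, ℓ (EuclideanSpace.basisFun ι ℝ i) ^ 2 = ‖ℓ‖ ^ 2 := by
  set y := (InnerProductSpace.toDual ℝ (EuclideanSpace ℝ ι)).symm ℓ with hy
  have h1 : ∀ z, ℓ z = inner ℝ y z := fun z => by
    rw [hy, InnerProductSpace.toDual_symm_apply]
  have h2 : ‖ℓ‖ = ‖y‖ := by rw [hy]; simp
  rw [h2, ← OrthonormalBasis.sum_sq_norm_inner_left (EuclideanSpace.basisFun ι ℝ) y]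
  simp [h1]

end laplacian

/-- A smooth cutoff on the line, equal to `1` on `s ≤ 0` and to `0` on `s ≥ 1`. -/
noncomputable def kap (s : ℝ) : ℝ := Real.smoothTransition (1 - s)

/-- Minus half of the primitive of `kap` which vanishes on `s ≥ 1`. -/
noncomputable def kapPrim (s : ℝ) : ℝ := ∫ t in s..1, kap t / 2

theorem contDiff_kap {n : ℕ∞} : ContDiff ℝ n kap :=
  Real.smoothTransition.contDiff.comp (contDiff_const.sub contDiff_id)

theorem continuous_kap : Continuous kap := (contDiff_kap (n := 0)).continuous

theorem kap_nonneg (s : ℝ) : 0 ≤ kap s := Real.smoothTransition.nonneg _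

theorem kap_le_one (s : ℝ) : kap s ≤ 1 := Real.smoothTransition.le_one _

theorem kap_eq_zero {s : ℝ} (hs : 1 ≤ s) : kap s = 0 :=
  Real.smoothTransition.zero_of_nonpos (by linarith)

theorem kap_eq_one {s : ℝ} (hs : s ≤ 0) : kap s = 1 :=
  Real.smoothTransition.one_of_one_le (by linarith)

theorem hasDerivAt_kapPrim (s : ℝ) : HasDerivAt kapPrim (-(kap s / 2)) s := by
  have hc : Continuous fun t => kap t / 2 := continuous_kap.div_const 2
  exact intervalIntegral.integral_hasDerivAt_left (hc.intervalIntegrable _ _)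
    hc.aestronglyMeasurable.stronglyMeasurableAtFilter hc.continuousAt

theorem continuous_kapPrim : Continuous kapPrim :=
  continuous_iff_continuousAt.2 fun s => (hasDerivAt_kapPrim s).continuousAt

theorem kapPrim_eq_zero {s : ℝ} (hs : 1 ≤ s) : kapPrim s = 0 := by
  rw [kapPrim, intervalIntegral.integral_symm]
  rw [intervalIntegral.integral_congr (g := fun _ => 0)]
  · simp
  · intro t ht
    rw [uIcc_of_le hs] at ht
    simp [kap_eq_zero ht.1]

theorem abs_kapPrim_sub_le (s t : ℝ) : |kapPrim s - kapPrim t| ≤ |s - t| := by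
  have := Convex.norm_image_sub_le_of_norm_hasDerivWithin_le (s := univ) (C := 1) (x := t) (y := s)
    (fun x _ => (hasDerivAt_kapPrim x).hasDerivWithinAt)
    (fun x _ => by
      rw [norm_neg, Real.norm_eq_abs, abs_of_nonneg (by linarith [kap_nonneg x])]
      linarith [kap_le_one x, kap_nonneg x]) convex_univ (mem_univ _) (mem_univ _)
  simpa using this

theorem abs_kapPrim_le {s : ℝ} (hs : 0 ≤ s) : |kapPrim s| ≤ 1 := by
  rcases le_total 1 s with h | h
  · simp [kapPrim_eq_zero h]
  · have := abs_kapPrim_sub_le s 1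
    rw [kapPrim_eq_zero le_rfl, sub_zero] at this
    refine this.trans ?_
    rw [abs_le]; constructor <;> linarith

section kernels

variable {F : Type*} [NormedAddCommGroup F] [InnerProductSpace ℝ F]

/-- The radial mollifier. -/
noncomputable def rhoK (y : F) : ℝ := kap (‖y‖ ^ 2)

/-- The radial potential with `∇ psiK y = - rhoK y • y`. -/
noncomputable def psiK (y : F) : ℝ := kapPrim (‖y‖ ^ 2)

theorem contDiff_rhoK {n : ℕ∞} : ContDiff ℝ n (rhoK : F → ℝ) :=
  contDiff_kap.comp (contDiff_norm_sq ℝ)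

theorem continuous_rhoK : Continuous (rhoK : F → ℝ) := (contDiff_rhoK (n := 0)).continuous

theorem continuous_psiK : Continuous (psiK : F → ℝ) :=
  continuous_kapPrim.comp (continuous_norm.pow 2)

theorem rhoK_nonneg (y : F) : 0 ≤ rhoK y := kap_nonneg _

theorem abs_rhoK_le (y : F) : |rhoK y| ≤ 1 := by
  rw [abs_of_nonneg (rhoK_nonneg y)]; exact kap_le_one _

theorem abs_psiK_le (y : F) : |psiK y| ≤ 1 := abs_kapPrim_le (by positivity)

theorem rhoK_eq_zero {y : F} (hy : y ∉ closedBall (0 : F) 1) : rhoK y = 0 := by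
  rw [mem_closedBall_zero_iff, not_le] at hy
  exact kap_eq_zero (by nlinarith)

theorem psiK_eq_zero {y : F} (hy : y ∉ closedBall (0 : F) 1) : psiK y = 0 := by
  rw [mem_closedBall_zero_iff, not_le] at hy
  exact kapPrim_eq_zero (by nlinarith)

theorem hasFDerivAt_psiK (y : F) : HasFDerivAt psiK (-(rhoK y) • innerSL ℝ y) y := by
  have h := (hasDerivAt_kapPrim (‖y‖ ^ 2)).comp_hasFDerivAt y (hasStrictFDerivAt_norm_sq y).hasFDerivAt
  refine h.congr_fderiv ?_
  ext z
  simp [rhoK]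
  ring

theorem rhoK_zero : rhoK (0 : F) = 1 := by
  simp [rhoK, kap_eq_one]

end kernels

section translation

variable {F : Type*} [NormedAddCommGroup F] [InnerProductSpace ℝ F] [FiniteDimensional ℝ F]
  [MeasurableSpace F] [BorelSpace F] {k q : F → ℝ}

theorem integrable_kernel_mul (hk : Continuous k) (hs : ∀ y ∉ closedBall (0 : F) 1, k y = 0)
    (hq : Continuous q) : Integrable fun y => k y * q y := by
  refine (hk.mul hq).integrable_of_hasCompactSupport ?_
  exact HasCompactSupport.intro (isCompact_closedBall (0 : F) 1) fun y hy => by simp [hs y hy]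

theorem integral_rhoK_pos : 0 < ∫ y : F, rhoK y :=
  continuous_rhoK.integral_pos_of_hasCompactSupport_nonneg_nonzero
    (HasCompactSupport.intro (isCompact_closedBall (0 : F) 1) fun _ hy => rhoK_eq_zero hy)
    rhoK_nonneg (x := 0) (by simp [rhoK_zero])

theorem abs_integral_kernel_le {B G : ℝ} (hs : ∀ y ∉ closedBall (0 : F) 1, k y = 0)
    (hB : ∀ y, |k y| ≤ B) (hG : ∀ y ∈ closedBall (0 : F) 1, |q y| ≤ G) :
    |∫ y, k y * q y| ≤ B * G * volume.real (closedBall (0 : F) 1) := by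
  have h0 : ∫ y, k y * q y = ∫ y in closedBall (0 : F) 1, k y * q y := by
    rw [setIntegral_eq_integral_of_forall_compl_eq_zero]
    intro y hy; simp [hs y hy]
  rw [h0, ← Real.norm_eq_abs]
  refine norm_setIntegral_le_of_norm_le_const (isCompact_closedBall (0 : F) 1).measure_lt_top ?_
  intro y hy
  rw [norm_mul]
  exact mul_le_mul (hB y) (hG y hy) (abs_nonneg _) ((abs_nonneg _).trans (hB y))

/-- The mean of `q` against a Lipschitz kernel has a Lipschitz bound which only uses the size
of `q`. -/
theorem abs_integral_kernel_translate_sub_le {L G r : ℝ} {x a : F} (hk : Continuous k)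
    (hs : ∀ y ∉ closedBall (0 : F) 1, k y = 0)
    (hL : ∀ y z, |k y - k z| ≤ L * ‖y - z‖) (hB : ∀ y, |k y| ≤ L) (hr : 0 < r)
    (hq : Continuous q) (hG : ∀ y ∈ closedBall x (r + ‖a‖), |q y| ≤ G) :
    |(∫ y, k y * q (x + a + r • y)) - ∫ y, k y * q (x + r • y)|
      ≤ 2 * L * volume.real (closedBall (0 : F) 2) * G * (‖a‖ / r) := by
  have hL0 : 0 ≤ L := (abs_nonneg _).trans (hB 0)
  have hG0 : 0 ≤ G := (abs_nonneg _).trans (hG x (mem_closedBall_self (by positivity)))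
  have hsub : closedBall (0 : F) 1 ⊆ closedBall (0 : F) 2 := closedBall_subset_closedBall (by norm_num)
  have hvol : volume.real (closedBall (0 : F) 1) ≤ volume.real (closedBall (0 : F) 2) :=
    measureReal_mono hsub (isCompact_closedBall (0 : F) 2).measure_lt_top.ne
  have hmem : ∀ y ∈ closedBall (0 : F) 1, x + r • y ∈ closedBall x (r + ‖a‖) ∧
      x + a + r • y ∈ closedBall x (r + ‖a‖) := by
    intro y hy
    rw [mem_closedBall_zero_iff] at hy
    have h1 : ‖r • y‖ ≤ r := by
      rw [norm_smul, Real.norm_eq_abs, abs_of_pos hr]; nlinarith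
    constructor
    · rw [mem_closedBall_iff_norm, add_sub_cancel_left]; linarith [norm_nonneg a]
    · rw [mem_closedBall_iff_norm, add_assoc, add_sub_cancel_left]
      linarith [norm_add_le a (r • y)]
  rcases le_total 1 (‖a‖ / r) with h1 | h1
  · have e1 := abs_integral_kernel_le (q := fun y => q (x + a + r • y)) hs hB
      (fun y hy => hG _ (hmem y hy).2)
    have e2 := abs_integral_kernel_le (q := fun y => q (x + r • y)) hs hB
      (fun y hy => hG _ (hmem y hy).1)
    have e3 : L * G * volume.real (closedBall (0 : F) 1) ≤
        L * G * volume.real (closedBall (0 : F) 2) * (‖a‖ / r) := by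
      calc _ ≤ L * G * volume.real (closedBall (0 : F) 2) := by gcongr
        _ ≤ _ := le_mul_of_one_le_right (by positivity) h1
    calc _ ≤ _ := abs_sub _ _
      _ ≤ 2 * (L * G * volume.real (closedBall (0 : F) 2) * (‖a‖ / r)) := by linarith
      _ = _ := by ring
  · set b := r⁻¹ • a with hb
    have hbn : ‖b‖ = ‖a‖ / r := by
      rw [hb, norm_smul, norm_inv, Real.norm_eq_abs, abs_of_pos hr]; field_simp
    have hrb : r • b = a := by rw [hb, smul_smul, mul_inv_cancel₀ hr.ne', one_smul]
    have hshift : ∫ y, k y * q (x + a + r • y) = ∫ y, k (y - b) * q (x + r • y) := by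
      rw [← integral_add_right_eq_self (fun y => k (y - b) * q (x + r • y)) b]
      congr 1; ext y
      rw [add_sub_cancel_right, smul_add, hrb]
      congr 2; abel
    have hqc : Continuous fun y => q (x + r • y) := by fun_prop
    have hqc2 : Continuous fun y => q (x + a + r • y) := by fun_prop
    have hi1 : Integrable fun y => k (y - b) * q (x + r • y) := by
      have := (integrable_kernel_mul hk hs hqc2).comp_sub_right b
      refine this.congr (Eventually.of_forall fun y => ?_)
      simp only [smul_sub, hrb]
      congr 2; abel
    rw [hshift, ← integral_sub hi1 (integrable_kernel_mul hk hs hqc)]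
    have h0 : ∫ y, (k (y - b) * q (x + r • y) - k y * q (x + r • y))
        = ∫ y in closedBall (0 : F) 2, (k (y - b) * q (x + r • y) - k y * q (x + r • y)) := by
      rw [setIntegral_eq_integral_of_forall_compl_eq_zero]
      intro y hy
      rw [hs y fun h => hy (hsub h), hs (y - b)]
      · simp
      · intro h
        apply hy
        rw [mem_closedBall_zero_iff] at h ⊢
        have := norm_add_le (y - b) b
        rw [sub_add_cancel] at this
        linarith
    rw [h0, ← Real.norm_eq_abs]
    have := norm_setIntegral_le_of_norm_le_const (μ := volume) (C := L * ‖b‖ * G)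
      (f := fun y => k (y - b) * q (x + r • y) - k y * q (x + r • y))
      (isCompact_closedBall (0 : F) 2).measure_lt_top (by
        intro y _
        rw [← sub_mul, norm_mul]
        have hk' : ‖k (y - b) - k y‖ ≤ L * ‖b‖ := by
          have := hL (y - b) y
          simpa using this
        by_cases hy1 : y ∈ closedBall (0 : F) 1
        · exact mul_le_mul hk' (hG _ (hmem y hy1).1) (norm_nonneg _) (by positivity)
        · by_cases hy2 : y - b ∈ closedBall (0 : F) 1
          · refine mul_le_mul hk' (hG _ ?_) (norm_nonneg _) (by positivity)
            have := (hmem _ hy2).2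
            rwa [smul_sub, hrb, show x + a + (r • y - a) = x + r • y by abel] at this
          · rw [hs _ hy1, hs _ hy2]; simp; positivity)
    refine this.trans ?_
    rw [hbn]
    have : 0 ≤ L * (‖a‖ / r) * G * volume.real (closedBall (0 : F) 2) := by positivity
    linarith [this]

end translation

section lipschitz_kernels

variable {F : Type*} [NormedAddCommGroup F] [InnerProductSpace ℝ F] [FiniteDimensional ℝ F]

theorem abs_psiK_sub_le (y z : F) : |psiK y - psiK z| ≤ ‖y - z‖ := by
  have := Convex.norm_image_sub_le_of_norm_hasFDerivWithin_le (s := univ) (C := 1) (x := z) (y := y)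
    (fun x _ => (hasFDerivAt_psiK x).hasFDerivWithinAt)
    (fun x _ => by
      rw [norm_smul, norm_neg, innerSL_apply_norm, Real.norm_eq_abs]
      by_cases hx : x ∈ closedBall (0 : F) 1
      · rw [mem_closedBall_zero_iff] at hx
        exact mul_le_one₀ (abs_rhoK_le x) (norm_nonneg _) hx
      · simp [rhoK_eq_zero hx]) convex_univ (mem_univ _) (mem_univ _)
  simpa using this

variable (F) in
theorem exists_rhoK_lipschitz : ∃ L : ℝ, 1 ≤ L ∧ ∀ y z : F, |rhoK y - rhoK z| ≤ L * ‖y - z‖ := by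
  have hc : HasCompactSupport (rhoK : F → ℝ) :=
    HasCompactSupport.intro (isCompact_closedBall (0 : F) 1) fun _ hy => rhoK_eq_zero hy
  obtain ⟨C, hC⟩ := (contDiff_rhoK (F := F) (n := 1)).lipschitzWith_of_hasCompactSupport hc (by simp)
  refine ⟨max C 1, le_max_right _ _, fun y z => ?_⟩
  have := hC.dist_le_mul y z
  rw [Real.dist_eq, dist_eq_norm] at this
  exact this.trans (by gcongr; exact le_max_left _ _)

end lipschitz_kernels

section mean

variable {ι : Type*} [Fintype ι] {w : EuclideanSpace ℝ ι → ℝ}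

theorem continuous_lapl (hw : ContDiff ℝ 2 w) : Continuous (lapl w) := by
  have h1 : ContDiff ℝ 1 (fderiv ℝ w) := hw.fderiv_right (by norm_num)
  have h2 : Continuous (fderiv ℝ (fderiv ℝ w)) := h1.continuous_fderiv (by norm_num)
  unfold lapl hess
  fun_prop

theorem integral_rhoK_mul_fderiv (hw : ContDiff ℝ 2 w) (x : EuclideanSpace ℝ ι) (r : ℝ) :
    ∫ y, rhoK y * fderiv ℝ w (x + r • y) y = r * ∫ y, psiK y * lapl w (x + r • y) := by
  have h1 : ContDiff ℝ 1 (fderiv ℝ w) := hw.fderiv_right (by norm_num)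
  have hc1 : Continuous (fderiv ℝ w) := h1.continuous
  have h2 : Continuous (fderiv ℝ (fderiv ℝ w)) := h1.continuous_fderiv (by norm_num)
  set e := EuclideanSpace.basisFun ι ℝ with he
  have hg : ∀ (i : ι) y, HasFDerivAt (fun y => fderiv ℝ w (x + r • y) (e i))
      ((ContinuousLinearMap.apply ℝ ℝ (e i)).comp
        ((hess w (x + r • y)).comp (r • ContinuousLinearMap.id ℝ (EuclideanSpace ℝ ι)))) y := by
    intro i y
    have hA : HasFDerivAt (fun y : EuclideanSpace ℝ ι => x + r • y)
      (r • ContinuousLinearMap.id ℝ _) y := ((hasFDerivAt_id y).const_smul r).const_add x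
    exact (ContinuousLinearMap.apply ℝ ℝ (e i)).hasFDerivAt.comp y
      (hw.contDiffAt.hasFDerivAt_fderiv.comp y hA)
  have hg' : ∀ (i : ι) y, fderiv ℝ (fun y => fderiv ℝ w (x + r • y) (e i)) y (e i)
      = r * hess w (x + r • y) (e i) (e i) := by
    intro i y
    rw [(hg i y).fderiv]; simp
  have hcg : ∀ i : ι, Continuous fun y => fderiv ℝ w (x + r • y) (e i) := fun i => by fun_prop
  have hch : ∀ i : ι, Continuous fun y => hess w (x + r • y) (e i) (e i) := fun i => by
    unfold hess; fun_prop
  have hcy : ∀ i : ι, Continuous fun y : EuclideanSpace ℝ ι => y i := fun i => by fun_prop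
  have hpsi : ∀ (i : ι) (y : EuclideanSpace ℝ ι), fderiv ℝ psiK y (e i) = -(rhoK y * y i) := by
    intro i y
    rw [(hasFDerivAt_psiK y).fderiv]
    have : inner ℝ y (e i) = y i := by
      rw [real_inner_comm, he, EuclideanSpace.basisFun_inner]
    simp [this]
  have hi1 : ∀ i : ι, Integrable fun y => rhoK y * (y i * fderiv ℝ w (x + r • y) (e i)) :=
    fun i => integrable_kernel_mul continuous_rhoK (fun _ hy => rhoK_eq_zero hy)
      ((hcy i).mul (hcg i))
  have hi2 : ∀ i : ι, Integrable fun y => psiK y * (r * hess w (x + r • y) (e i) (e i)) :=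
    fun i => integrable_kernel_mul continuous_psiK (fun _ hy => psiK_eq_zero hy)
      (continuous_const.mul (hch i))
  have key : ∀ i : ι, ∫ y, psiK y * (r * hess w (x + r • y) (e i) (e i))
      = ∫ y, rhoK y * (y i * fderiv ℝ w (x + r • y) (e i)) := by
    intro i
    have := integral_mul_fderiv_eq_neg_fderiv_mul_of_integrable (μ := volume) (𝕜 := ℝ)
      (f := (psiK : EuclideanSpace ℝ ι → ℝ))
      (g := fun y => fderiv ℝ w (x + r • y) (e i)) (v := e i)
      ((hi1 i).neg.congr (Eventually.of_forall fun y => by simp only [hpsi, Pi.neg_apply]; ring))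
      ((hi2 i).congr (Eventually.of_forall fun y => by simp only [hg']))
      (integrable_kernel_mul continuous_psiK (fun _ hy => psiK_eq_zero hy) (hcg i))
      (fun y _ => (hasFDerivAt_psiK y).differentiableAt) (fun y _ => (hg i y).differentiableAt)
    simp only [hg', hpsi] at this
    rw [this, ← integral_neg]
    congr 1; ext y; ring
  calc ∫ y, rhoK y * fderiv ℝ w (x + r • y) y
      = ∫ y, ∑ i, rhoK y * (y i * fderiv ℝ w (x + r • y) (e i)) := by
        congr 1; ext y
        conv_lhs => rw [← e.sum_repr y]
        rw [map_sum, Finset.mul_sum]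
        refine Finset.sum_congr rfl fun i _ => ?_
        rw [e.sum_repr y]
        simp [he]
    _ = ∑ i, ∫ y, psiK y * (r * hess w (x + r • y) (e i) (e i)) := by
        rw [integral_finsetSum _ fun i _ => hi1 i]
        exact Finset.sum_congr rfl fun i _ => (key i).symm
    _ = ∫ y, ∑ i, psiK y * (r * hess w (x + r • y) (e i) (e i)) :=
        (integral_finsetSum _ fun i _ => hi2 i).symm
    _ = ∫ y, r * (psiK y * lapl w (x + r • y)) := by
        congr 1; ext y
        simp only [lapl, Finset.mul_sum, he]
        exact Finset.sum_congr rfl fun i _ => by ring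
    _ = _ := integral_const_mul _ _

theorem hasDerivAt_mean (hw : ContDiff ℝ 2 w) (x : EuclideanSpace ℝ ι) (r : ℝ) :
    HasDerivAt (fun r : ℝ => ∫ y, rhoK y * w (x + r • y))
      (r * ∫ y, psiK y * lapl w (x + r • y)) r := by
  rw [← integral_rhoK_mul_fderiv hw]
  have hc1 : Continuous (fderiv ℝ w) := hw.continuous_fderiv (by norm_num)
  have hcw := hw.continuous
  have hcR := continuous_rhoK (F := EuclideanSpace ℝ ι)
  have hcont : Continuous fun p : ℝ × EuclideanSpace ℝ ι =>
      rhoK p.2 * fderiv ℝ w (x + p.1 • p.2) p.2 := by fun_prop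
  obtain ⟨C, hC⟩ := ((isCompact_Icc (a := r - 1) (b := r + 1)).prod
    (isCompact_closedBall (0 : EuclideanSpace ℝ ι) 1)).exists_bound_of_continuousOn
      hcont.continuousOn
  refine (hasDerivAt_integral_of_dominated_loc_of_deriv_le (μ := volume)
    (F := fun r y => rhoK y * w (x + r • y))
    (F' := fun r y => rhoK y * fderiv ℝ w (x + r • y) y)
    (bound := (closedBall (0 : EuclideanSpace ℝ ι) 1).indicator fun _ => C)
    (Icc_mem_nhds (show r - 1 < r by linarith) (show r < r + 1 by linarith)) ?_ ?_ ?_ ?_ ?_ ?_).2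
  · exact Eventually.of_forall fun s => (by fun_prop : Continuous _).aestronglyMeasurable
  · exact integrable_kernel_mul continuous_rhoK (fun _ hy => rhoK_eq_zero hy) (by fun_prop)
  · exact (by fun_prop : Continuous _).aestronglyMeasurable
  · refine Eventually.of_forall fun y s hs => ?_
    by_cases hy : y ∈ closedBall (0 : EuclideanSpace ℝ ι) 1
    · rw [indicator_of_mem hy]
      exact hC (s, y) ⟨hs, hy⟩
    · simp [hy, rhoK_eq_zero hy]
  · exact (integrable_indicator_iff measurableSet_closedBall).2
      (integrableOn_const (isCompact_closedBall (0 : EuclideanSpace ℝ ι) 1).measure_lt_top.ne)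
  · refine Eventually.of_forall fun y s _ => ?_
    have hA : HasDerivAt (fun s : ℝ => x + s • y) y s := by
      simpa using ((hasDerivAt_id s).smul_const y).const_add x
    exact ((hw.differentiable (by norm_num) _).hasFDerivAt.comp_hasDerivAt s hA).const_mul _

end mean

section extension

variable {F : Type*} [NormedAddCommGroup F] [InnerProductSpace ℝ F] [FiniteDimensional ℝ F]

theorem isOpen_setOf_contDiffAt_two (w : F → ℝ) : IsOpen {y | ContDiffAt ℝ 2 w y} :=
  isOpen_iff_mem_nhds.2 fun y (hy : ContDiffAt ℝ 2 w y) => hy.eventually (by simp)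

/-- A function which is `C²` near a closed ball agrees near that ball with a `C²` function. -/
theorem exists_contDiff_extension {w : F → ℝ} {x : F} {R : ℝ} (hR : 0 < R)
    (hw : ∀ y ∈ closedBall x R, ContDiffAt ℝ 2 w y) :
    ∃ w' : F → ℝ, ContDiff ℝ 2 w' ∧ ∀ y ∈ closedBall x R, w' =ᶠ[𝓝 y] w := by
  obtain ⟨δ, hδ, hsub⟩ := (isCompact_closedBall x R).exists_cthickening_subset_open
    (isOpen_setOf_contDiffAt_two w) hw
  have hsub' : closedBall x (R + δ) ⊆ {y | ContDiffAt ℝ 2 w y} := by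
    rw [cthickening_closedBall hδ.le hR.le] at hsub
    rwa [add_comm]
  let χ : ContDiffBump x := ⟨R + δ / 2, R + δ, by linarith, by linarith⟩
  refine ⟨fun y => χ y * w y, ?_, ?_⟩
  · rw [contDiff_iff_contDiffAt]
    intro y
    by_cases hy : y ∈ closedBall x (R + δ)
    · exact χ.contDiffAt.mul (hsub' hy)
    · have hev : (fun y => χ y * w y) =ᶠ[𝓝 y] fun _ => 0 := by
        filter_upwards [isClosed_closedBall.isOpen_compl.mem_nhds hy] with z hz
        have hz' : ¬ dist z x ≤ R + δ := hz
        rw [χ.zero_of_le_dist (not_le.1 hz').le, zero_mul]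
      exact contDiffAt_const.congr_of_eventuallyEq hev
  · intro y hy
    have : y ∈ ball x (R + δ / 2) := closedBall_subset_ball (by linarith) hy
    filter_upwards [isOpen_ball.mem_nhds this] with z hz
    rw [χ.one_of_mem_closedBall (ball_subset_closedBall hz), one_mul]

end extension

section gradient

variable (ι : Type*) [Fintype ι]

/-- Interior gradient estimate for the Poisson equation. -/
theorem exists_gradient_bound : ∃ C : ℝ, 1 ≤ C ∧ ∀ (w : EuclideanSpace ℝ ι → ℝ)
    (x : EuclideanSpace ℝ ι) (R M G : ℝ), 0 < R →
    (∀ y ∈ closedBall x (2 * R), ContDiffAt ℝ 2 w y) →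
    (∀ y ∈ closedBall x (2 * R), |w y| ≤ M) →
    (∀ y ∈ closedBall x (2 * R), |lapl w y| ≤ G) →
    ‖fderiv ℝ w x‖ ≤ C * (M / R + G * R) := by
  obtain ⟨L, hL1, hL⟩ := exists_rhoK_lipschitz (EuclideanSpace ℝ ι)
  set V := volume.real (closedBall (0 : EuclideanSpace ℝ ι) 2)
  set c := ∫ y : EuclideanSpace ℝ ι, rhoK y with hc
  have hcpos : 0 < c := integral_rhoK_pos
  set K := 2 * L * V with hK
  have hK0 : 0 ≤ K := by positivity
  refine ⟨K / c + 1, by linarith [div_nonneg hK0 hcpos.le], ?_⟩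
  intro w x R M G hR hw hM hG
  obtain ⟨w', hw', hww'⟩ := exists_contDiff_extension (by linarith : 0 < 2 * R) hw
  have hxm : x ∈ closedBall x (2 * R) := mem_closedBall_self (by linarith)
  have hM0 : 0 ≤ M := (abs_nonneg _).trans (hM x hxm)
  have hG0 : 0 ≤ G := (abs_nonneg _).trans (hG x hxm)
  have hM' : ∀ y ∈ closedBall x (2 * R), |w' y| ≤ M := fun y hy => by
    rw [(hww' y hy).self_of_nhds]; exact hM y hy
  have hG' : ∀ y ∈ closedBall x (2 * R), |lapl w' y| ≤ G := fun y hy => by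
    rw [lapl_congr (hww' y hy)]; exact hG y hy
  rw [← (hww' x hxm).fderiv_eq]
  have hclose : ∀ a : EuclideanSpace ℝ ι, ‖a‖ ≤ R →
      |w' (x + a) - w' x| ≤ K / c * (M / R + G * R) * ‖a‖ := by
    intro a ha
    set g : ℝ → ℝ := fun r => (∫ y, rhoK y * w' (x + a + r • y)) - ∫ y, rhoK y * w' (x + r • y)
      with hg
    have hsub : ∀ r ≤ R, closedBall x (r + ‖a‖) ⊆ closedBall x (2 * R) := fun r hr =>
      closedBall_subset_closedBall (by linarith)
    have hd : ∀ r, HasDerivAt g ((r * ∫ y, psiK y * lapl w' (x + a + r • y))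
        - r * ∫ y, psiK y * lapl w' (x + r • y)) r := fun r =>
      (hasDerivAt_mean hw' _ r).sub (hasDerivAt_mean hw' _ r)
    have hbd : ∀ r ∈ Ico 0 R, ‖(r * ∫ y, psiK y * lapl w' (x + a + r • y))
        - r * ∫ y, psiK y * lapl w' (x + r • y)‖ ≤ K * G * ‖a‖ := by
      intro r hr
      rcases hr.1.eq_or_lt with h0 | h0
      · rw [← h0]; simp; positivity
      · have := abs_integral_kernel_translate_sub_le (x := x) (a := a) (L := L) continuous_psiK
          (fun _ hy => psiK_eq_zero hy)
          (fun y z => (abs_psiK_sub_le y z).trans (le_mul_of_one_le_left (norm_nonneg _) hL1))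
          (fun y => (abs_psiK_le y).trans hL1) h0 (continuous_lapl hw')
          (fun y hy => hG' y (hsub r hr.2.le hy))
        rw [← mul_sub, norm_mul, Real.norm_eq_abs, Real.norm_eq_abs, abs_of_pos h0]
        calc _ ≤ r * (K * G * (‖a‖ / r)) := by gcongr
          _ = _ := by field_simp
    have hmv := norm_image_sub_le_of_norm_deriv_le_segment' (f := g) (a := 0) (b := R)
      (fun r _ => (hd r).hasDerivWithinAt) hbd R (right_mem_Icc.2 hR.le)
    have hg0 : g 0 = c * (w' (x + a) - w' x) := by
      simp only [hg, zero_smul, add_zero, integral_mul_const, hc]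
      ring
    have hgR : |g R| ≤ K * M * (‖a‖ / R) :=
      abs_integral_kernel_translate_sub_le (x := x) (a := a) (L := L) continuous_rhoK
          (fun _ hy => rhoK_eq_zero hy) hL (fun y => (abs_rhoK_le y).trans hL1) hR hw'.continuous
          (fun y hy => hM' y (hsub R le_rfl hy))
    have h1 : |g 0| ≤ K * M * (‖a‖ / R) + K * G * ‖a‖ * R := by
      have h2 : |g R - g 0| ≤ K * G * ‖a‖ * R := by simpa using hmv
      have h3 : g 0 = g R - (g R - g 0) := by ring
      rw [h3]
      exact (abs_sub _ _).trans (add_le_add hgR h2)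
    rw [hg0, abs_mul, abs_of_pos hcpos] at h1
    have : |w' (x + a) - w' x| ≤ (K * M * (‖a‖ / R) + K * G * ‖a‖ * R) / c := by
      rw [le_div_iff₀ hcpos]; linarith
    calc _ ≤ _ := this
      _ = _ := by field_simp
  have h1 : ‖fderiv ℝ w' x‖ ≤ K / c * (M / R + G * R) := by
    refine norm_fderiv_le_of_lip' ℝ (by positivity) ?_
    filter_upwards [closedBall_mem_nhds x hR] with y hy
    have := hclose (y - x) (by rwa [← mem_closedBall_iff_norm])
    simpa using this
  refine h1.trans ?_
  gcongr
  linarith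

/-- Interior Hessian estimate for the Poisson equation with Lipschitz right-hand side. -/
theorem exists_hessian_bound : ∃ C : ℝ, 1 ≤ C ∧ ∀ (w : EuclideanSpace ℝ ι → ℝ)
    (x : EuclideanSpace ℝ ι) (R M G L : ℝ), 0 < R →
    (∀ y ∈ closedBall x (2 * R), ContDiffAt ℝ 2 w y) →
    (∀ y ∈ closedBall x (2 * R), |w y| ≤ M) →
    (∀ y ∈ closedBall x (2 * R), |lapl w y| ≤ G) → 0 ≤ L →
    (∀ y ∈ closedBall x (2 * R), ∀ z ∈ closedBall x (2 * R),
      |lapl w y - lapl w z| ≤ L * ‖y - z‖) →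
    ‖hess w x‖ ≤ C * (M / R ^ 2 + G + L * R) := by
  obtain ⟨C, hC1, hC⟩ := exists_gradient_bound ι
  refine ⟨8 * C ^ 2, by nlinarith, ?_⟩
  intro w x R M G L hR hw hM hG hL0 hL
  have hxm : x ∈ closedBall x (2 * R) := mem_closedBall_self (by linarith)
  have hM0 : 0 ≤ M := (abs_nonneg _).trans (hM x hxm)
  have hG0 : 0 ≤ G := (abs_nonneg _).trans (hG x hxm)
  set B := C * (M / (R / 2) + G * (R / 2)) with hB
  have hB0 : 0 ≤ B := by positivity
  have hgrad : ∀ y ∈ closedBall x R, ‖fderiv ℝ w y‖ ≤ B := by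
    intro y hy
    have hsub : closedBall y (2 * (R / 2)) ⊆ closedBall x (2 * R) := by
      refine closedBall_subset_closedBall' ?_
      rw [mem_closedBall] at hy
      linarith
    exact hC w y (R / 2) M G (by linarith) (fun z hz => hw z (hsub hz))
      (fun z hz => hM z (hsub hz)) (fun z hz => hG z (hsub hz))
  have hlip : ∀ y ∈ closedBall x R, ∀ z ∈ closedBall x R, |w y - w z| ≤ B * ‖y - z‖ := by
    intro y hy z hz
    have := (convex_closedBall x R).norm_image_sub_le_of_norm_hasFDerivWithin_le (C := B)
      (f := w) (f' := fderiv ℝ w)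
      (fun p hp => ((hw p (closedBall_subset_closedBall (by linarith) hp)).differentiableAt
        (by norm_num)).hasFDerivAt.hasFDerivWithinAt) hgrad hz hy
    simpa using this
  have hdiff : ∀ a : EuclideanSpace ℝ ι, ‖a‖ ≤ R / 4 →
      ‖fderiv ℝ w (x + a) - fderiv ℝ w x‖ ≤
        C * (B / (R / 4) + L * (R / 4)) * ‖a‖ := by
    intro a ha
    have hm : ∀ y ∈ closedBall x (2 * (R / 4)), y ∈ closedBall x R ∧ a + y ∈ closedBall x R := by
      intro y hy
      rw [mem_closedBall_iff_norm] at hy ⊢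
      rw [mem_closedBall_iff_norm]
      refine ⟨by linarith, ?_⟩
      rw [add_sub_assoc]
      linarith [norm_add_le a (y - x)]
    have hbig : closedBall x R ⊆ closedBall x (2 * R) :=
      closedBall_subset_closedBall (by linarith)
    have htr : ∀ y, ContDiffAt ℝ 2 w (a + y) → ContDiffAt ℝ 2 (fun y => w (a + y)) y := by
      intro y hy
      exact ContDiffAt.comp y hy (contDiffAt_const.add contDiffAt_id)
    have hlt : ∀ y, ContDiffAt ℝ 2 w (a + y) → lapl (fun y => w (a + y)) y = lapl w (a + y) := by
      intro y hy
      have := lapl_comp_affine (w := w) (x := y) a 1 (by simpa using hy)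
      simpa using this
    have h := hC (fun y => w (a + y) - w y) x (R / 4) (B * ‖a‖) (L * ‖a‖) (by linarith)
      (fun y hy => (htr y (hw _ (hbig (hm y hy).2))).sub (hw _ (hbig (hm y hy).1)))
      (fun y hy => by
        have := hlip _ (hm y hy).2 _ (hm y hy).1
        simpa using this)
      (fun y hy => by
        rw [lapl_sub (htr y (hw _ (hbig (hm y hy).2))) (hw _ (hbig (hm y hy).1)),
          hlt y (hw _ (hbig (hm y hy).2))]
        have := hL _ (hbig (hm y hy).2) _ (hbig (hm y hy).1)
        simpa using this)
    have hx := hm x (mem_closedBall_self (by linarith))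
    have hfd : fderiv ℝ (fun y => w (a + y) - w y) x = fderiv ℝ w (x + a) - fderiv ℝ w x := by
      rw [fderiv_fun_sub ((htr x (hw _ (hbig hx.2))).differentiableAt (by norm_num))
        ((hw x hxm).differentiableAt (by norm_num)), fderiv_comp_add_left, add_comm]
    rw [hfd] at h
    calc _ ≤ _ := h
      _ = _ := by ring
  have h1 : ‖hess w x‖ ≤ C * (B / (R / 4) + L * (R / 4)) := by
    refine norm_fderiv_le_of_lip' ℝ (by positivity) ?_
    filter_upwards [closedBall_mem_nhds x (by linarith : 0 < R / 4)] with y hy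
    have := hdiff (y - x) (by rwa [← mem_closedBall_iff_norm])
    simpa using this
  refine h1.trans ?_
  have e1 : C * (B / (R / 4) + L * (R / 4))
      = 8 * C ^ 2 * (M / R ^ 2) + 2 * C ^ 2 * G + C / 4 * (L * R) := by
    rw [hB]; field_simp; ring
  rw [e1]
  have hMR : 0 ≤ M / R ^ 2 := by positivity
  have hLR : 0 ≤ L * R := by positivity
  have h5 : C / 4 ≤ 8 * C ^ 2 := by nlinarith
  have h6 : 2 * C ^ 2 * G ≤ 8 * C ^ 2 * G := by gcongr; norm_num
  have h7 := mul_le_mul_of_nonneg_right h5 hLR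
  linarith

end gradient

theorem contDiffOn_two_of_hasFDerivWithinAt {E : Type*} [NormedAddCommGroup E] [NormedSpace ℝ E]
    {w : E → ℝ} {g₁ : E → E →L[ℝ] ℝ} {g₂ : E → E →L[ℝ] E →L[ℝ] ℝ} {s : Set E}
    (h1 : ∀ y ∈ s, HasFDerivWithinAt w (g₁ y) s y) (h2 : ∀ y ∈ s, HasFDerivWithinAt g₁ (g₂ y) s y)
    (h3 : ContinuousOn g₂ s) : ContDiffOn ℝ 2 w s := by
  have e2 : ContDiffOn ℝ (0 + 1) g₁ s := by
    rw [contDiffOn_succ_iff_hasFDerivWithinAt (by simp)]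
    intro x hx
    refine ⟨s, ?_, by simp, g₂, h2, contDiffOn_zero.2 h3⟩
    rw [insert_eq_of_mem hx]; exact self_mem_nhdsWithin
  have e1 : ContDiffOn ℝ (1 + 1) w s := by
    rw [contDiffOn_succ_iff_hasFDerivWithinAt (by simp)]
    intro x hx
    refine ⟨s, ?_, by simp, g₁, h1, by simpa using e2⟩
    rw [insert_eq_of_mem hx]; exact self_mem_nhdsWithin
  have : (1 + 1 : WithTop ℕ∞) = 2 := by norm_num
  rwa [this] at e1

theorem uniformCauchySeqOn_of_norm_sub_le {α G : Type*} [SeminormedAddCommGroup G]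
    {F : ℕ → α → G} {s : Set α}
    (h : ∀ θ > 0, ∃ n, ∀ k ≥ n, ∀ l ≥ n, ∀ y ∈ s, ‖F k y - F l y‖ ≤ θ) :
    UniformCauchySeqOn F atTop s := by
  rw [Metric.uniformCauchySeqOn_iff]
  intro θ hθ
  obtain ⟨n, hn⟩ := h (θ / 2) (by linarith)
  refine ⟨n, fun k hk l hl y hy => ?_⟩
  rw [dist_eq_norm]
  exact (hn k hk l hl y hy).trans_lt (by linarith)

section semilinear

variable {ι : Type*} [Fintype ι] {f : ℝ → ℝ}

/-- `u` is a `C²` solution of `-Δu = f(u)` on `s` with `|u| ≤ M`. -/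
def IsBddSol (f : ℝ → ℝ) (M : ℝ) (s : Set (EuclideanSpace ℝ ι)) (u : EuclideanSpace ℝ ι → ℝ) :
    Prop :=
  ∀ y ∈ s, ContDiffAt ℝ 2 u y ∧ |u y| ≤ M ∧ lapl u y = -f (u y)

theorem exists_bound_lipschitz (hf : ContDiff ℝ 1 f) (M : ℝ) : ∃ L : ℝ, 0 < L ∧
    (∀ s, |s| ≤ M → |f s| ≤ L) ∧ (∀ s, |s| ≤ M → |deriv f s| ≤ L) ∧
    ∀ s t, |s| ≤ M → |t| ≤ M → |f s - f t| ≤ L * |s - t| := by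
  have hIcc : ∀ s : ℝ, |s| ≤ M ↔ s ∈ Icc (-M) M := fun s => abs_le
  obtain ⟨A, hA⟩ := (isCompact_Icc (a := -M) (b := M)).exists_bound_of_continuousOn
    hf.continuous.continuousOn
  obtain ⟨B, hB⟩ := (isCompact_Icc (a := -M) (b := M)).exists_bound_of_continuousOn
    (hf.continuous_deriv le_rfl).continuousOn
  have hA1 : A ≤ |A| + |B| + 1 := by linarith [le_abs_self A, abs_nonneg B]
  have hB1 : B ≤ |A| + |B| + 1 := by linarith [le_abs_self B, abs_nonneg A]
  have hB' : ∀ s, |s| ≤ M → |deriv f s| ≤ |A| + |B| + 1 :=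
    fun s hs => (hB s ((hIcc s).1 hs)).trans hB1
  refine ⟨|A| + |B| + 1, by positivity, fun s hs => (hA s ((hIcc s).1 hs)).trans hA1, hB', ?_⟩
  intro s t hs ht
  exact (convex_Icc (-M) M).norm_image_sub_le_of_norm_hasDerivWithin_le
    (fun x _ => ((hf.differentiable (by norm_num)) x).hasDerivAt.hasDerivWithinAt)
    (fun x hx => hB' x ((hIcc x).2 hx)) ((hIcc t).1 ht) ((hIcc s).1 hs)

variable (ι) in
/-- Interior estimates, including continuous dependence in `C²`, for `-Δu = f(u)`. -/
theorem exists_semilinear_estimates (hf : ContDiff ℝ 1 f) (M : ℝ) {R : ℝ} (hR : 0 < R) :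
    ∃ K : ℝ, 0 ≤ K ∧ (∀ (u : EuclideanSpace ℝ ι → ℝ) x₀, IsBddSol f M (closedBall x₀ (8 * R)) u →
        ∀ y ∈ closedBall x₀ (4 * R), ‖fderiv ℝ u y‖ ≤ K) ∧
      ∀ θ > 0, ∃ ε > 0, ∀ (u v : EuclideanSpace ℝ ι → ℝ) x₀,
        IsBddSol f M (closedBall x₀ (8 * R)) u → IsBddSol f M (closedBall x₀ (8 * R)) v →
        (∀ y ∈ closedBall x₀ (4 * R), |u y - v y| ≤ ε) → ∀ y ∈ closedBall x₀ R,
          ‖fderiv ℝ u y - fderiv ℝ v y‖ ≤ θ ∧ ‖hess u y - hess v y‖ ≤ θ := by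
  obtain ⟨L, hL0, hLf, hLd, hLl⟩ := exists_bound_lipschitz hf M
  obtain ⟨C₁, hC₁, hG1⟩ := exists_gradient_bound ι
  obtain ⟨C₂, hC₂, hG2⟩ := exists_hessian_bound ι
  set K := C₁ * (|M| / (2 * R) + L * (2 * R)) with hK
  have hK0 : 0 ≤ K := by positivity
  have hgrad : ∀ (u : EuclideanSpace ℝ ι → ℝ) x₀, IsBddSol f M (closedBall x₀ (8 * R)) u →
        ∀ y ∈ closedBall x₀ (4 * R), ‖fderiv ℝ u y‖ ≤ K := by
    intro u x₀ hu y hy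
    have hsub : closedBall y (2 * (2 * R)) ⊆ closedBall x₀ (8 * R) := by
      refine closedBall_subset_closedBall' ?_
      rw [mem_closedBall] at hy
      linarith
    refine hG1 u y (2 * R) |M| L (by linarith) (fun z hz => (hu z (hsub hz)).1)
      (fun z hz => (hu z (hsub hz)).2.1.trans (le_abs_self _)) (fun z hz => ?_)
    rw [(hu z (hsub hz)).2.2, abs_neg]
    exact hLf _ (hu z (hsub hz)).2.1
  refine ⟨K, hK0, hgrad, ?_⟩
  intro θ hθ
  set A := C₁ * (1 / R + L * R) with hA
  have hA0 : 0 < A := by positivity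
  set B := C₂ * (1 / (R / 2) ^ 2 + L + (K + L * A) * (R / 2)) with hB
  have hB0 : 0 < B := by positivity
  set t := θ / (A + B) with ht
  have ht0 : 0 < t := by positivity
  have hAt : A * t ≤ θ := by
    rw [ht, ← mul_div_assoc, div_le_iff₀ (by positivity)]; nlinarith
  have hBt : B * t ≤ θ := by
    rw [ht, ← mul_div_assoc, div_le_iff₀ (by positivity)]; nlinarith
  have huc := (isCompact_Icc (a := -M) (b := M)).uniformContinuousOn_of_continuous
    (hf.continuous_deriv le_rfl).continuousOn
  rw [Metric.uniformContinuousOn_iff] at huc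
  obtain ⟨δ, hδ, hδ'⟩ := huc t ht0
  refine ⟨min t (δ / 2), by positivity, ?_⟩
  intro u v x₀ hu hv huv
  have s48 : closedBall x₀ (4 * R) ⊆ closedBall x₀ (8 * R) :=
    closedBall_subset_closedBall (by linarith)
  have s24 : closedBall x₀ (2 * R) ⊆ closedBall x₀ (4 * R) :=
    closedBall_subset_closedBall (by linarith)
  have s12 : closedBall x₀ R ⊆ closedBall x₀ (2 * R) :=
    closedBall_subset_closedBall (by linarith)
  have hd2 : ∀ z ∈ closedBall x₀ (4 * R), ContDiffAt ℝ 2 (fun y => u y - v y) z := fun z hz =>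
    (hu z (s48 hz)).1.sub (hv z (s48 hz)).1
  have hdl : ∀ z ∈ closedBall x₀ (4 * R),
      lapl (fun y => u y - v y) z = -(f (u z) - f (v z)) := fun z hz => by
    rw [lapl_sub (hu z (s48 hz)).1 (hv z (s48 hz)).1, (hu z (s48 hz)).2.2, (hv z (s48 hz)).2.2]
    ring
  have hdM : ∀ z ∈ closedBall x₀ (4 * R), |u z - v z| ≤ t := fun z hz =>
    (huv z hz).trans (min_le_left _ _)
  have hdG : ∀ z ∈ closedBall x₀ (4 * R), |lapl (fun y => u y - v y) z| ≤ L * t := fun z hz => by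
    rw [hdl z hz, abs_neg]
    exact (hLl _ _ (hu z (s48 hz)).2.1 (hv z (s48 hz)).2.1).trans (by gcongr; exact hdM z hz)
  have hfd : ∀ z ∈ closedBall x₀ (4 * R), fderiv ℝ (fun y => u y - v y) z
      = fderiv ℝ u z - fderiv ℝ v z := fun z hz =>
    fderiv_fun_sub ((hu z (s48 hz)).1.differentiableAt (by norm_num))
      ((hv z (s48 hz)).1.differentiableAt (by norm_num))
  have hgd : ∀ y ∈ closedBall x₀ (2 * R), ‖fderiv ℝ u y - fderiv ℝ v y‖ ≤ A * t := by
    intro y hy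
    have hsub : closedBall y (2 * R) ⊆ closedBall x₀ (4 * R) := by
      refine closedBall_subset_closedBall' ?_
      rw [mem_closedBall] at hy
      linarith
    rw [← hfd y (s24 hy)]
    refine (hG1 _ y R t (L * t) hR (fun z hz => hd2 z (hsub hz)) (fun z hz => hdM z (hsub hz))
      (fun z hz => hdG z (hsub hz))).trans (le_of_eq ?_)
    rw [hA]; ring
  have hlip : ∀ y ∈ closedBall x₀ (2 * R), ∀ z ∈ closedBall x₀ (2 * R),
      |lapl (fun y => u y - v y) y - lapl (fun y => u y - v y) z|
        ≤ (K * t + L * (A * t)) * ‖y - z‖ := by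
    intro y hy z hz
    rw [hdl y (s24 hy), hdl z (s24 hz)]
    have hder : ∀ p ∈ closedBall x₀ (2 * R), HasFDerivWithinAt (fun p => -(f (u p) - f (v p)))
        (-(deriv f (u p) • fderiv ℝ u p - deriv f (v p) • fderiv ℝ v p)) (closedBall x₀ (2 * R))
        p := by
      intro p hp
      have h1 := ((hu p (s48 (s24 hp))).1.differentiableAt (by norm_num)).hasFDerivAt
      have h2 := ((hv p (s48 (s24 hp))).1.differentiableAt (by norm_num)).hasFDerivAt
      have hfd' := fun q => ((hf.differentiable (by norm_num)) q).hasDerivAt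
      exact (((hfd' _).comp_hasFDerivAt p h1).sub
        ((hfd' _).comp_hasFDerivAt p h2)).neg.hasFDerivWithinAt
    refine (convex_closedBall x₀ (2 * R)).norm_image_sub_le_of_norm_hasFDerivWithin_le hder
      (fun p hp => ?_) hz hy
    have hp4 := s24 hp
    have e : deriv f (u p) • fderiv ℝ u p - deriv f (v p) • fderiv ℝ v p
        = (deriv f (u p) - deriv f (v p)) • fderiv ℝ u p
          + deriv f (v p) • (fderiv ℝ u p - fderiv ℝ v p) := by
      rw [sub_smul, smul_sub]; abel
    rw [norm_neg, e]
    refine (norm_add_le _ _).trans ?_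
    rw [norm_smul, norm_smul]
    have h1 : ‖deriv f (u p) - deriv f (v p)‖ ≤ t := by
      have := hδ' (u p) (abs_le.1 (hu p (s48 hp4)).2.1) (v p) (abs_le.1 (hv p (s48 hp4)).2.1)
        (by
          rw [Real.dist_eq]
          exact ((huv p hp4).trans (min_le_right _ _)).trans_lt (by linarith))
      rw [dist_eq_norm] at this
      exact this.le
    have h2 := hgrad u x₀ hu p hp4
    have h3 : ‖deriv f (v p)‖ ≤ L := hLd _ (hv p (s48 hp4)).2.1
    have h4 := hgd p hp
    calc _ ≤ t * K + L * (A * t) := by gcongr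
      _ = _ := by ring
  intro y hy
  refine ⟨(hgd y (s12 hy)).trans hAt, ?_⟩
  have hsub : closedBall y (2 * (R / 2)) ⊆ closedBall x₀ (2 * R) := by
    refine closedBall_subset_closedBall' ?_
    rw [mem_closedBall] at hy
    linarith
  rw [← hess_sub (hu y (s48 (s24 (s12 hy)))).1 (hv y (s48 (s24 (s12 hy)))).1]
  refine ((hG2 _ y (R / 2) t (L * t) (K * t + L * (A * t)) (by linarith)
    (fun z hz => hd2 z (s24 (hsub hz))) (fun z hz => hdM z (s24 (hsub hz)))
    (fun z hz => hdG z (s24 (hsub hz))) (by positivity)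
    (fun z hz z' hz' => hlip z (hsub hz) z' (hsub hz'))).trans (le_of_eq ?_)).trans hBt
  rw [hB]; ring

/-- A bounded monotone limit of solutions of `-Δu = f(u)` is a solution. -/
theorem isBddSol_of_tendsto (hf : ContDiff ℝ 1 f) {M : ℝ} {O : Set (EuclideanSpace ℝ ι)}
    (hO : IsOpen O) {u : ℕ → EuclideanSpace ℝ ι → ℝ} {w : EuclideanSpace ℝ ι → ℝ}
    (hu : ∀ k, IsBddSol f M O (u k)) (hmono : ∀ y ∈ O, Monotone fun k => u k y)
    (hlim : ∀ y ∈ O, Tendsto (fun k => u k y) atTop (𝓝 (w y))) : IsBddSol f M O w := by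
  intro x₀ hx₀
  obtain ⟨R, hR, hsub⟩ : ∃ R > 0, closedBall x₀ (8 * R) ⊆ O := by
    obtain ⟨r, hr, h⟩ := Metric.nhds_basis_closedBall.mem_iff.1 (hO.mem_nhds hx₀)
    exact ⟨r / 8, by positivity, by rwa [mul_div_cancel₀ r (by norm_num)]⟩
  have hu' : ∀ k, IsBddSol f M (closedBall x₀ (8 * R)) (u k) := fun k y hy => hu k y (hsub hy)
  obtain ⟨K, hK0, hK, hpair⟩ := exists_semilinear_estimates ι hf M hR
  have s4 : closedBall x₀ (4 * R) ⊆ O :=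
    (closedBall_subset_closedBall (by linarith)).trans hsub
  have s1 : closedBall x₀ R ⊆ O := (closedBall_subset_closedBall (by linarith)).trans hsub
  have hlip : ∀ k, ∀ y ∈ closedBall x₀ (4 * R), ∀ z ∈ closedBall x₀ (4 * R),
      |u k y - u k z| ≤ K * dist y z := by
    intro k y hy z hz
    rw [dist_eq_norm]
    exact (convex_closedBall x₀ (4 * R)).norm_image_sub_le_of_norm_hasFDerivWithin_le
      (fun p hp => ((hu k p (s4 hp)).1.differentiableAt (by norm_num)).hasFDerivAt.hasFDerivWithinAt)
      (fun p hp => hK _ x₀ (hu' k) p hp) hz hy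
  have hwlip : LipschitzOnWith ⟨K, hK0⟩ w (closedBall x₀ (4 * R)) := by
    refine LipschitzOnWith.of_dist_le_mul fun y hy z hz => ?_
    rw [Real.dist_eq]
    exact le_of_tendsto ((hlim y (s4 hy)).sub (hlim z (s4 hz))).abs
      (Eventually.of_forall fun k => hlip k y hy z hz)
  have hunif : TendstoUniformlyOn u w atTop (closedBall x₀ (4 * R)) :=
    Monotone.tendstoUniformlyOn_of_forall_tendsto (isCompact_closedBall x₀ (4 * R))
      (fun k y hy => (hu k y (s4 hy)).1.continuousAt.continuousWithinAt)
      (fun y hy => hmono y (s4 hy)) hwlip.continuousOn (fun y hy => hlim y (s4 hy))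
  have hcauchy := hunif.uniformCauchySeqOn
  rw [Metric.uniformCauchySeqOn_iff] at hcauchy
  have hc : ∀ θ > 0, ∃ n, ∀ k ≥ n, ∀ l ≥ n, ∀ y ∈ closedBall x₀ R,
      ‖fderiv ℝ (u k) y - fderiv ℝ (u l) y‖ ≤ θ ∧ ‖hess (u k) y - hess (u l) y‖ ≤ θ := by
    intro θ hθ
    obtain ⟨ε, hε, h⟩ := hpair θ hθ
    obtain ⟨n, hn⟩ := hcauchy ε hε
    refine ⟨n, fun k hk l hl => h (u k) (u l) x₀ (hu' k) (hu' l) fun y hy => ?_⟩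
    exact (hn k hk l hl y hy).le
  have hc1 : UniformCauchySeqOn (fun k => fderiv ℝ (u k)) atTop (ball x₀ R) :=
    uniformCauchySeqOn_of_norm_sub_le fun θ hθ => (hc θ hθ).imp fun n hn k hk l hl y hy =>
      (hn k hk l hl y (ball_subset_closedBall hy)).1
  have hc2 : UniformCauchySeqOn (fun k => hess (u k)) atTop (ball x₀ R) :=
    uniformCauchySeqOn_of_norm_sub_le
      (G := EuclideanSpace ℝ ι →L[ℝ] EuclideanSpace ℝ ι →L[ℝ] ℝ) (F := fun k => hess (u k))
      fun θ hθ => (hc θ hθ).imp fun n hn k hk l hl y hy =>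
        (hn k hk l hl y (ball_subset_closedBall hy)).2
  have hl1 : ∀ y, ∃ g, y ∈ ball x₀ R → Tendsto (fun k => fderiv ℝ (u k) y) atTop (𝓝 g) := by
    intro y
    by_cases hy : y ∈ ball x₀ R
    · obtain ⟨g, hg⟩ := cauchySeq_tendsto_of_complete (hc1.cauchySeq hy)
      exact ⟨g, fun _ => hg⟩
    · exact ⟨0, fun h => absurd h hy⟩
  have hl2 : ∀ y, ∃ g, y ∈ ball x₀ R → Tendsto (fun k => hess (u k) y) atTop (𝓝 g) := by
    intro y
    by_cases hy : y ∈ ball x₀ R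
    · obtain ⟨g, hg⟩ := cauchySeq_tendsto_of_complete (hc2.cauchySeq hy)
      exact ⟨g, fun _ => hg⟩
    · exact ⟨0, fun h => absurd h hy⟩
  choose g₁ hg₁ using hl1
  choose g₂ hg₂ using hl2
  have hU1 := hc1.tendstoUniformlyOn_of_tendsto hg₁
  have hU2 := hc2.tendstoUniformlyOn_of_tendsto hg₂
  have sb : ball x₀ R ⊆ O := ball_subset_closedBall.trans s1
  have hD1 : ∀ y ∈ ball x₀ R, HasFDerivAt w (g₁ y) y := fun y hy =>
    hasFDerivAt_of_tendstoUniformlyOn isOpen_ball hU1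
      (fun k z hz => ((hu k z (sb hz)).1.differentiableAt (by norm_num)).hasFDerivAt)
      (fun z hz => hlim z (sb hz)) hy
  have hD2 : ∀ y ∈ ball x₀ R, HasFDerivAt g₁ (g₂ y) y := fun y hy =>
    hasFDerivAt_of_tendstoUniformlyOn isOpen_ball hU2
      (fun k z hz => (hu k z (sb hz)).1.hasFDerivAt_fderiv) hg₁ hy
  have hcont : ContinuousOn g₂ (ball x₀ R) := by
    refine hU2.continuousOn (Eventually.of_forall fun k z hz => ?_).frequently
    exact ((((hu k z (sb hz)).1.fderiv_right (m := 1) (by norm_num)).fderiv_right (m := 0)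
      (by norm_num)).continuousAt).continuousWithinAt
  have hx : x₀ ∈ ball x₀ R := mem_ball_self hR
  have hcd : ContDiffOn ℝ 2 w (ball x₀ R) :=
    contDiffOn_two_of_hasFDerivWithinAt (fun y hy => (hD1 y hy).hasFDerivWithinAt)
      (fun y hy => (hD2 y hy).hasFDerivWithinAt) hcont
  refine ⟨hcd.contDiffAt (isOpen_ball.mem_nhds hx),
    le_of_tendsto (hlim x₀ hx₀).abs (Eventually.of_forall fun k => (hu k x₀ hx₀).2.1), ?_⟩
  have hh : hess w x₀ = g₂ x₀ := hess_eq_of_hasFDerivAt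
    ((isOpen_ball.eventually_mem hx).mono hD1) (hD2 x₀ hx)
  have ht1 : Tendsto (fun k => lapl (u k) x₀) atTop (𝓝 (lapl w x₀)) := by
    simp only [lapl, hh]
    refine tendsto_finsetSum _ fun i _ => ?_
    have hev : Continuous fun B : EuclideanSpace ℝ ι →L[ℝ] EuclideanSpace ℝ ι →L[ℝ] ℝ =>
      B (EuclideanSpace.basisFun ι ℝ i) (EuclideanSpace.basisFun ι ℝ i) := by fun_prop
    exact (hev.tendsto _).comp (hg₂ x₀ hx)
  have ht2 : Tendsto (fun k => lapl (u k) x₀) atTop (𝓝 (-f (w x₀))) := by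
    simp only [fun k => (hu k x₀ hx₀).2.2]
    exact ((hf.continuous.tendsto _).comp (hlim x₀ hx₀)).neg
  exact tendsto_nhds_unique ht1 ht2

end semilinear

section barrier

variable {ι : Type*} [Fintype ι]

theorem lapl_norm_sub_sq (x z : EuclideanSpace ℝ ι) :
    lapl (fun y => ‖y - x‖ ^ 2) z = 2 * Fintype.card ι := by
  obtain ⟨B, hB⟩ : ∃ B : EuclideanSpace ℝ ι →L[ℝ] EuclideanSpace ℝ ι →L[ℝ] ℝ,
      ∀ u v, B u v = inner ℝ u v := ⟨innerSL ℝ, fun _ _ => rfl⟩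
  have h : hess (fun y => ‖y - x‖ ^ 2) z = (2 : ℝ) • B := by
    refine hess_eq_of_hasFDerivAt (w' := fun y => (2 : ℝ) • B (y - x))
      (Eventually.of_forall fun y => ?_) ?_
    · have := ((hasStrictFDerivAt_norm_sq (y - x)).hasFDerivAt).comp y
        ((hasFDerivAt_id y).sub_const x)
      refine HasFDerivAt.congr_fderiv this ?_
      ext v; simp [hB]
    · have := (B.hasFDerivAt.comp z ((hasFDerivAt_id z).sub_const x)).const_smul (2 : ℝ)
      exact this.congr_fderiv (by ext; simp)
  simp [lapl, h, hB, mul_comm]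

theorem le_barrier {c₀ C₀ : ℝ} (hc₀ : 0 < c₀) (hC₀ : 0 < C₀) : ∃ r₀ > 0, ∃ C ≥ 1,
    ∀ (σ h : EuclideanSpace ℝ ι → ℝ) (x : EuclideanSpace ℝ ι) (r M : ℝ), 0 < r → r ≤ r₀ → 0 ≤ M →
    (∀ y ∈ closedBall x r, ContDiffAt ℝ 2 σ y ∧ |σ y| ≤ C₀ * r ∧ |lapl σ y| ≤ C₀ ∧
      c₀ ≤ ‖fderiv ℝ σ y‖) → 0 ≤ σ x →
    ContinuousOn h (closedBall x r ∩ {y | 0 ≤ σ y}) →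
    (∀ y ∈ closedBall x r, 0 ≤ σ y → h y ≤ M) →
    (∀ y ∈ closedBall x r, σ y = 0 → h y = 0) →
    (∀ y ∈ closedBall x r, 0 < σ y → ContDiffAt ℝ 2 h y ∧ -(M / r ^ 2) ≤ lapl h y) →
    h x ≤ C * M * (σ x / r) := by
  set κ := 1 / (4 * C₀) with hκ
  have hκ0 : 0 < κ := by positivity
  set n : ℝ := (Fintype.card ι : ℝ) with hn
  have hn0 : 0 ≤ n := by positivity
  set A₀ := (2 * n + 2) / (κ * c₀ ^ 2) with hA₀
  have hA00 : 0 < A₀ := by positivity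
  refine ⟨κ * c₀ ^ 2 / C₀, by positivity, A₀ + 1, by linarith, ?_⟩
  intro σ h x r M hr hr0 hM hσ hσx hhc hhM hh0 hhl
  have hxm : x ∈ closedBall x r := mem_closedBall_self hr.le
  have hσr : 0 ≤ σ x / r := by positivity
  suffices H : h x ≤ A₀ * M * (σ x / r) from
    H.trans (by
      have : 0 ≤ M * (σ x / r) := by positivity
      nlinarith)
  rcases hM.eq_or_lt with hM0 | hM0
  · rw [← hM0] at hhM ⊢
    simpa using hhM x hxm hσx
  set A := A₀ * M / r with hA
  have hA0 : 0 < A := by positivity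
  set K := κ / r with hK
  have hK0 : 0 < K := by positivity
  set β : EuclideanSpace ℝ ι → ℝ := fun z =>
    (A * σ z + (-(A * K)) * (σ z * σ z)) + M / r ^ 2 * ‖z - x‖ ^ 2 with hβ
  set S := closedBall x r ∩ {y | 0 ≤ σ y} with hS
  have hσc : ContinuousOn σ (closedBall x r) := fun y hy =>
    (hσ y hy).1.continuousAt.continuousWithinAt
  have hScl : IsClosed S := hσc.preimage_isClosed_of_isClosed isClosed_closedBall isClosed_Ici
  have hScpt : IsCompact S := (isCompact_closedBall x r).of_isClosed_subset hScl inter_subset_left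
  have hβc : ContinuousOn β S := by
    have := hσc.mono (inter_subset_left : S ⊆ closedBall x r)
    fun_prop
  have hKσ : ∀ y ∈ closedBall x r, 0 ≤ σ y → K * σ y ≤ 1 / 4 := by
    intro y hy _
    have h1 : σ y ≤ C₀ * r := (le_abs_self _).trans (hσ y hy).2.1
    calc K * σ y ≤ K * (C₀ * r) := by gcongr
      _ = 1 / 4 := by rw [hK, hκ]; field_simp
  by_contra! hcon
  have hpos : 0 < h x - β x := by
    have : β x ≤ A₀ * M * (σ x / r) := by
      have h1 : 0 ≤ A * K * (σ x * σ x) := by positivity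
      have h2 : A * σ x = A₀ * M * (σ x / r) := by rw [hA]; ring
      simp only [hβ, sub_self, norm_zero]
      linarith
    linarith
  obtain ⟨z, hzS, hz⟩ := hScpt.exists_isMaxOn ⟨x, hxm, hσx⟩ (hhc.sub hβc)
  have hz' : ∀ y ∈ S, h y - β y ≤ h z - β z := fun y hy => hz hy
  have hzpos : 0 < h z - β z := hpos.trans_le (hz' x ⟨hxm, hσx⟩)
  obtain ⟨hzb, hzσ⟩ := hzS
  have hzσ : 0 ≤ σ z := hzσ
  have hq : 0 ≤ A * σ z + (-(A * K)) * (σ z * σ z) := by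
    have h1 := hKσ z hzb hzσ
    have h2 : A * σ z + (-(A * K)) * (σ z * σ z) = A * σ z * (1 - K * σ z) := by ring
    rw [h2]
    exact mul_nonneg (by positivity) (by linarith)
  have hσpos : 0 < σ z := by
    rcases hzσ.eq_or_lt with h0 | h0
    · exfalso
      have h1 := hh0 z hzb h0.symm
      have h2 : 0 ≤ M / r ^ 2 * ‖z - x‖ ^ 2 := by positivity
      simp only [hβ] at hzpos
      linarith
    · exact h0
  have hzr : z ∈ ball x r := by
    rw [mem_ball_iff_norm]
    by_contra! hge
    have h1 := hhM z hzb hzσ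
    have h2 : M ≤ M / r ^ 2 * ‖z - x‖ ^ 2 := by
      rw [div_mul_eq_mul_div, le_div_iff₀ (by positivity)]
      gcongr
    simp only [hβ] at hzpos
    linarith
  obtain ⟨hσ2, hσC, hσl, hσg⟩ := hσ z hzb
  obtain ⟨hh2, hhl'⟩ := hhl z hzb hσpos
  have hn2 : ContDiffAt ℝ 2 (fun y : EuclideanSpace ℝ ι => ‖y - x‖ ^ 2) z :=
    ((contDiff_id.sub contDiff_const).norm_sq ℝ).contDiffAt
  have hc1 : ContDiffAt ℝ 2 (fun y => A * σ y) z := contDiffAt_const.mul hσ2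
  have hc2 : ContDiffAt ℝ 2 (fun y => (-(A * K)) * (σ y * σ y)) z :=
    contDiffAt_const.mul (hσ2.mul hσ2)
  have hc3 : ContDiffAt ℝ 2 (fun y => M / r ^ 2 * ‖y - x‖ ^ 2) z := contDiffAt_const.mul hn2
  have hβ2 : ContDiffAt ℝ 2 β z := (hc1.add hc2).add hc3
  have hlb : lapl β z = A * lapl σ z - A * K * (2 * (σ z * lapl σ z) + 2 * ‖fderiv ℝ σ z‖ ^ 2)
      + M / r ^ 2 * (2 * n) := by
    rw [hβ, lapl_add (hc1.add hc2) hc3, lapl_add hc1 hc2, lapl_const_mul _ hσ2,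
      lapl_const_mul _ (hσ2.mul hσ2), lapl_const_mul _ hn2, lapl_mul hσ2 hσ2, lapl_norm_sub_sq,
      ← sum_clm_sq]
    simp only [← pow_two]
    ring
  have hmax : IsLocalMax (fun y => h y - β y) z := by
    have hU : ∀ᶠ y in 𝓝 z, y ∈ ball x r ∧ 0 < σ y :=
      (isOpen_ball.eventually_mem hzr).and (hσ2.continuousAt.eventually (lt_mem_nhds hσpos))
    filter_upwards [hU] with y hy
    exact hz' y ⟨ball_subset_closedBall hy.1, hy.2.le⟩
  have hle := hmax.lapl_nonpos (hh2.sub hβ2)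
  rw [lapl_sub hh2 hβ2, hlb] at hle
  have e1 : A * lapl σ z - A * K * (2 * (σ z * lapl σ z)) ≤ A * C₀ := by
    have h1 := hKσ z hzb hzσ
    have h2 : A * lapl σ z - A * K * (2 * (σ z * lapl σ z))
        = A * ((1 - 2 * (K * σ z)) * lapl σ z) := by ring
    rw [h2]
    refine mul_le_mul_of_nonneg_left ?_ hA0.le
    have h3 : 0 ≤ K * σ z := by positivity
    calc (1 - 2 * (K * σ z)) * lapl σ z ≤ (1 - 2 * (K * σ z)) * C₀ :=
          mul_le_mul_of_nonneg_left ((le_abs_self _).trans hσl) (by linarith)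
      _ ≤ C₀ := by nlinarith
  have e2 : A * K * c₀ ^ 2 ≤ A * K * ‖fderiv ℝ σ z‖ ^ 2 := by gcongr
  have e3 : C₀ ≤ K * c₀ ^ 2 := by
    rw [le_div_iff₀ hC₀] at hr0
    rw [hK, div_mul_eq_mul_div, le_div_iff₀ hr]
    linarith
  have e4 : A * C₀ ≤ A * (K * c₀ ^ 2) := by gcongr
  have e5 : A * (K * c₀ ^ 2) = M / r ^ 2 * (2 * n + 2) := by
    rw [hA, hK, hA₀]; field_simp
  have e6 : 0 < M / r ^ 2 := by positivity
  nlinarith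

/-- Boundary barrier: a solution with bounded data which vanishes on `{σ = 0}` grows at most
linearly in `σ`. -/
theorem exists_barrier_bound (ι : Type*) [Fintype ι] {c₀ C₀ : ℝ} (hc₀ : 0 < c₀) (hC₀ : 0 < C₀) :
    ∃ r₀ > 0, ∃ C ≥ 1,
    ∀ (σ h : EuclideanSpace ℝ ι → ℝ) (x : EuclideanSpace ℝ ι) (r M : ℝ), 0 < r → r ≤ r₀ → 0 ≤ M →
    (∀ y ∈ closedBall x r, ContDiffAt ℝ 2 σ y ∧ |σ y| ≤ C₀ * r ∧ |lapl σ y| ≤ C₀ ∧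
      c₀ ≤ ‖fderiv ℝ σ y‖) → 0 ≤ σ x →
    ContinuousOn h (closedBall x r ∩ {y | 0 ≤ σ y}) →
    (∀ y ∈ closedBall x r, 0 ≤ σ y → |h y| ≤ M) →
    (∀ y ∈ closedBall x r, σ y = 0 → h y = 0) →
    (∀ y ∈ closedBall x r, 0 < σ y → ContDiffAt ℝ 2 h y ∧ |lapl h y| ≤ M / r ^ 2) →
    |h x| ≤ C * M * (σ x / r) := by
  obtain ⟨r₀, hr₀, C, hC, H⟩ := le_barrier (ι := ι) hc₀ hC₀
  refine ⟨r₀, hr₀, C, hC, ?_⟩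
  intro σ h x r M hr hr0 hM hσ hσx hhc hhM hh0 hhl
  rw [abs_le']
  constructor
  · exact H σ h x r M hr hr0 hM hσ hσx hhc (fun y hy hy' => (abs_le.1 (hhM y hy hy')).2) hh0
      fun y hy hy' => ⟨(hhl y hy hy').1, (abs_le.1 (hhl y hy hy').2).1⟩
  · have hneg : (fun y => -h y) = fun y => (-1) * h y := by ext y; ring
    refine H σ (fun y => -h y) x r M hr hr0 hM hσ hσx hhc.neg
      (fun y hy hy' => by linarith [(abs_le.1 (hhM y hy hy')).1])
      (fun y hy hy' => by simp [hh0 y hy hy']) fun y hy hy' => ⟨(hhl y hy hy').1.neg, ?_⟩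
    rw [hneg, lapl_const_mul _ (hhl y hy hy').1]
    linarith [(abs_le.1 (hhl y hy hy').2).2]

end barrier

theorem kap_antitone : Antitone kap := fun _ _ h =>
  Real.smoothTransition.monotone (by linarith)

theorem kapPrim_sub_bounds {s t : ℝ} (ht : 0 ≤ t) :
    0 ≤ kapPrim s - kapPrim (s + t) ∧ kapPrim s - kapPrim (s + t) ≤ t * kap s := by
  have hc : Continuous fun t => kap t / 2 := continuous_kap.div_const 2
  have h : kapPrim s - kapPrim (s + t) = ∫ x in s..(s + t), kap x / 2 := by
    rw [kapPrim, kapPrim, sub_eq_iff_eq_add]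
    exact (intervalIntegral.integral_add_adjacent_intervals (hc.intervalIntegrable _ _)
      (hc.intervalIntegrable _ _)).symm
  rw [h]
  refine ⟨intervalIntegral.integral_nonneg (by linarith) fun x _ => by
    linarith [kap_nonneg x], ?_⟩
  have : ∫ x in s..(s + t), kap x / 2 ≤ ∫ _ in s..(s + t), kap s :=
    intervalIntegral.integral_mono_on (by linarith) (hc.intervalIntegrable _ _)
      intervalIntegrable_const fun x hx => by
        linarith [kap_antitone hx.1, kap_nonneg x]
  simpa using this

theorem kapPrim_nonneg (s : ℝ) : 0 ≤ kapPrim s := by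
  rcases le_total 1 s with h | h
  · rw [kapPrim_eq_zero h]
  · have := (kapPrim_sub_bounds (s := s) (sub_nonneg.2 h)).1
    rwa [add_sub_cancel, kapPrim_eq_zero le_rfl, sub_zero] at this

theorem abs_le_pow_succ_of_deriv {g g' : ℝ → ℝ} {K s : ℝ} {n : ℕ} (hg : ∀ t, HasDerivAt g (g' t) t)
    (h0 : g s = 0) (hK : ∀ t, |g' t| ≤ K * |t - s| ^ n) (t : ℝ) :
    |g t| ≤ K * |t - s| ^ (n + 1) := by
  have hK0 : 0 ≤ K * |t - s| ^ n := (abs_nonneg _).trans (hK t)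
  rcases eq_or_ne t s with rfl | hts
  · simp [h0]
  have hpos : 0 < |t - s| := abs_pos.2 (sub_ne_zero.2 hts)
  have hKK : 0 ≤ K := nonneg_of_mul_nonneg_left hK0 (by positivity)
  have := Convex.norm_image_sub_le_of_norm_hasDerivWithin_le (s := closedBall s |t - s|)
    (C := K * |t - s| ^ n) (x := s) (y := t) (fun x _ => (hg x).hasDerivWithinAt)
    (fun x hx => (hK x).trans (by
      rw [mem_closedBall, Real.dist_eq] at hx
      gcongr)) (convex_closedBall _ _) (mem_closedBall_self hpos.le)
    (by rw [mem_closedBall, Real.dist_eq])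
  rw [h0, sub_zero, Real.norm_eq_abs, Real.norm_eq_abs] at this
  rw [pow_succ, ← mul_assoc]; exact this

theorem exists_kap_taylor : ∃ K : ℝ, 0 ≤ K ∧ (∀ s, |deriv kap s| ≤ K) ∧
    (∀ s, |deriv (deriv kap) s| ≤ K) ∧
    ∀ s t, |kap t - kap s - deriv kap s * (t - s) - deriv (deriv kap) s / 2 * (t - s) ^ 2|
      ≤ K * |t - s| ^ 3 := by
  have hcd : ∀ n : ℕ, ContDiff ℝ n kap := fun n => contDiff_kap (n := n)
  have h1 : ContDiff ℝ 2 (deriv kap) := by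
    have := hcd 3
    exact ((contDiff_succ_iff_deriv (n := 2)).1 (by exact_mod_cast this)).2.2
  have h2 : ContDiff ℝ 1 (deriv (deriv kap)) :=
    ((contDiff_succ_iff_deriv (n := 1)).1 (by exact_mod_cast h1)).2.2
  have h3 : ContDiff ℝ 0 (deriv (deriv (deriv kap))) :=
    ((contDiff_succ_iff_deriv (n := 0)).1 (by exact_mod_cast h2)).2.2
  have d0 : ∀ s, HasDerivAt kap (deriv kap s) s := fun s =>
    ((hcd 1).differentiable (by norm_num) s).hasDerivAt
  have d1 : ∀ s, HasDerivAt (deriv kap) (deriv (deriv kap) s) s := fun s =>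
    (h1.differentiable (by norm_num) s).hasDerivAt
  have d2 : ∀ s, HasDerivAt (deriv (deriv kap)) (deriv (deriv (deriv kap)) s) s := fun s =>
    (h2.differentiable (by norm_num) s).hasDerivAt
  -- constant outside `[0, 1]`, so derivatives vanish there
  have z : ∀ (g : ℝ → ℝ) (c₁ c₂ : ℝ), (∀ s < 0, g s = c₁) → (∀ s > 1, g s = c₂) →
      (∀ s < 0, deriv g s = 0) ∧ (∀ s > 1, deriv g s = 0) := by
    intro g c₁ c₂ a b
    constructor
    · intro s hs
      have : g =ᶠ[𝓝 s] fun _ => c₁ := by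
        filter_upwards [Iio_mem_nhds hs] with t ht using a t ht
      rw [this.deriv_eq]; simp
    · intro s hs
      have : g =ᶠ[𝓝 s] fun _ => c₂ := by
        filter_upwards [Ioi_mem_nhds hs] with t ht using b t ht
      rw [this.deriv_eq]; simp
  have z1 := z kap 1 0 (fun s hs => kap_eq_one hs.le) (fun s hs => kap_eq_zero hs.le)
  have z2 := z _ 0 0 z1.1 z1.2
  have z3 := z _ 0 0 z2.1 z2.2
  have bd : ∀ g : ℝ → ℝ, Continuous g → ((∀ s < 0, g s = 0) ∧ (∀ s > 1, g s = 0)) →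
      ∃ K, ∀ s, |g s| ≤ K := by
    intro g hg h
    obtain ⟨K, hK⟩ := (isCompact_Icc (a := (0 : ℝ)) (b := 1)).exists_bound_of_continuousOn
      hg.continuousOn
    refine ⟨max K 0, fun s => ?_⟩
    rcases lt_or_ge s 0 with h0 | h0
    · simp [h.1 s h0]
    rcases lt_or_ge 1 s with h1 | h1
    · simp [h.2 s h1]
    exact (hK s ⟨h0, h1⟩).trans (le_max_left _ _)
  obtain ⟨K1, hK1⟩ := bd _ h1.continuous z1
  obtain ⟨K2, hK2⟩ := bd _ h2.continuous z2
  obtain ⟨K3, hK3⟩ := bd _ h3.continuous z3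
  have p1 : 0 ≤ K1 := (abs_nonneg _).trans (hK1 0)
  have p2 : 0 ≤ K2 := (abs_nonneg _).trans (hK2 0)
  have p3 : 0 ≤ K3 := (abs_nonneg _).trans (hK3 0)
  refine ⟨K1 + K2 + K3, by positivity, fun s => (hK1 s).trans (by linarith),
    fun s => (hK2 s).trans (by linarith), fun s t => ?_⟩
  have e2 := abs_le_pow_succ_of_deriv (g := fun t => deriv (deriv kap) t - deriv (deriv kap) s)
    (n := 0) (s := s) (fun t => (d2 t).sub_const _) (by simp) (fun t => by simpa using hK3 t)
  have e1 := abs_le_pow_succ_of_deriv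
    (g := fun t => deriv kap t - deriv kap s - deriv (deriv kap) s * (t - s))
    (g' := fun t => deriv (deriv kap) t - deriv (deriv kap) s) (n := 1) (s := s)
    (fun t => by
      have := ((d1 t).sub_const (deriv kap s)).sub
        (((hasDerivAt_id t).sub_const s).const_mul (deriv (deriv kap) s))
      exact this.congr_deriv (by simp)) (by simp) e2
  have e0 := abs_le_pow_succ_of_deriv
    (g := fun t => kap t - kap s - deriv kap s * (t - s) - deriv (deriv kap) s / 2 * (t - s) ^ 2)
    (g' := fun t => deriv kap t - deriv kap s - deriv (deriv kap) s * (t - s)) (n := 2) (s := s)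
    (fun t => by
      have := (((d0 t).sub_const (kap s)).sub
        (((hasDerivAt_id t).sub_const s).const_mul (deriv kap s))).sub
        ((((hasDerivAt_id t).sub_const s).pow 2).const_mul (deriv (deriv kap) s / 2))
      refine this.congr_deriv ?_
      simp; ring) (by simp) e1 t
  refine e0.trans ?_
  gcongr; linarith

section odd

variable {F : Type*} [NormedAddCommGroup F] [InnerProductSpace ℝ F]

/-- First and second order coefficients of the odd part of a translated mollifier. -/
theorem exists_odd_kernel_expansion (F : Type*) [NormedAddCommGroup F] [InnerProductSpace ℝ F] :
    ∃ C : ℝ, 0 ≤ C ∧ ∀ e : F, ‖e‖ = 1 → ∃ (α : F → ℝ) (β : F → F),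
    Continuous α ∧ Continuous β ∧ (∀ y, |α y| ≤ C) ∧ (∀ y, ‖β y‖ ≤ C) ∧
    (∀ y ∉ closedBall (0 : F) 1, α y = 0) ∧ (∀ y ∉ closedBall (0 : F) 1, β y = 0) ∧
    (∀ y, ⟪β y, e⟫ = 0) ∧
    ∀ p y : F, ‖p‖ ≤ 1 → |rhoK (y - p) - rhoK (y - (p - (2 * ⟪p, e⟫) • e))
      - ⟪p, e⟫ * α y - ⟪p, e⟫ * ⟪β y, p⟫| ≤ C * ‖p‖ ^ 3 := by
  obtain ⟨K, hK0, hK1, hK2, hK3⟩ := exists_kap_taylor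
  have hcd : ∀ n : ℕ, ContDiff ℝ n kap := fun n => contDiff_kap (n := n)
  have h1 : ContDiff ℝ 2 (deriv kap) := by
    have := hcd 3
    exact ((contDiff_succ_iff_deriv (n := 2)).1 (by exact_mod_cast this)).2.2
  have h2 : ContDiff ℝ 1 (deriv (deriv kap)) :=
    ((contDiff_succ_iff_deriv (n := 1)).1 (by exact_mod_cast h1)).2.2
  have z1 : ∀ s > 1, deriv kap s = 0 := by
    intro s hs
    have : kap =ᶠ[𝓝 s] fun _ => 0 := by
      filter_upwards [Ioi_mem_nhds hs] with t ht using kap_eq_zero (le_of_lt ht)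
    rw [this.deriv_eq]; simp
  have z2 : ∀ s > 1, deriv (deriv kap) s = 0 := by
    intro s hs
    have : deriv kap =ᶠ[𝓝 s] fun _ => 0 := by
      filter_upwards [Ioi_mem_nhds hs] with t ht using z1 t ht
    rw [this.deriv_eq]; simp
  have hout : ∀ y : F, y ∉ closedBall (0 : F) 1 → 1 < ‖y‖ ^ 2 := by
    intro y hy
    rw [mem_closedBall_zero_iff, not_le] at hy
    nlinarith
  refine ⟨254 * K + 16 * K, by positivity, fun e he => ⟨fun y => -4 * ⟪y, e⟫ * deriv kap (‖y‖ ^ 2),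
    fun y => (8 * ⟪y, e⟫ * deriv (deriv kap) (‖y‖ ^ 2)) • (y - ⟪y, e⟫ • e), ?_, ?_, ?_, ?_, ?_, ?_,
    ?_, ?_⟩⟩
  · have := h1.continuous; fun_prop
  · have := h2.continuous; fun_prop
  · intro y
    by_cases hy : y ∈ closedBall (0 : F) 1
    · rw [mem_closedBall_zero_iff] at hy
      have i1 : |⟪y, e⟫| ≤ 1 := by
        have := abs_real_inner_le_norm y e; rw [he] at this; linarith
      rw [abs_mul, abs_mul]
      have : |⟪y, e⟫| * |deriv kap (‖y‖ ^ 2)| ≤ 1 * K :=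
        mul_le_mul i1 (hK1 _) (abs_nonneg _) zero_le_one
      rw [abs_neg, abs_of_pos (by norm_num : (0 : ℝ) < 4)]
      linarith
    · simp only [z1 _ (hout y hy)]; simp; positivity
  · intro y
    by_cases hy : y ∈ closedBall (0 : F) 1
    · rw [mem_closedBall_zero_iff] at hy
      have i1 : |⟪y, e⟫| ≤ 1 := by
        have := abs_real_inner_le_norm y e; rw [he] at this; linarith
      have i2 : ‖y - ⟪y, e⟫ • e‖ ≤ 2 := by
        refine (norm_sub_le _ _).trans ?_
        rw [norm_smul, he, Real.norm_eq_abs]; linarith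
      rw [norm_smul, Real.norm_eq_abs, abs_mul, abs_mul]
      have : |⟪y, e⟫| * |deriv (deriv kap) (‖y‖ ^ 2)| ≤ 1 * K :=
        mul_le_mul i1 (hK2 _) (abs_nonneg _) zero_le_one
      rw [abs_of_pos (by norm_num : (0 : ℝ) < 8)]
      nlinarith [norm_nonneg (y - ⟪y, e⟫ • e)]
    · simp only [z2 _ (hout y hy)]; simp; positivity
  · intro y hy
    simp [z1 _ (hout y hy)]
  · intro y hy
    simp [z2 _ (hout y hy)]
  · intro y
    rw [inner_smul_left, inner_sub_left, inner_smul_left, real_inner_self_eq_norm_sq, he]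
    simp
  · intro p y hp
    set π := ⟪p, e⟫ with hπ
    set ε := ⟪y, e⟫ with hε
    set A := ⟪y, p⟫ with hA
    have hπp : |π| ≤ ‖p‖ := by
      have := abs_real_inner_le_norm p e; rw [he] at this; linarith
    have n1 : ‖y - p‖ ^ 2 = ‖y‖ ^ 2 + (‖p‖ ^ 2 - 2 * A) := by
      rw [norm_sub_sq_real]; ring
    have hee : ⟪e, e⟫ = 1 := by rw [real_inner_self_eq_norm_sq, he]; norm_num
    have n0 : ‖p - (2 * π) • e‖ ^ 2 = ‖p‖ ^ 2 := by
      rw [norm_sub_sq_real, inner_smul_right, norm_smul, he, mul_one, Real.norm_eq_abs, sq_abs]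
      ring
    have n2 : ‖y - (p - (2 * π) • e)‖ ^ 2 = ‖y‖ ^ 2 + (‖p‖ ^ 2 - 2 * (A - 2 * π * ε)) := by
      rw [norm_sub_sq_real, n0, inner_sub_right, inner_smul_right, ← hA, ← hε]; ring
    have nb : ⟪(8 * ε * deriv (deriv kap) (‖y‖ ^ 2)) • (y - ε • e), p⟫
        = 8 * ε * deriv (deriv kap) (‖y‖ ^ 2) * (A - ε * π) := by
      rw [inner_smul_left, inner_sub_left, inner_smul_left, real_inner_comm p e, ← hA, ← hπ]
      simp
    have q0 : ‖p - (2 * π) • e‖ = ‖p‖ := by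
      rw [← abs_of_nonneg (norm_nonneg (p - _)), ← abs_of_nonneg (norm_nonneg p)]
      exact (sq_eq_sq_iff_abs_eq_abs _ _).1 n0
    show |rhoK (y - p) - rhoK (y - (p - (2 * π) • e)) - π * (-4 * ε * deriv kap (‖y‖ ^ 2)) - π * _|
      ≤ _
    rw [nb]
    by_cases hy : ‖y‖ ≤ 2
    · have hεy : |ε| ≤ 2 := by
        have := abs_real_inner_le_norm y e; rw [he] at this; linarith
      have t1 := hK3 (‖y‖ ^ 2) (‖y - p‖ ^ 2)
      have t2 := hK3 (‖y‖ ^ 2) (‖y - (p - (2 * π) • e)‖ ^ 2)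
      have hb : ∀ q : F, ‖q‖ = ‖p‖ → |‖y - q‖ ^ 2 - ‖y‖ ^ 2| ^ 3 ≤ 125 * ‖p‖ ^ 3 := by
        intro q hq
        have : |‖y - q‖ ^ 2 - ‖y‖ ^ 2| ≤ 5 * ‖p‖ := by
          have := abs_real_inner_le_norm y q
          rw [hq] at this
          have h3 : ‖y‖ * ‖p‖ ≤ 2 * ‖p‖ := by gcongr
          have h4 : ‖p‖ ^ 2 ≤ ‖p‖ := by nlinarith [norm_nonneg p]
          rw [norm_sub_sq_real, hq, abs_le]
          rw [abs_le] at this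
          constructor <;> nlinarith [norm_nonneg p]
        calc _ ≤ (5 * ‖p‖) ^ 3 := by gcongr
          _ = _ := by ring
      have t1' := t1.trans (mul_le_mul_of_nonneg_left (hb p rfl) hK0)
      have t2' := t2.trans (mul_le_mul_of_nonneg_left (hb _ q0) hK0)
      rw [n1] at t1'
      rw [n2] at t2'
      have t3 : |deriv (deriv kap) (‖y‖ ^ 2) * (ε * (π * ‖p‖ ^ 2))| ≤ K * (2 * (‖p‖ * ‖p‖ ^ 2)) := by
        rw [abs_mul, abs_mul, abs_mul, abs_of_nonneg (by positivity : 0 ≤ ‖p‖ ^ 2)]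
        gcongr
        exact hK2 _
      unfold rhoK
      rw [n1, n2]
      rw [add_sub_cancel_left] at t1' t2'
      have t4 := abs_add_le (kap (‖y‖ ^ 2 + (‖p‖ ^ 2 - 2 * A)) - kap (‖y‖ ^ 2)
        - deriv kap (‖y‖ ^ 2) * (‖p‖ ^ 2 - 2 * A)
        - deriv (deriv kap) (‖y‖ ^ 2) / 2 * (‖p‖ ^ 2 - 2 * A) ^ 2)
        (-(4 * (deriv (deriv kap) (‖y‖ ^ 2) * (ε * (π * ‖p‖ ^ 2)))))
      have t5 := abs_sub (kap (‖y‖ ^ 2 + (‖p‖ ^ 2 - 2 * A)) - kap (‖y‖ ^ 2)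
        - deriv kap (‖y‖ ^ 2) * (‖p‖ ^ 2 - 2 * A)
        - deriv (deriv kap) (‖y‖ ^ 2) / 2 * (‖p‖ ^ 2 - 2 * A) ^ 2
        + -(4 * (deriv (deriv kap) (‖y‖ ^ 2) * (ε * (π * ‖p‖ ^ 2)))))
        (kap (‖y‖ ^ 2 + (‖p‖ ^ 2 - 2 * (A - 2 * π * ε))) - kap (‖y‖ ^ 2)
        - deriv kap (‖y‖ ^ 2) * (‖p‖ ^ 2 - 2 * (A - 2 * π * ε))
        - deriv (deriv kap) (‖y‖ ^ 2) / 2 * (‖p‖ ^ 2 - 2 * (A - 2 * π * ε)) ^ 2)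
      rw [abs_neg, abs_mul, abs_of_pos (by norm_num : (0 : ℝ) < 4)] at t4
      have hp3 : 0 ≤ K * ‖p‖ ^ 3 := by positivity
      calc _ = _ := by congr 1; ring
        _ ≤ _ := t5
        _ ≤ (254 * K + 16 * K) * ‖p‖ ^ 3 := by nlinarith
    · push Not at hy
      have a1 : y ∉ closedBall (0 : F) 1 := by
        rw [mem_closedBall_zero_iff]; linarith
      have a2 : ∀ q : F, ‖q‖ = ‖p‖ → y - q ∉ closedBall (0 : F) 1 := by
        intro q hq
        rw [mem_closedBall_zero_iff]
        have := norm_sub_norm_le y q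
        rw [hq] at this; linarith
      rw [rhoK_eq_zero (a2 p rfl), rhoK_eq_zero (a2 _ q0), z1 _ (hout y a1), z2 _ (hout y a1)]
      simp; positivity

end odd

section slab

variable {F : Type*} [NormedAddCommGroup F] [InnerProductSpace ℝ F]

/-- A ramp in the direction `e`, from `0` to `1` over `3δ ≤ ⟪z, e⟫ ≤ 4δ`. -/
noncomputable def ramp (e : F) (δ : ℝ) (z : F) : ℝ := max 0 (min 1 (⟪z, e⟫ / δ - 3))

/-- A continuous bump which is `1` on the slab `2δ ≤ ⟪z, e⟫ ≤ 3δ`. -/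
noncomputable def slab (e : F) (δ : ℝ) (z : F) : ℝ := ramp e δ (z + (2 * δ) • e) - ramp e δ z

theorem continuous_ramp (e : F) (δ : ℝ) : Continuous (ramp e δ) := by
  unfold ramp; fun_prop

theorem continuous_slab (e : F) (δ : ℝ) : Continuous (slab e δ) := by
  have := continuous_ramp e δ
  unfold slab; fun_prop

theorem abs_ramp_le (e : F) (δ : ℝ) (z : F) : |ramp e δ z| ≤ 1 := by
  rw [ramp, abs_of_nonneg (le_max_left _ _)]
  exact max_le zero_le_one (min_le_left _ _)

variable {e : F} {δ : ℝ}

theorem slab_eq (he : ‖e‖ = 1) (hδ : 0 < δ) (z : F) :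
    slab e δ z = max 0 (min 1 (⟪z, e⟫ / δ - 1)) - max 0 (min 1 (⟪z, e⟫ / δ - 3)) := by
  rw [slab, ramp, ramp, inner_add_left, inner_smul_left, real_inner_self_eq_norm_sq, he]
  congr 3
  simp
  field_simp
  ring

theorem slab_nonneg (he : ‖e‖ = 1) (hδ : 0 < δ) (z : F) : 0 ≤ slab e δ z := by
  rw [slab_eq he hδ, sub_nonneg]
  gcongr; norm_num

theorem slab_eq_one (he : ‖e‖ = 1) (hδ : 0 < δ) {z : F} (h2 : 2 * δ ≤ ⟪z, e⟫)
    (h3 : ⟪z, e⟫ ≤ 3 * δ) : slab e δ z = 1 := by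
  have a : 2 ≤ ⟪z, e⟫ / δ := by rwa [le_div_iff₀ hδ]
  have b : ⟪z, e⟫ / δ ≤ 3 := by rwa [div_le_iff₀ hδ]
  rw [slab_eq he hδ, min_eq_left (by linarith), min_eq_right (by linarith),
    max_eq_left (by linarith : ⟪z, e⟫ / δ - 3 ≤ 0)]
  simp

theorem slab_eq_zero (he : ‖e‖ = 1) (hδ : 0 < δ) {z : F} (h4 : 4 * δ < ⟪z, e⟫) :
    slab e δ z = 0 := by
  have a : 4 < ⟪z, e⟫ / δ := by rwa [lt_div_iff₀ hδ]
  rw [slab_eq he hδ, min_eq_left (by linarith), min_eq_left (by linarith), sub_self]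

theorem integral_kernel_slab_le [FiniteDimensional ℝ F]
    [MeasurableSpace F] [BorelSpace F] {k : F → ℝ} {L r : ℝ} (he : ‖e‖ = 1) (hδ : 0 < δ)
    (hk : Continuous k) (hs : ∀ y ∉ closedBall (0 : F) 1, k y = 0)
    (hL : ∀ y z, |k y - k z| ≤ L * ‖y - z‖) (hB : ∀ y, |k y| ≤ L) (hr : 0 < r) (x : F) :
    ∫ y, k y * slab e δ (x + r • y) ≤ 4 * L * volume.real (closedBall (0 : F) 2) * (δ / r) := by
  have h := abs_integral_kernel_translate_sub_le (x := x) (a := (2 * δ) • e) (G := 1) hk hs hL hB hr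
    (continuous_ramp e δ) fun y _ => abs_ramp_le e δ y
  have hc := continuous_ramp e δ
  rw [← integral_sub (integrable_kernel_mul hk hs (by fun_prop))
    (integrable_kernel_mul hk hs (by fun_prop))] at h
  have e1 : ∀ y, k y * slab e δ (x + r • y) = k y * ramp e δ (x + (2 * δ) • e + r • y)
      - k y * ramp e δ (x + r • y) := by
    intro y
    rw [slab, mul_sub]
    congr 3; abel
  simp_rw [e1]
  refine (le_abs_self _).trans (h.trans (le_of_eq ?_))
  rw [norm_smul, he, Real.norm_eq_abs, abs_of_pos (by positivity)]
  ring

end slab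

section reflection

theorem exists_mean_reflection_bound (ι : Type*) [Fintype ι] {C₁ : ℝ} (hC₁ : 0 ≤ C₁) :
    ∃ C : ℝ, 0 ≤ C ∧ ∀ (δ : ℝ) (e x : EuclideanSpace ℝ ι) (w : EuclideanSpace ℝ ι → ℝ),
    0 < δ → δ ≤ 1 / 64 → ‖e‖ = 1 → ‖x‖ ≤ 1 / 8 → 0 ≤ ⟪x, e⟫ → ContDiff ℝ 2 w →
    (∀ z ∈ closedBall (0 : EuclideanSpace ℝ ι) (1 / 4), ⟪z, e⟫ < 2 * δ → lapl w z = 0) →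
    (∀ z ∈ closedBall (0 : EuclideanSpace ℝ ι) (1 / 4), |lapl w z| ≤ δ + C₁ / δ * slab e δ z) →
    |(∫ y, rhoK y * w (x + (1 / 8 : ℝ) • y))
      - (∫ y, rhoK y * w (x - (2 * ⟪x, e⟫) • e + (1 / 8 : ℝ) • y))
      - (∫ y : EuclideanSpace ℝ ι, rhoK y) * (w x - w (x - (2 * ⟪x, e⟫) • e))| ≤ C * √δ := by
  obtain ⟨L, hL1, hLip⟩ := exists_rhoK_lipschitz (F := EuclideanSpace ℝ ι)
  set V := volume.real (closedBall (0 : EuclideanSpace ℝ ι) 1) with hV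
  set V2 := volume.real (closedBall (0 : EuclideanSpace ℝ ι) 2) with hV2
  have hV0 : 0 ≤ V := measureReal_nonneg
  have hV20 : 0 ≤ V2 := measureReal_nonneg
  set K := 4 * L * V2 with hK
  have hK0 : 0 ≤ K := by positivity
  refine ⟨(V + C₁ * K) + (V + 80 * C₁ * K), by positivity, ?_⟩
  intro δ e x w hδ hδ1 he hx hxe hw hz0 hzL
  have hpsi : ∀ r > 0, ∫ y, psiK y * slab e δ (x + r • y) ≤ K * (δ / r) := fun r hr =>
    integral_kernel_slab_le he hδ continuous_psiK (fun y => psiK_eq_zero)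
      (fun y z => (abs_psiK_sub_le y z).trans (by nlinarith [norm_nonneg (y - z)]))
      (fun y => (abs_psiK_le y).trans hL1) hr x
  have hrho : ∀ r > 0, ∫ y, rhoK y * slab e δ (x + r • y) ≤ K * (δ / r) := fun r hr =>
    integral_kernel_slab_le he hδ continuous_rhoK (fun y => rhoK_eq_zero) hLip
      (fun y => (abs_rhoK_le y).trans hL1) hr x
  have hpsiV : ∫ y : EuclideanSpace ℝ ι, psiK y ≤ V := by
    have := abs_integral_kernel_le (k := psiK) (q := fun _ : EuclideanSpace ℝ ι => 1) (B := 1)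
      (G := 1) (fun y => psiK_eq_zero) abs_psiK_le (by simp)
    simp only [mul_one, one_mul] at this
    exact (le_abs_self _).trans this
  set t := ⟪x, e⟫ with ht
  set xs := x - (2 * t) • e with hxs
  have hxs_norm : ‖xs‖ ≤ 1 / 8 := by
    have : ‖xs‖ ^ 2 = ‖x‖ ^ 2 := by
      rw [hxs, norm_sub_sq_real, inner_smul_right, norm_smul, he, mul_one, Real.norm_eq_abs, sq_abs,
        ← ht]
      ring
    rw [← sq_le_sq₀ (norm_nonneg _) (by norm_num), this]
    gcongr
  set lw := lapl w with hlw
  have hlwc : Continuous lw := continuous_lapl hw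
  set g : ℝ → ℝ := fun r => (∫ y, rhoK y * w (x + r • y)) - ∫ y, rhoK y * w (xs + r • y) with hg
  set g' : ℝ → ℝ := fun r => r * (∫ y, psiK y * lw (x + r • y))
    - r * ∫ y, psiK y * lw (xs + r • y) with hg'
  have hd : ∀ r, HasDerivAt g (g' r) r := fun r =>
    (hasDerivAt_mean hw x r).sub (hasDerivAt_mean hw xs r)
  -- pointwise bound and integration
  have key : ∀ r, 0 < r → r ≤ 1 / 8 → ∀ κ : EuclideanSpace ℝ ι → ℝ, Continuous κ →
      (∀ y ∉ closedBall (0 : EuclideanSpace ℝ ι) 1, κ y = 0) →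
      (∀ y, 0 ≤ κ y) →
      (∀ y s, 0 ≤ s → s * r ^ 2 = 4 * t * ⟪x + r • y, e⟫ → slab e δ (x + r • y) ≠ 0 →
        kapPrim (‖y‖ ^ 2) - kapPrim (‖y‖ ^ 2 + s) ≤ κ y) →
      |g' r| ≤ r * (δ * V + C₁ / δ * ∫ y, κ y * slab e δ (x + r • y)) := by
    intro r hr hr1 κ hκc hκs hκ0 hκ
    set b := 2 * t / r with hb
    have hrb : r * b = 2 * t := by rw [hb]; field_simp
    have hxsx : xs + (r * b) • e = x := by rw [hrb, hxs, sub_add_cancel]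
    have hshift : ∫ y, psiK y * lw (xs + r • y) = ∫ y, psiK (y + b • e) * lw (x + r • y) := by
      rw [← integral_add_right_eq_self (fun y => psiK y * lw (xs + r • y)) (b • e)]
      congr 1; ext y
      congr 2
      rw [← hxsx, smul_add, smul_smul]; abel
    have hc1 : Continuous fun y => lw (x + r • y) := by fun_prop
    have hc2 : Continuous fun y => lw (xs + r • y) := by fun_prop
    have hi1 := integrable_kernel_mul continuous_psiK (fun y => psiK_eq_zero) hc1
    have hi2 : Integrable fun y => psiK (y + b • e) * lw (x + r • y) := by
      have := (integrable_kernel_mul continuous_psiK (fun y => psiK_eq_zero) hc2).comp_add_right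
        (b • e)
      refine this.congr (Eventually.of_forall fun y => ?_)
      simp only
      congr 2
      rw [← hxsx, smul_add, smul_smul]; abel
    have hg'r : g' r = r * ∫ y, (psiK y * lw (x + r • y) - psiK (y + b • e) * lw (x + r • y)) := by
      rw [integral_sub hi1 hi2, ← hshift, hg']; ring
    rw [hg'r, abs_mul, abs_of_pos hr]
    gcongr
    have hsc := continuous_slab e δ
    have hi3 := integrable_kernel_mul (q := fun y => slab e δ (x + r • y)) hκc hκs (by fun_prop)
    have hi4 : Integrable fun y : EuclideanSpace ℝ ι => psiK y := by
      have := integrable_kernel_mul (q := fun _ : EuclideanSpace ℝ ι => 1) continuous_psiK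
        (fun y => psiK_eq_zero) (by fun_prop)
      simpa using this
    have hmain : ‖∫ y, (psiK y * lw (x + r • y) - psiK (y + b • e) * lw (x + r • y))‖ ≤
        ∫ y, (δ * psiK y + C₁ / δ * (κ y * slab e δ (x + r • y))) := by
      refine norm_integral_le_of_norm_le ((hi4.const_mul δ).add (hi3.const_mul (C₁ / δ)))
        (Eventually.of_forall fun y => ?_)
      rw [← sub_mul, norm_mul, Real.norm_eq_abs, Real.norm_eq_abs]
      set z := x + r • y with hz
      have hsl := slab_nonneg he hδ z
      have hrhs : 0 ≤ δ * psiK y + C₁ / δ * (κ y * slab e δ z) := by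
        have := hκ0 y
        have : 0 ≤ psiK y := kapPrim_nonneg _
        positivity
      by_cases hmem : z ∈ closedBall (0 : EuclideanSpace ℝ ι) (1 / 4)
      · rcases lt_or_ge ⟪z, e⟫ (2 * δ) with hlt | hge
        · rw [hz0 z hmem hlt]; simpa using hrhs
        have hs0 : 0 ≤ 4 * t * ⟪z, e⟫ / r ^ 2 := by
          have : 0 ≤ ⟪z, e⟫ := by linarith
          positivity
        have hn : ‖y + b • e‖ ^ 2 = ‖y‖ ^ 2 + 4 * t * ⟪z, e⟫ / r ^ 2 := by
          rw [norm_add_sq_real, inner_smul_right, norm_smul, he, mul_one, Real.norm_eq_abs, sq_abs,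
            hz, inner_add_left, inner_smul_left, ← ht, hb]
          simp
          field_simp
          ring
        have hκ' := hκ y _ hs0 (by rw [hz]; field_simp)
        have hb1 := kapPrim_sub_bounds (s := ‖y‖ ^ 2) hs0
        have hb2 := kapPrim_nonneg (‖y‖ ^ 2 + 4 * t * ⟪z, e⟫ / r ^ 2)
        have hdiff : psiK y - psiK (y + b • e)
            = kapPrim (‖y‖ ^ 2) - kapPrim (‖y‖ ^ 2 + 4 * t * ⟪z, e⟫ / r ^ 2) := by
          rw [psiK, psiK, hn]
        have hle : psiK y - psiK (y + b • e) ≤ psiK y := by rw [hdiff, psiK]; linarith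
        have h0 : 0 ≤ psiK y - psiK (y + b • e) := by rw [hdiff]; exact hb1.1
        rw [abs_of_nonneg h0]
        calc _ ≤ (psiK y - psiK (y + b • e)) * (δ + C₁ / δ * slab e δ z) := by
              gcongr; exact hzL z hmem
          _ = δ * (psiK y - psiK (y + b • e))
              + C₁ / δ * ((psiK y - psiK (y + b • e)) * slab e δ z) := by ring
          _ ≤ _ := by
              have : (psiK y - psiK (y + b • e)) * slab e δ z ≤ κ y * slab e δ z := by
                rcases eq_or_ne (slab e δ z) 0 with h | h
                · rw [h]; simp
                · gcongr
                  rw [hdiff]; exact hκ' h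
              gcongr
      · have hn1 : y ∉ closedBall (0 : EuclideanSpace ℝ ι) 1 := by
          intro hy
          apply hmem
          rw [mem_closedBall_zero_iff] at hy ⊢
          have := norm_add_le x (r • y)
          rw [norm_smul, Real.norm_eq_abs, abs_of_pos hr] at this
          have : r * ‖y‖ ≤ 1 / 8 * 1 := by gcongr
          linarith
        have hn2 : y + b • e ∉ closedBall (0 : EuclideanSpace ℝ ι) 1 := by
          intro hy
          apply hmem
          rw [mem_closedBall_zero_iff] at hy ⊢
          have hzz : z = xs + r • (y + b • e) := by
            rw [hz, ← hxsx, smul_add, smul_smul]; abel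
          have := norm_add_le xs (r • (y + b • e))
          rw [norm_smul, Real.norm_eq_abs, abs_of_pos hr] at this
          have : r * ‖y + b • e‖ ≤ 1 / 8 * 1 := by gcongr
          rw [hzz]; linarith
        rw [psiK_eq_zero hn1] at hrhs ⊢
        rw [psiK_eq_zero hn2]
        simpa using hrhs
    rw [Real.norm_eq_abs] at hmain
    refine hmain.trans ?_
    rw [integral_add (hi4.const_mul δ) (hi3.const_mul (C₁ / δ)), integral_const_mul,
      integral_const_mul]
    gcongr
  have hsq : √δ * √δ = δ := Real.mul_self_sqrt hδ.le
  have hs0 : 0 < √δ := Real.sqrt_pos.2 hδ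
  have hs8 : √δ ≤ 1 / 8 := by
    rw [Real.sqrt_le_left (by norm_num)]; linarith
  have hsmall : ∀ r ∈ Icc 0 (√δ), ‖g' r‖ ≤ V + C₁ * K := by
    intro r hr
    rcases hr.1.eq_or_lt with rfl | hr0
    · simp [hg']; positivity
    have := key r hr0 (hr.2.trans hs8) psiK continuous_psiK (fun y => psiK_eq_zero)
      (fun y => kapPrim_nonneg _) (fun y s hs _ _ => by
        rw [psiK]; linarith [kapPrim_nonneg (‖y‖ ^ 2 + s)])
    refine this.trans ?_
    calc _ ≤ r * (δ * V + C₁ / δ * (K * (δ / r))) := by gcongr; exact hpsi r hr0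
      _ = r * δ * V + C₁ * K := by field_simp
      _ ≤ 1 * 1 * V + C₁ * K := by
          gcongr
          · linarith [hr.2]
          · linarith
      _ = _ := by ring
  have hlarge : ∀ r ∈ Icc (√δ) (1 / 8), ‖g' r‖ ≤ (V + 80 * C₁ * K) * √δ := by
    intro r hr
    have hr0 : 0 < r := hs0.trans_le hr.1
    have hδr : δ ≤ r := by nlinarith [hr.1]
    have := key r hr0 hr.2 (fun y => 80 * (δ / r) * rhoK y) (continuous_const.mul continuous_rhoK)
      (fun y hy => by simp [rhoK_eq_zero hy])
      (fun y => by have := rhoK_nonneg y; positivity) (fun y s hs hst hsl => by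
        refine (kapPrim_sub_bounds hs).2.trans ?_
        by_cases hy : y ∈ closedBall (0 : EuclideanSpace ℝ ι) 1
        · show _ ≤ 80 * (δ / r) * kap (‖y‖ ^ 2)
          refine mul_le_mul_of_nonneg_right ?_ (kap_nonneg _)
          have h4 : ⟪x + r • y, e⟫ ≤ 4 * δ := by
            by_contra h
            exact hsl (slab_eq_zero he hδ (not_le.1 h))
          rw [mem_closedBall_zero_iff] at hy
          have hye : -1 ≤ ⟪y, e⟫ := by
            have := abs_real_inner_le_norm y e
            rw [he, mul_one] at this
            linarith [(abs_le.1 this).1]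
          have hexp : ⟪x + r • y, e⟫ = t + r * ⟪y, e⟫ := by
            rw [inner_add_left, inner_smul_left]; simp [ht]
          have ht5 : t ≤ 5 * r := by nlinarith
          have : s * r ^ 2 ≤ 80 * (δ / r) * r ^ 2 := by
            rw [hst]
            calc 4 * t * ⟪x + r • y, e⟫ ≤ 4 * t * (4 * δ) := by gcongr
              _ ≤ 4 * (5 * r) * (4 * δ) := by gcongr
              _ = _ := by field_simp; ring
          exact le_of_mul_le_mul_right this (by positivity)
        · have h0 : kap (‖y‖ ^ 2) = 0 := rhoK_eq_zero hy
          rw [rhoK, h0]; simp)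
    refine this.trans ?_
    have e1 : ∫ y, 80 * (δ / r) * rhoK y * slab e δ (x + r • y)
        = 80 * (δ / r) * ∫ y, rhoK y * slab e δ (x + r • y) := by
      rw [← integral_const_mul]; congr 1; ext y; ring
    have hdr : δ / r ≤ √δ := by
      rw [div_le_iff₀ hr0]; nlinarith [hr.1]
    calc _ ≤ r * (δ * V + C₁ / δ * (80 * (δ / r) * (K * (δ / r)))) := by
            rw [e1]; gcongr; exact hrho r hr0
      _ = r * δ * V + 80 * C₁ * K * (δ / r) := by field_simp
      _ ≤ 1 * √δ * V + 80 * C₁ * K * √δ := by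
          gcongr
          · linarith [hr.2]
          · nlinarith
      _ = _ := by ring
  have m1 := Convex.norm_image_sub_le_of_norm_hasDerivWithin_le (f := g) (s := Icc 0 (√δ))
    (fun r _ => (hd r).hasDerivWithinAt) hsmall (convex_Icc _ _) (left_mem_Icc.2 hs0.le)
    (right_mem_Icc.2 hs0.le)
  have m2 := Convex.norm_image_sub_le_of_norm_hasDerivWithin_le (f := g) (s := Icc (√δ) (1 / 8))
    (fun r _ => (hd r).hasDerivWithinAt) hlarge (convex_Icc _ _) (left_mem_Icc.2 hs8)
    (right_mem_Icc.2 hs8)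
  have hg0 : g 0 = (∫ y : EuclideanSpace ℝ ι, rhoK y) * (w x - w xs) := by
    simp only [hg, zero_smul, add_zero]
    rw [integral_mul_const, integral_mul_const]; ring
  rw [← hg0]
  rw [sub_zero, Real.norm_eq_abs, Real.norm_eq_abs, abs_of_pos hs0] at m1
  rw [Real.norm_eq_abs, Real.norm_eq_abs, abs_of_nonneg (by linarith : (0:ℝ) ≤ 1 / 8 - √δ)] at m2
  have m2' : (V + 80 * C₁ * K) * √δ * (1 / 8 - √δ) ≤ (V + 80 * C₁ * K) * √δ * 1 := by
    gcongr; linarith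
  calc _ = |(g (1 / 8) - g (√δ)) + (g (√δ) - g 0)| := by rw [hg]; congr 1; ring
    _ ≤ _ := abs_add_le _ _
    _ ≤ _ := by linarith

end reflection

section cutoff

variable {ι : Type*} [Fintype ι]

theorem abs_sum_clm_mul_le (A B : EuclideanSpace ℝ ι →L[ℝ] ℝ) :
    |∑ i, A (EuclideanSpace.basisFun ι ℝ i) * B (EuclideanSpace.basisFun ι ℝ i)|
      ≤ Fintype.card ι * (‖A‖ * ‖B‖) := by
  refine (Finset.abs_sum_le_sum_abs _ _).trans ?_
  refine (Finset.sum_le_sum (g := fun _ => ‖A‖ * ‖B‖) fun i _ => ?_).trans (by simp)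
  have h1 := A.le_opNorm (EuclideanSpace.basisFun ι ℝ i)
  have h2 := B.le_opNorm (EuclideanSpace.basisFun ι ℝ i)
  simp only [OrthonormalBasis.norm_eq_one, mul_one] at h1 h2
  rw [abs_mul]
  exact mul_le_mul h1 h2 (abs_nonneg _) (norm_nonneg _)

/-- A cutoff in the direction `e`, from `0` to `1` over `2δ ≤ ⟪y, e⟫ ≤ 3δ`. -/
noncomputable def stripCut (e : EuclideanSpace ℝ ι) (δ : ℝ) (y : EuclideanSpace ℝ ι) : ℝ :=
  kap (3 - ⟪e, y⟫ / δ)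

theorem contDiff_stripCut (e : EuclideanSpace ℝ ι) (δ : ℝ) : ContDiff ℝ 2 (stripCut e δ) :=
  (contDiff_kap (n := 2)).comp (contDiff_const.sub ((contDiff_const.inner ℝ contDiff_id).div_const δ))

theorem exists_stripCut_bounds (ι : Type*) [Fintype ι] : ∃ K : ℝ, 0 ≤ K ∧
    ∀ (e : EuclideanSpace ℝ ι) (δ : ℝ) (y : EuclideanSpace ℝ ι), ‖e‖ = 1 → 0 < δ →
    ‖fderiv ℝ (stripCut e δ) y‖ ≤ K / δ ∧ |lapl (stripCut e δ) y| ≤ K / δ ^ 2 := by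
  obtain ⟨K, hK0, hK1, hK2, -⟩ := exists_kap_taylor
  refine ⟨K, hK0, fun e δ y he hδ => ?_⟩
  have hkc : ContDiff ℝ 2 kap := contDiff_kap (n := 2)
  have hkc1 : ContDiff ℝ 1 (deriv kap) := ((contDiff_succ_iff_deriv (n := 1)).1 hkc).2.2
  set φ : ℝ → ℝ := fun s => kap (3 - s / δ) with hφ
  have hφc : ContDiff ℝ 2 φ := hkc.comp (contDiff_const.sub (contDiff_id.div_const δ))
  have hin : ∀ s, HasDerivAt (fun s : ℝ => 3 - s / δ) (-(1 / δ)) s := fun s => by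
    have := ((hasDerivAt_id s).div_const δ).const_sub 3
    exact this
  have d1 : ∀ s, HasDerivAt φ (deriv kap (3 - s / δ) * -(1 / δ)) s := fun s =>
    ((hkc.differentiable (by norm_num) _).hasDerivAt).comp s (hin s)
  have e1 : deriv φ = fun s => deriv kap (3 - s / δ) * -(1 / δ) := funext fun s => (d1 s).deriv
  have d2 : ∀ s, HasDerivAt (deriv φ) (deriv (deriv kap) (3 - s / δ) * -(1 / δ) * -(1 / δ)) s := by
    intro s
    rw [e1]
    exact (((hkc1.differentiable (by norm_num) _).hasDerivAt).comp s (hin s)).mul_const _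
  set ℓ := innerSL ℝ e with hℓ
  have hℓn : ‖ℓ‖ = 1 := by rw [hℓ, innerSL_apply_norm, he]
  have hst : stripCut e δ = fun y => φ (ℓ y) := by
    ext y; simp [stripCut, hφ, hℓ]
  rw [hst]
  constructor
  · have : HasFDerivAt (fun y => φ (ℓ y)) ((deriv kap (3 - ℓ y / δ) * -(1 / δ)) • ℓ) y :=
      (d1 (ℓ y)).comp_hasFDerivAt y ℓ.hasFDerivAt
    rw [this.fderiv, norm_smul, hℓn, mul_one, norm_mul, norm_neg, Real.norm_eq_abs, Real.norm_eq_abs,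
      abs_of_pos (by positivity : 0 < 1 / δ), mul_one_div]
    gcongr
    exact hK1 _
  · have : lapl (fun y => φ (ℓ y)) y = deriv (deriv φ) (ℓ y) * ‖ℓ‖ ^ 2 := by
      rw [lapl, ← sum_clm_sq, Finset.mul_sum]
      refine Finset.sum_congr rfl fun i _ => ?_
      rw [hess_comp_real hφc]; ring
    rw [this, hℓn, one_pow, mul_one, (d2 _).deriv, abs_mul, abs_mul, abs_neg,
      abs_of_pos (by positivity : 0 < 1 / δ)]
    calc _ = |deriv (deriv kap) (3 - ℓ y / δ)| / δ ^ 2 := by field_simp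
      _ ≤ _ := by gcongr; exact hK2 _

theorem stripCut_eq_zero {e : EuclideanSpace ℝ ι} {δ : ℝ} (hδ : 0 < δ) {y : EuclideanSpace ℝ ι}
    (h : ⟪y, e⟫ ≤ 2 * δ) : stripCut e δ y = 0 := by
  refine kap_eq_zero ?_
  rw [real_inner_comm] at h
  have : ⟪e, y⟫ / δ ≤ 2 := by rwa [div_le_iff₀ hδ]
  linarith

theorem stripCut_eq_one {e : EuclideanSpace ℝ ι} {δ : ℝ} (hδ : 0 < δ) {y : EuclideanSpace ℝ ι}
    (h : 3 * δ ≤ ⟪y, e⟫) : stripCut e δ y = 1 := by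
  refine kap_eq_one ?_
  rw [real_inner_comm] at h
  have : 3 ≤ ⟪e, y⟫ / δ := by rwa [le_div_iff₀ hδ]
  linarith

theorem exists_cutoff_extension (ι : Type*) [Fintype ι] {C₁ : ℝ} (hC₁ : 0 ≤ C₁) :
    ∃ C : ℝ, 0 ≤ C ∧ ∀ (δ : ℝ) (e : EuclideanSpace ℝ ι) (D : Set (EuclideanSpace ℝ ι))
    (h : EuclideanSpace ℝ ι → ℝ), 0 < δ → δ ≤ 1 / 64 → ‖e‖ = 1 →
    (∀ x, ‖x‖ < 1 → δ < ⟪x, e⟫ → x ∈ D) →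
    (∀ x ∈ D, ‖x‖ < 1 → ContDiffAt ℝ 2 h x ∧ |h x| ≤ 1 ∧ |lapl h x| ≤ δ) →
    (∀ x ∈ D, ‖x‖ < 1 / 2 → |h x| ≤ C₁ * (|⟪x, e⟫| + δ)) →
    ∃ w : EuclideanSpace ℝ ι → ℝ, ContDiff ℝ 2 w ∧
      (∀ z ∈ closedBall (0 : EuclideanSpace ℝ ι) (1 / 4), |w z| ≤ 1) ∧
      (∀ z ∈ closedBall (0 : EuclideanSpace ℝ ι) (1 / 4), ⟪z, e⟫ < 2 * δ → w z = 0 ∧ lapl w z = 0) ∧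
      (∀ z ∈ closedBall (0 : EuclideanSpace ℝ ι) (1 / 4), 3 * δ < ⟪z, e⟫ → w z = h z) ∧
      (∀ z ∈ closedBall (0 : EuclideanSpace ℝ ι) (1 / 4),
        |lapl w z| ≤ δ + C / δ * slab e δ z) := by
  obtain ⟨K, hK0, hK⟩ := exists_stripCut_bounds ι
  obtain ⟨Cg, hCg1, hCg⟩ := exists_gradient_bound ι
  set N : ℝ := ((Fintype.card ι : ℕ) : ℝ) with hN
  have hN0 : 0 ≤ N := by positivity
  set Kg := Cg * (C₁ * 5 * 4 + 1) with hKg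
  refine ⟨1 + C₁ * 5 * K + 2 * (N * (K * Kg)), by positivity, ?_⟩
  intro δ e D h hδ hδ1 he hD hh hh1
  have hcont : Continuous fun y : EuclideanSpace ℝ ι => ⟪y, e⟫ := by fun_prop
  have hcut := contDiff_stripCut e δ
  set H : EuclideanSpace ℝ ι → ℝ := fun y => stripCut e δ y * h y with hH
  have near0 : ∀ y, ⟪y, e⟫ < 2 * δ → H =ᶠ[𝓝 y] fun _ => 0 := by
    intro y hy
    filter_upwards [(isOpen_lt hcont continuous_const).mem_nhds hy] with z hz
    simp [hH, stripCut_eq_zero hδ (le_of_lt hz)]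
  have near1 : ∀ y, 3 * δ < ⟪y, e⟫ → H =ᶠ[𝓝 y] h := by
    intro y hy
    filter_upwards [(isOpen_lt continuous_const hcont).mem_nhds hy] with z hz
    simp [hH, stripCut_eq_one hδ (le_of_lt hz)]
  have hHC : ∀ y, ‖y‖ < 1 → ContDiffAt ℝ 2 H y := by
    intro y hy
    rcases lt_or_ge ⟪y, e⟫ (2 * δ) with h2 | h2
    · exact contDiffAt_const.congr_of_eventuallyEq (near0 y h2)
    · exact hcut.contDiffAt.mul (hh y (hD y hy (by linarith)) hy).1
  have hHb : ∀ y, ‖y‖ < 1 → |H y| ≤ 1 := by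
    intro y hy
    rcases lt_or_ge ⟪y, e⟫ (2 * δ) with h2 | h2
    · rw [(near0 y h2).eq_of_nhds]; simp
    · rw [hH]
      simp only [abs_mul]
      have := (hh y (hD y hy (by linarith)) hy).2.1
      have h3 : |stripCut e δ y| ≤ 1 := by
        rw [stripCut, abs_of_nonneg (kap_nonneg _)]; exact kap_le_one _
      nlinarith [abs_nonneg (h y), abs_nonneg (stripCut e δ y)]
  obtain ⟨w, hw, hwH⟩ := exists_contDiff_extension (w := H) (x := 0) (R := 1 / 4) (by norm_num)
    (fun y hy => hHC y (by rw [mem_closedBall_zero_iff] at hy; linarith))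
  refine ⟨w, hw, fun z hz => ?_, fun z hz hz2 => ?_, fun z hz hz3 => ?_, fun z hz => ?_⟩
  · rw [(hwH z hz).eq_of_nhds]
    exact hHb z (by rw [mem_closedBall_zero_iff] at hz; linarith)
  · have := (hwH z hz).trans (near0 z hz2)
    refine ⟨this.eq_of_nhds, ?_⟩
    rw [lapl_congr this]
    have h0 := lapl_const_mul (f := fun _ => (0 : ℝ)) (x := z) 0 contDiffAt_const
    simpa using h0
  · exact ((hwH z hz).trans (near1 z hz3)).eq_of_nhds
  · rw [lapl_congr (hwH z hz)]
    rw [mem_closedBall_zero_iff] at hz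
    have hz1 : ‖z‖ < 1 := by linarith
    have hsl := slab_nonneg he hδ z
    set C := 1 + C₁ * 5 * K + 2 * (N * (K * Kg)) with hC
    have hC0 : 0 ≤ C := by positivity
    rcases lt_or_ge ⟪z, e⟫ (2 * δ) with h2 | h2
    · rw [lapl_congr (near0 z h2)]
      have h0 := lapl_const_mul (f := fun _ => (0 : ℝ)) (x := z) 0 contDiffAt_const
      have h0' : lapl (fun _ : EuclideanSpace ℝ ι => (0 : ℝ)) z = 0 := by simpa using h0
      rw [h0', abs_zero]; positivity
    rcases lt_or_ge (3 * δ) ⟪z, e⟫ with h3 | h3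
    · rw [lapl_congr (near1 z h3)]
      have := (hh z (hD z hz1 (by linarith)) hz1).2.2
      have : 0 ≤ C / δ * slab e δ z := by positivity
      linarith
    rw [slab_eq_one he hδ h2 h3, mul_one]
    obtain ⟨k1, k2⟩ := hK e δ z he hδ
    obtain ⟨h0, -, hl⟩ := hh z (hD z hz1 (by linarith)) hz1
    have ball : ∀ y ∈ closedBall z (2 * (δ / 4)), ‖y‖ < 1 / 2 ∧ δ < ⟪y, e⟫ ∧ ⟪y, e⟫ ≤ 4 * δ := by
      intro y hy
      rw [mem_closedBall_iff_norm] at hy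
      have e1 := abs_real_inner_le_norm (y - z) e
      rw [he, mul_one, inner_sub_left, abs_le] at e1
      refine ⟨?_, by linarith [e1.1], by linarith [e1.2]⟩
      have := norm_add_le z (y - z)
      rw [add_sub_cancel] at this
      linarith
    have hgrad := hCg h z (δ / 4) (C₁ * (5 * δ)) δ (by positivity)
      (fun y hy => (hh y (hD y (by linarith [(ball y hy).1]) (ball y hy).2.1)
        (by linarith [(ball y hy).1])).1)
      (fun y hy => by
        obtain ⟨b1, b2, b3⟩ := ball y hy
        refine (hh1 y (hD y (by linarith) b2) b1).trans ?_
        rw [abs_of_pos (by linarith)]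
        gcongr; linarith)
      (fun y hy => (hh y (hD y (by linarith [(ball y hy).1]) (ball y hy).2.1)
        (by linarith [(ball y hy).1])).2.2)
    have hgrad' : ‖fderiv ℝ h z‖ ≤ Kg := by
      refine hgrad.trans ?_
      rw [hKg]
      gcongr
      · refine le_of_eq ?_
        field_simp
      · nlinarith
    have hhz : |h z| ≤ C₁ * (5 * δ) := by
      refine (hh1 z (hD z hz1 (by linarith)) (by linarith)).trans ?_
      rw [abs_of_nonneg (by linarith)]
      gcongr; linarith
    rw [hH, lapl_mul hcut.contDiffAt h0]
    have h3' : |stripCut e δ z| ≤ 1 := by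
      rw [stripCut, abs_of_nonneg (kap_nonneg _)]; exact kap_le_one _
    have t1 : |stripCut e δ z * lapl h z| ≤ 1 * δ := by
      rw [abs_mul]; exact mul_le_mul h3' hl (abs_nonneg _) zero_le_one
    have t2 : |h z * lapl (stripCut e δ) z| ≤ C₁ * 5 * K / δ := by
      rw [abs_mul]
      calc _ ≤ C₁ * (5 * δ) * (K / δ ^ 2) := mul_le_mul hhz k2 (abs_nonneg _) (by positivity)
        _ = _ := by field_simp
    have t3 := abs_sum_clm_mul_le (fderiv ℝ (stripCut e δ) z) (fderiv ℝ h z)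
    have t3' : ‖fderiv ℝ (stripCut e δ) z‖ * ‖fderiv ℝ h z‖ ≤ K / δ * Kg :=
      mul_le_mul k1 hgrad' (norm_nonneg _) (by positivity)
    have t3'' := t3.trans (mul_le_mul_of_nonneg_left t3' hN0)
    refine (abs_add_three _ _ _).trans ?_
    rw [abs_mul 2, abs_of_pos (by norm_num : (0:ℝ) < 2)]
    have t4 : 0 ≤ 1 / δ := by positivity
    calc _ ≤ 1 * δ + C₁ * 5 * K / δ + 2 * (N * (K / δ * Kg)) := by gcongr
      _ ≤ 1 * δ + C₁ * 5 * K / δ + 2 * (N * (K / δ * Kg)) + 1 / δ := by linarith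
      _ = _ := by rw [hC]; field_simp; ring

end cutoff

/-- A function which is almost harmonic on an almost flat half ball, and almost vanishes on the
flat part of its boundary, has an expansion of second order there. -/
theorem exists_flat_expansion (ι : Type*) [Fintype ι] {C₁ : ℝ} (hC₁ : 0 ≤ C₁) :
    ∃ C : ℝ, 0 ≤ C ∧ ∀ (δ : ℝ) (e : EuclideanSpace ℝ ι) (D : Set (EuclideanSpace ℝ ι))
    (h : EuclideanSpace ℝ ι → ℝ), 0 < δ → δ ≤ 1 / 64 → ‖e‖ = 1 →
    (∀ x, ‖x‖ < 1 → δ < ⟪x, e⟫ → x ∈ D) →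
    (∀ x ∈ D, ‖x‖ < 1 → -δ < ⟪x, e⟫) →
    (∀ x ∈ D, ‖x‖ < 1 → ContDiffAt ℝ 2 h x ∧ |h x| ≤ 1 ∧ |lapl h x| ≤ δ) →
    (∀ x ∈ D, ‖x‖ < 1 / 2 → |h x| ≤ C₁ * (|⟪x, e⟫| + δ)) →
    ∃ (a : ℝ) (b : EuclideanSpace ℝ ι), |a| ≤ C ∧ ‖b‖ ≤ C ∧ ⟪b, e⟫ = 0 ∧
      ∀ x ∈ D, ‖x‖ ≤ 1 / 8 → |h x - a * ⟪x, e⟫ - ⟪b, x⟫ * ⟪x, e⟫| ≤ C * (‖x‖ ^ 3 + √δ) := by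
  obtain ⟨Ce, hCe0, hCe⟩ := exists_cutoff_extension ι hC₁
  obtain ⟨Cr, hCr0, hCr⟩ := exists_mean_reflection_bound ι hCe0
  obtain ⟨Ck, hCk0, hCk⟩ := exists_odd_kernel_expansion (EuclideanSpace ℝ ι)
  set V := volume.real (closedBall (0 : EuclideanSpace ℝ ι) 1) with hV
  set V2 := volume.real (closedBall (0 : EuclideanSpace ℝ ι) 2) with hV2
  have hV0 : 0 ≤ V := measureReal_nonneg
  have hV20 : 0 ≤ V2 := measureReal_nonneg
  have hc := integral_rhoK_pos (F := EuclideanSpace ℝ ι)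
  set c := ∫ y : EuclideanSpace ℝ ι, rhoK y
  set B := 64 * (Ck * V) / c with hB
  have hB0 : 0 ≤ B := by positivity
  set C := B + (Ck * 512 * V2 / c + Cr / c) + (4 * C₁ + 6 * B) with hC
  refine ⟨C, by positivity, ?_⟩
  intro δ e D h hδ hδ1 he hD hD' hh hh1
  obtain ⟨w, hw, hw1, hw2, hw3, hwl⟩ := hCe δ e D h hδ hδ1 he hD hh hh1
  obtain ⟨α, β, hαc, hβc, hαb, hβb, hα0, hβ0, hβe, hexp⟩ := hCk e he
  have hwc : Continuous fun y : EuclideanSpace ℝ ι => w ((1 / 8 : ℝ) • y) :=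
    hw.continuous.comp (by fun_prop)
  have hwb : ∀ y ∈ closedBall (0 : EuclideanSpace ℝ ι) 2, |w ((1 / 8 : ℝ) • y)| ≤ 1 := by
    intro y hy
    refine hw1 _ ?_
    rw [mem_closedBall_zero_iff] at hy ⊢
    rw [norm_smul, Real.norm_eq_abs, abs_of_pos (by norm_num)]; linarith
  have hwb1 : ∀ y ∈ closedBall (0 : EuclideanSpace ℝ ι) 1, |w ((1 / 8 : ℝ) • y)| ≤ 1 :=
    fun y hy => hwb y (closedBall_subset_closedBall (by norm_num) hy)
  set a0 := ∫ y, α y * w ((1 / 8 : ℝ) • y) with ha0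
  set b0 := ∫ y, w ((1 / 8 : ℝ) • y) • β y with hb0
  have ia : |a0| ≤ Ck * V := by
    have := abs_integral_kernel_le (k := α) (q := fun y => w ((1 / 8 : ℝ) • y)) hα0 hαb hwb1
    rwa [mul_one] at this
  have hbi : Integrable fun y => w ((1 / 8 : ℝ) • y) • β y :=
    (hwc.smul hβc).integrable_of_hasCompactSupport
      (HasCompactSupport.intro (isCompact_closedBall (0 : EuclideanSpace ℝ ι) 1) fun y hy => by
        simp [hβ0 y hy])
  have ib : ‖b0‖ ≤ Ck * V := by
    have h0 : b0 = ∫ y in closedBall (0 : EuclideanSpace ℝ ι) 1, w ((1 / 8 : ℝ) • y) • β y := by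
      rw [setIntegral_eq_integral_of_forall_compl_eq_zero]
      intro y hy; simp [hβ0 y hy]
    rw [h0]
    refine norm_setIntegral_le_of_norm_le_const
      (isCompact_closedBall (0 : EuclideanSpace ℝ ι) 1).measure_lt_top ?_
    intro y hy
    rw [norm_smul]
    calc _ ≤ 1 * Ck := mul_le_mul (hwb1 y hy) (hβb y) (norm_nonneg _) zero_le_one
      _ = Ck := one_mul _
  have hbp : ∀ p, ∫ y, ⟪β y, p⟫ * w ((1 / 8 : ℝ) • y) = ⟪b0, p⟫ := by
    intro p
    have := integral_inner (𝕜 := ℝ) hbi p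
    rw [hb0, real_inner_comm, ← this]
    congr 1; ext y
    rw [inner_smul_right, real_inner_comm p]; ring
  refine ⟨8 * a0 / c, (64 / c) • b0, ?_, ?_, ?_, ?_⟩
  · rw [abs_div, abs_of_pos hc, abs_mul, abs_of_pos (by norm_num : (0:ℝ) < 8)]
    have : 8 * |a0| / c ≤ B := by
      rw [hB]; gcongr; linarith [mul_nonneg hCk0 hV0]
    have : 0 ≤ Ck * 512 * V2 / c + Cr / c := by positivity
    linarith
  · rw [norm_smul, Real.norm_eq_abs, abs_of_pos (by positivity)]
    have : 64 / c * ‖b0‖ ≤ B := by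
      calc _ ≤ 64 / c * (Ck * V) := by gcongr
        _ = B := by rw [hB]; ring
    have : 0 ≤ Ck * 512 * V2 / c + Cr / c := by positivity
    linarith
  · rw [inner_smul_left, ← hbp e]
    simp [hβe]
  · intro x hx hx8
    have hbn : ‖(64 / c) • b0‖ ≤ B := by
      rw [norm_smul, Real.norm_eq_abs, abs_of_pos (by positivity)]
      calc _ ≤ 64 / c * (Ck * V) := by gcongr
        _ = B := by rw [hB]; ring
    have han : |8 * a0 / c| ≤ B := by
      rw [abs_div, abs_of_pos hc, abs_mul, abs_of_pos (by norm_num : (0:ℝ) < 8), hB]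
      gcongr; linarith [mul_nonneg hCk0 hV0]
    have hδs : δ ≤ √δ := by
      have h1 := Real.mul_self_sqrt hδ.le
      have h2 : √δ ≤ 1 := by rw [Real.sqrt_le_left (by norm_num)]; linarith
      nlinarith [Real.sqrt_nonneg δ]
    have hs0 := Real.sqrt_nonneg δ
    have hx30 : 0 ≤ ‖x‖ ^ 3 := by positivity
    rcases le_or_gt ⟪x, e⟫ (3 * δ) with h3 | h3
    · have hxe : |⟪x, e⟫| ≤ 3 * δ := by
        rw [abs_le]; exact ⟨by linarith [hD' x hx (by linarith)], h3⟩
      have t1 : |h x| ≤ C₁ * (4 * δ) := (hh1 x hx (by linarith)).trans (by gcongr; linarith)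
      have t2 : |8 * a0 / c * ⟪x, e⟫| ≤ B * (3 * δ) := by
        rw [abs_mul]; exact mul_le_mul han hxe (abs_nonneg _) hB0
      have t3 : |⟪(64 / c) • b0, x⟫ * ⟪x, e⟫| ≤ B * (3 * δ) := by
        rw [abs_mul]
        refine mul_le_mul ?_ hxe (abs_nonneg _) hB0
        refine (abs_real_inner_le_norm _ _).trans ?_
        calc _ ≤ B * 1 := mul_le_mul hbn (by linarith) (norm_nonneg _) hB0
          _ = B := mul_one _
      have t4 : 0 ≤ Ck * 512 * V2 / c + Cr / c := by positivity
      calc _ ≤ |h x| + |8 * a0 / c * ⟪x, e⟫| + |⟪(64 / c) • b0, x⟫ * ⟪x, e⟫| :=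
            (abs_sub _ _).trans (by gcongr; exact abs_sub _ _)
        _ ≤ (4 * C₁ + 6 * B) * δ := by linarith
        _ ≤ C * (‖x‖ ^ 3 + √δ) := by
            refine mul_le_mul ?_ (by linarith) hδ.le (by positivity)
            rw [hC]; linarith
    · have hz : x ∈ closedBall (0 : EuclideanSpace ℝ ι) (1 / 4) := by
        rw [mem_closedBall_zero_iff]; linarith
      set xs := x - (2 * ⟪x, e⟫) • e with hxs
      have hee : ⟪e, e⟫ = 1 := by rw [real_inner_self_eq_norm_sq, he]; norm_num
      have hxs_norm : ‖xs‖ ≤ 1 / 8 := by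
        have : ‖xs‖ ^ 2 = ‖x‖ ^ 2 := by
          rw [hxs, norm_sub_sq_real, inner_smul_right, norm_smul, he, mul_one, Real.norm_eq_abs,
            sq_abs]
          ring
        rw [← sq_le_sq₀ (norm_nonneg _) (by norm_num), this]
        gcongr
      have hxse : ⟪xs, e⟫ = -⟪x, e⟫ := by
        rw [hxs, inner_sub_left, inner_smul_left, hee]; simp; ring
      have hwxs : w xs = 0 := (hw2 xs (by rw [mem_closedBall_zero_iff]; linarith)
        (by rw [hxse]; linarith)).1
      have hr := hCr δ e x w hδ hδ1 he hx8 (by linarith) hw (fun z hz hz2 => (hw2 z hz hz2).2) hwl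
      rw [← hxs, hwxs, hw3 x hz h3, sub_zero] at hr
      set p := (8 : ℝ) • x with hp
      have hpn : ‖p‖ = 8 * ‖x‖ := by
        rw [hp, norm_smul, Real.norm_eq_abs, abs_of_pos (by norm_num)]
      have hp1 : ‖p‖ ≤ 1 := by rw [hpn]; linarith
      have hpe : ⟪p, e⟫ = 8 * ⟪x, e⟫ := by rw [hp, inner_smul_left]; simp
      have hps : p - (2 * ⟪p, e⟫) • e = (8 : ℝ) • xs := by
        rw [hpe, hxs, hp, smul_sub, smul_smul]; congr 2; ring
      have hpsn : ‖(8 : ℝ) • xs‖ ≤ 1 := by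
        rw [norm_smul, Real.norm_eq_abs, abs_of_pos (by norm_num)]; linarith
      have shift : ∀ z : EuclideanSpace ℝ ι, ∫ y, rhoK y * w (z + (1 / 8 : ℝ) • y)
          = ∫ y, rhoK (y - (8 : ℝ) • z) * w ((1 / 8 : ℝ) • y) := by
        intro z
        rw [← integral_sub_right_eq_self (fun y => rhoK y * w (z + (1 / 8 : ℝ) • y)) ((8 : ℝ) • z)]
        congr 1; ext y
        congr 2
        rw [smul_sub, smul_smul]; norm_num
      have cs : ∀ q : EuclideanSpace ℝ ι, ‖q‖ ≤ 1 →
          Integrable (fun y => rhoK (y - q) * w ((1 / 8 : ℝ) • y)) ∧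
          ∀ y ∉ closedBall (0 : EuclideanSpace ℝ ι) 2, rhoK (y - q) = 0 := by
        intro q hq
        have h0 : ∀ y ∉ closedBall (0 : EuclideanSpace ℝ ι) 2, rhoK (y - q) = 0 := by
          intro y hy
          refine rhoK_eq_zero fun hy' => hy ?_
          rw [mem_closedBall_zero_iff] at hy' ⊢
          have := norm_add_le (y - q) q
          rw [sub_add_cancel] at this; linarith
        have hrc : Continuous fun y : EuclideanSpace ℝ ι => rhoK (y - q) :=
          continuous_rhoK.comp (by fun_prop)
        refine ⟨(hrc.mul hwc).integrable_of_hasCompactSupport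
          (HasCompactSupport.intro (isCompact_closedBall (0 : EuclideanSpace ℝ ι) 2) fun y hy => by
            simp [h0 y hy]), h0⟩
      have i3 : Integrable fun y => α y * w ((1 / 8 : ℝ) • y) := integrable_kernel_mul hαc hα0 hwc
      have i4 : Integrable fun y => ⟪β y, p⟫ * w ((1 / 8 : ℝ) • y) :=
        integrable_kernel_mul (by fun_prop) (fun y hy => by simp [hβ0 y hy]) hwc
      have hid : ∫ y, (rhoK (y - p) - rhoK (y - (p - (2 * ⟪p, e⟫) • e))
            - ⟪p, e⟫ * α y - ⟪p, e⟫ * ⟪β y, p⟫) * w ((1 / 8 : ℝ) • y)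
          = (∫ y, rhoK (y - p) * w ((1 / 8 : ℝ) • y))
            - (∫ y, rhoK (y - (8 : ℝ) • xs) * w ((1 / 8 : ℝ) • y))
            - ⟪p, e⟫ * a0 - ⟪p, e⟫ * ⟪b0, p⟫ := by
        have i1 := (cs p hp1).1
        have i2 := (cs _ hpsn).1
        have i12 : Integrable fun y => rhoK (y - p) * w ((1 / 8 : ℝ) • y)
            - rhoK (y - (8 : ℝ) • xs) * w ((1 / 8 : ℝ) • y) := i1.sub i2
        have i3' := i3.const_mul ⟪p, e⟫
        have i4' := i4.const_mul ⟪p, e⟫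
        have i123 : Integrable fun y => rhoK (y - p) * w ((1 / 8 : ℝ) • y)
            - rhoK (y - (8 : ℝ) • xs) * w ((1 / 8 : ℝ) • y)
            - ⟪p, e⟫ * (α y * w ((1 / 8 : ℝ) • y)) := i12.sub i3'
        rw [ha0, ← hbp p, ← integral_const_mul, ← integral_const_mul, ← integral_sub i1 i2,
          ← integral_sub i12 i3', ← integral_sub i123 i4', hps]
        congr 1; ext y
        ring
      have herr : |∫ y, (rhoK (y - p) - rhoK (y - (p - (2 * ⟪p, e⟫) • e))
            - ⟪p, e⟫ * α y - ⟪p, e⟫ * ⟪β y, p⟫) * w ((1 / 8 : ℝ) • y)|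
          ≤ Ck * ‖p‖ ^ 3 * V2 := by
        rw [← setIntegral_eq_integral_of_forall_compl_eq_zero
          (s := closedBall (0 : EuclideanSpace ℝ ι) 2), ← Real.norm_eq_abs]
        · refine norm_setIntegral_le_of_norm_le_const
            (isCompact_closedBall (0 : EuclideanSpace ℝ ι) 2).measure_lt_top ?_
          intro y hy
          rw [norm_mul]
          calc _ ≤ Ck * ‖p‖ ^ 3 * 1 :=
                mul_le_mul (hexp p y hp1) (hwb y hy) (abs_nonneg _) (by positivity)
            _ = _ := mul_one _
        · intro y hy
          have hy1 : y ∉ closedBall (0 : EuclideanSpace ℝ ι) 1 := fun h' =>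
            hy (closedBall_subset_closedBall (by norm_num) h')
          rw [(cs p hp1).2 y hy, hps, (cs _ hpsn).2 y hy, hα0 y hy1, hβ0 y hy1]
          simp
      rw [hid] at herr
      rw [shift x, shift xs, ← hp] at hr
      rw [hpe, hpn] at herr
      have hbx : ⟪b0, p⟫ = 8 * ⟪b0, x⟫ := by rw [hp, inner_smul_right]
      rw [hbx] at herr
      set A1 := ∫ y, rhoK (y - p) * w ((1 / 8 : ℝ) • y)
      set A2 := ∫ y, rhoK (y - (8 : ℝ) • xs) * w ((1 / 8 : ℝ) • y)
      have hfin : |c * (h x - 8 * a0 / c * ⟪x, e⟫ - ⟪(64 / c) • b0, x⟫ * ⟪x, e⟫)|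
          ≤ Ck * (8 * ‖x‖) ^ 3 * V2 + Cr * √δ := by
        have e1 : c * (h x - 8 * a0 / c * ⟪x, e⟫ - ⟪(64 / c) • b0, x⟫ * ⟪x, e⟫)
            = (A1 - A2 - 8 * ⟪x, e⟫ * a0 - 8 * ⟪x, e⟫ * (8 * ⟪b0, x⟫)) - (A1 - A2 - c * h x) := by
          rw [inner_smul_left]
          simp
          field_simp
          ring
        rw [e1]
        exact (abs_sub _ _).trans (add_le_add herr hr)
      rw [abs_mul, abs_of_pos hc, ← le_div_iff₀' hc] at hfin
      refine hfin.trans ?_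
      have t5 : 0 ≤ Ck * 512 * V2 / c := by positivity
      have t6 : 0 ≤ Cr / c := by positivity
      calc _ = Ck * 512 * V2 / c * ‖x‖ ^ 3 + Cr / c * √δ := by ring
        _ ≤ C * ‖x‖ ^ 3 + C * √δ := by
            gcongr <;> rw [hC] <;> linarith
        _ = _ := by ring

section boundary_expansion

variable {ι : Type*} [Fintype ι]

/-- The second order boundary model at `x₀`, for the defining function `σ`. -/
noncomputable def bdryModel (σ : EuclideanSpace ℝ ι → ℝ) (x₀ : EuclideanSpace ℝ ι) (a : ℝ)
    (b : EuclideanSpace ℝ ι) (x : EuclideanSpace ℝ ι) : ℝ :=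
  σ x * (a + ⟪b, x - x₀⟫)

/-- Quantitative hypotheses near a boundary point `x₀`: `σ` is a defining function of the domain
`{0 < σ}`, and `v` vanishes on the boundary while its Laplacian is Lipschitz at `x₀`. -/
structure BdryData (c C r : ℝ) (σ v : EuclideanSpace ℝ ι → ℝ) (γ : ℝ)
    (x₀ g : EuclideanSpace ℝ ι) : Prop where
  contDiff : ContDiff ℝ 2 σ
  zero : σ x₀ = 0
  fderiv_eq : ∀ y, fderiv ℝ σ x₀ y = ⟪g, y⟫
  le_norm : c ≤ ‖g‖
  norm_le : ‖g‖ ≤ C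
  abs_le : |γ| ≤ C
  le_norm_fderiv : ∀ y ∈ closedBall x₀ r, c ≤ ‖fderiv ℝ σ y‖
  taylor : ∀ y ∈ closedBall x₀ r, |σ y - ⟪g, y - x₀⟫| ≤ C * ‖y - x₀‖ ^ 2
  fderiv_lip : ∀ y ∈ closedBall x₀ r, ‖fderiv ℝ σ y - fderiv ℝ σ x₀‖ ≤ C * ‖y - x₀‖
  lapl_le : ∀ y ∈ closedBall x₀ r, |lapl σ y| ≤ C
  lapl_lip : ∀ y ∈ closedBall x₀ r, |lapl σ y - lapl σ x₀| ≤ C * ‖y - x₀‖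
  continuousOn : ContinuousOn v (closedBall x₀ r ∩ {y | 0 ≤ σ y})
  eq_zero : ∀ y ∈ closedBall x₀ r, σ y = 0 → v y = 0
  abs_v_le : ∀ y ∈ closedBall x₀ r, 0 ≤ σ y → |v y| ≤ C
  interior : ∀ y ∈ closedBall x₀ r, 0 < σ y →
    ContDiffAt ℝ 2 v y ∧ |lapl v y - γ| ≤ C * ‖y - x₀‖

theorem contDiff_affine (x₀ : EuclideanSpace ℝ ι) (a : ℝ) (b : EuclideanSpace ℝ ι) {n : WithTop ℕ∞} :
    ContDiff ℝ n fun y => a + ⟪b, y - x₀⟫ :=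
  contDiff_const.add (contDiff_const.inner ℝ (contDiff_id.sub contDiff_const))

theorem hasFDerivAt_affine (x₀ : EuclideanSpace ℝ ι) (a : ℝ) (b x : EuclideanSpace ℝ ι) :
    HasFDerivAt (fun y => a + ⟪b, y - x₀⟫) (innerSL ℝ b) x := by
  have := (((innerSL ℝ b).hasFDerivAt (x := x - x₀)).comp x
    ((hasFDerivAt_id x).sub_const x₀)).const_add a
  simpa using this

theorem lapl_affine (x₀ : EuclideanSpace ℝ ι) (a : ℝ) (b x : EuclideanSpace ℝ ι) :
    lapl (fun y => a + ⟪b, y - x₀⟫) x = 0 := by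
  have : hess (fun y => a + ⟪b, y - x₀⟫) x = 0 :=
    hess_eq_of_hasFDerivAt (w' := fun _ => innerSL ℝ b)
      (Eventually.of_forall fun y => hasFDerivAt_affine x₀ a b y) (hasFDerivAt_const _ _)
  simp [lapl, this]

theorem sum_clm_mul_inner (A : EuclideanSpace ℝ ι →L[ℝ] ℝ) (b : EuclideanSpace ℝ ι) :
    ∑ i, A (EuclideanSpace.basisFun ι ℝ i) * innerSL ℝ b (EuclideanSpace.basisFun ι ℝ i) = A b := by
  conv_rhs => rw [← (EuclideanSpace.basisFun ι ℝ).sum_repr b]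
  rw [map_sum]
  refine Finset.sum_congr rfl fun i _ => ?_
  rw [map_smul, smul_eq_mul, mul_comm]
  congr 1
  rw [OrthonormalBasis.repr_apply_apply, innerSL_apply_apply, real_inner_comm]

theorem contDiff_bdryModel {σ : EuclideanSpace ℝ ι → ℝ} (hσ : ContDiff ℝ 2 σ)
    (x₀ : EuclideanSpace ℝ ι) (a : ℝ) (b : EuclideanSpace ℝ ι) :
    ContDiff ℝ 2 (bdryModel σ x₀ a b) :=
  hσ.mul (contDiff_affine x₀ a b)

theorem lapl_bdryModel {σ : EuclideanSpace ℝ ι → ℝ} (hσ : ContDiff ℝ 2 σ)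
    (x₀ : EuclideanSpace ℝ ι) (a : ℝ) (b x : EuclideanSpace ℝ ι) :
    lapl (bdryModel σ x₀ a b) x = (a + ⟪b, x - x₀⟫) * lapl σ x + 2 * fderiv ℝ σ x b := by
  unfold bdryModel
  rw [lapl_mul hσ.contDiffAt (contDiff_affine x₀ a b).contDiffAt, lapl_affine,
    (hasFDerivAt_affine x₀ a b x).fderiv, sum_clm_mul_inner]
  ring

theorem BdryData.abs_lapl_model_sub_le {c C r : ℝ} {σ v : EuclideanSpace ℝ ι → ℝ} {γ : ℝ}
    {x₀ g : EuclideanSpace ℝ ι} (H : BdryData c C r σ v γ x₀ g) (hC : 0 ≤ C) {a : ℝ}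
    {b : EuclideanSpace ℝ ι} (hab : a * lapl σ x₀ + 2 * ⟪b, g⟫ = γ) {x : EuclideanSpace ℝ ι}
    (hx : x ∈ closedBall x₀ r) :
    |lapl (bdryModel σ x₀ a b) x - γ| ≤ 3 * C * (|a| + ‖b‖) * ‖x - x₀‖ := by
  rw [lapl_bdryModel H.contDiff, ← hab]
  have e : (a + ⟪b, x - x₀⟫) * lapl σ x + 2 * fderiv ℝ σ x b - (a * lapl σ x₀ + 2 * ⟪b, g⟫)
      = a * (lapl σ x - lapl σ x₀) + ⟪b, x - x₀⟫ * lapl σ x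
        + 2 * (fderiv ℝ σ x - fderiv ℝ σ x₀) b := by
    rw [sub_apply, H.fderiv_eq, real_inner_comm b g]; ring
  rw [e]
  have t1 : |a * (lapl σ x - lapl σ x₀)| ≤ |a| * (C * ‖x - x₀‖) := by
    rw [abs_mul]; exact mul_le_mul_of_nonneg_left (H.lapl_lip x hx) (abs_nonneg _)
  have t2 : |⟪b, x - x₀⟫ * lapl σ x| ≤ ‖b‖ * ‖x - x₀‖ * C := by
    rw [abs_mul]
    exact mul_le_mul (abs_real_inner_le_norm _ _) (H.lapl_le x hx) (abs_nonneg _) (by positivity)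
  have t3 : |2 * (fderiv ℝ σ x - fderiv ℝ σ x₀) b| ≤ 2 * (C * ‖x - x₀‖ * ‖b‖) := by
    rw [abs_mul, abs_of_pos (by norm_num : (0 : ℝ) < 2)]
    have := (fderiv ℝ σ x - fderiv ℝ σ x₀).le_opNorm b
    rw [Real.norm_eq_abs] at this
    have h2 := mul_le_mul_of_nonneg_right (H.fderiv_lip x hx) (norm_nonneg b)
    linarith
  have t4 : 0 ≤ |a| * (C * ‖x - x₀‖) := by positivity
  refine (abs_add_three _ _ _).trans ?_
  linarith

theorem BdryData.abs_le_of_mem {c C r : ℝ} {σ v : EuclideanSpace ℝ ι → ℝ} {γ : ℝ}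
    {x₀ g : EuclideanSpace ℝ ι} (H : BdryData c C r σ v γ x₀ g) (hC : 0 ≤ C)
    (hr : r ≤ 1) {x : EuclideanSpace ℝ ι} (hx : x ∈ closedBall x₀ r) :
    |σ x| ≤ 2 * C * ‖x - x₀‖ := by
  have h1 := H.taylor x hx
  rw [mem_closedBall_iff_norm] at hx
  have h2 : |⟪g, x - x₀⟫| ≤ C * ‖x - x₀‖ :=
    (abs_real_inner_le_norm _ _).trans (mul_le_mul_of_nonneg_right H.norm_le (norm_nonneg _))
  have h3 := abs_add_le (σ x - ⟪g, x - x₀⟫) ⟪g, x - x₀⟫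
  rw [sub_add_cancel] at h3
  have h4 : C * ‖x - x₀‖ ^ 2 ≤ C * ‖x - x₀‖ := by
    have := norm_nonneg (x - x₀)
    gcongr; nlinarith
  linarith

set_option maxHeartbeats 2000000 in
theorem exists_improvement (ι : Type*) [Fintype ι] {c C r₁ : ℝ} (hc : 0 < c) (hC : 1 ≤ C)
    (hr₁ : 0 < r₁) (hr₁' : r₁ ≤ 1) :
    ∃ s r₀ B : ℝ, 0 < s ∧ s < 1 ∧ 0 < r₀ ∧ r₀ ≤ r₁ ∧ 0 ≤ B ∧
    ∀ (σ v : EuclideanSpace ℝ ι → ℝ) (γ : ℝ) (x₀ g : EuclideanSpace ℝ ι),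
    BdryData c C r₁ σ v γ x₀ g → ∀ (r a : ℝ) (b : EuclideanSpace ℝ ι) (M : ℝ), 0 < r → r ≤ r₀ →
    1 + |a| + ‖b‖ ≤ M → a * lapl σ x₀ + 2 * ⟪b, g⟫ = γ →
    (∀ x ∈ closedBall x₀ r, 0 ≤ σ x → |v x - bdryModel σ x₀ a b x| ≤ M * (r ^ 2 * √r)) →
    ∃ (a' : ℝ) (b' : EuclideanSpace ℝ ι), a' * lapl σ x₀ + 2 * ⟪b', g⟫ = γ ∧
      |a' - a| ≤ B * M * (r * √r) ∧ ‖b' - b‖ ≤ B * M * √r ∧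
      ∀ x ∈ closedBall x₀ (s ^ 2 * r), 0 ≤ σ x →
        |v x - bdryModel σ x₀ a' b' x| ≤ M * (s ^ 5 * (r ^ 2 * √r)) := by
  obtain ⟨rb, hrb, Cb, hCb, HB⟩ := exists_barrier_bound ι hc (by positivity : 0 < 4 * C)
  obtain ⟨Ci, hCi0, HI⟩ := exists_flat_expansion ι (by positivity : 0 ≤ 2 * Cb * C)
  have hC0 : 0 < C := by linarith
  obtain ⟨κ, hκ⟩ : ∃ κ, κ = C / c := ⟨_, rfl⟩
  have hκ0 : 0 < κ := by rw [hκ]; positivity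
  obtain ⟨K, hK⟩ : ∃ K, K = 4 * C + κ := ⟨_, rfl⟩
  have hK0 : 0 < K := by rw [hK]; positivity
  obtain ⟨K', hK'⟩ : ∃ K', K' = κ * (2 * Ci + Ci * κ) + Ci * κ := ⟨_, rfl⟩
  obtain ⟨s, hs⟩ : ∃ s, s = 1 / (8 * (Ci + 1)) := ⟨_, rfl⟩
  have hs0 : 0 < s := by rw [hs]; positivity
  have hs8 : s ≤ 1 / 8 := by
    rw [hs]; apply one_div_le_one_div_of_le (by norm_num); linarith
  have hsC : Ci * s ≤ 1 / 8 := by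
    rw [hs, mul_one_div, div_le_div_iff₀ (by positivity) (by norm_num)]; linarith
  obtain ⟨ε, hε, hr⟩ : ∃ ε > 0, ∀ r : ℝ, 0 < r → r < ε →
      Ci * √(K * √r) + K' * r < s ^ 5 / 2 ∧ K * √r < 1 / 64 ∧ C * √r < 1 := by
    have h1 : Tendsto (fun r : ℝ => Ci * √(K * √r) + K' * r) (𝓝 0) (𝓝 0) := by
      have : Continuous fun r : ℝ => Ci * √(K * √r) + K' * r := by fun_prop
      simpa using this.tendsto 0
    have h2 : ∀ L : ℝ, Tendsto (fun r : ℝ => L * √r) (𝓝 0) (𝓝 0) := fun L => by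
      have : Continuous fun r : ℝ => L * √r := by fun_prop
      simpa using this.tendsto 0
    have h3 := ((h1.eventually_lt_const (by positivity : 0 < s ^ 5 / 2)).and
      (((h2 K).eventually_lt_const (by norm_num : (0 : ℝ) < 1 / 64)).and
        ((h2 C).eventually_lt_const one_pos)))
    obtain ⟨ε, hε, h⟩ := Metric.eventually_nhds_iff.1 h3
    exact ⟨ε, hε, fun r h0 hr => h (by rwa [Real.dist_eq, sub_zero, abs_of_pos h0])⟩
  refine ⟨s, min (ε / 2) (min r₁ rb), (Ci + Ci * κ) / c, hs0, by linarith, by positivity,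
    (min_le_right _ _).trans (min_le_left _ _), by positivity, ?_⟩
  intro σ v γ x₀ g H r a b M hr0 hrr hM hab hq
  obtain ⟨hr1, hr2, hr3⟩ := hr r hr0 (by linarith [min_le_left (ε / 2) (min r₁ rb)])
  have hrr₁ : r ≤ r₁ := hrr.trans ((min_le_right _ _).trans (min_le_left _ _))
  have hrrb : r ≤ rb := hrr.trans ((min_le_right _ _).trans (min_le_right _ _))
  have hr1' : r ≤ 1 := hrr₁.trans hr₁'
  have hM1 : 1 ≤ M := by linarith [abs_nonneg a, norm_nonneg b]
  obtain ⟨R, hR⟩ : ∃ R, R = √r := ⟨_, rfl⟩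
  have hR0 : 0 < R := by rw [hR]; positivity
  have hRr : r = R ^ 2 := by rw [hR, Real.sq_sqrt hr0.le]
  have hR1 : R ≤ 1 := by rw [hR]; exact Real.sqrt_le_one.2 hr1'
  rw [← hR] at hr1 hr2 hr3 hq ⊢
  have hrR : r ≤ R := by rw [hRr]; exact pow_le_of_le_one hR0.le hR1 two_ne_zero
  obtain ⟨s0, hs0'⟩ : ∃ s0, s0 = ‖g‖ := ⟨_, rfl⟩
  have hcs : c ≤ s0 := hs0' ▸ H.le_norm
  have hsC0 : s0 ≤ C := hs0' ▸ H.norm_le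
  have hs00 : 0 < s0 := by linarith
  obtain ⟨e, he⟩ : ∃ e, e = s0⁻¹ • g := ⟨_, rfl⟩
  have hge : g = s0 • e := by rw [he, smul_smul, mul_inv_cancel₀ hs00.ne', one_smul]
  have hen : ‖e‖ = 1 := by
    rw [he, norm_smul, norm_inv, Real.norm_eq_abs, abs_of_pos hs00, ← hs0',
      inv_mul_cancel₀ hs00.ne']
  have hball : ∀ y : EuclideanSpace ℝ ι, ‖y‖ ≤ 1 → x₀ + r • y ∈ closedBall x₀ r := by
    intro y hy
    rw [mem_closedBall_iff_norm, add_sub_cancel_left, norm_smul, Real.norm_eq_abs, abs_of_pos hr0]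
    exact mul_le_of_le_one_right hr0.le hy
  have hsub : closedBall x₀ r ⊆ closedBall x₀ r₁ := closedBall_subset_closedBall hrr₁
  have hty : ∀ y : EuclideanSpace ℝ ι, ‖y‖ ≤ 1 →
      |σ (x₀ + r • y) - s0 * r * ⟪y, e⟫| ≤ C * r ^ 2 := by
    intro y hy
    have h1 := H.taylor _ (hsub (hball y hy))
    rw [add_sub_cancel_left, inner_smul_right, norm_smul, Real.norm_eq_abs, abs_of_pos hr0, hge,
      inner_smul_left, real_inner_comm] at h1
    simp only [conj_trivial] at h1
    have h2 : C * (r * ‖y‖) ^ 2 ≤ C * r ^ 2 := by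
      gcongr
      exact mul_le_of_le_one_right hr0.le hy
    have h3 : r * (s0 * ⟪y, e⟫) = s0 * r * ⟪y, e⟫ := by ring
    rw [h3] at h1
    linarith
  set q : EuclideanSpace ℝ ι → ℝ := fun x => v x - bdryModel σ x₀ a b x with hqd
  have hmc := contDiff_bdryModel H.contDiff x₀ a b
  have hqC : ∀ x ∈ closedBall x₀ r, 0 < σ x → ContDiffAt ℝ 2 q x ∧ |lapl q x| ≤ 4 * C * M * r := by
    intro x hx hx0
    obtain ⟨h1, h2⟩ := H.interior x (hsub hx) hx0
    refine ⟨h1.sub hmc.contDiffAt, ?_⟩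
    rw [hqd, lapl_sub h1 hmc.contDiffAt]
    have h3 := H.abs_lapl_model_sub_le hC0.le hab (hsub hx)
    rw [mem_closedBall_iff_norm] at hx
    have e1 : lapl v x - lapl (bdryModel σ x₀ a b) x
        = (lapl v x - γ) - (lapl (bdryModel σ x₀ a b) x - γ) := by ring
    rw [e1]
    refine (abs_sub _ _).trans ?_
    have h4 : C * ‖x - x₀‖ ≤ C * M * r := by
      rw [mul_assoc]; gcongr; exact hx.trans (le_mul_of_one_le_left hr0.le hM1)
    have h5 : 3 * C * (|a| + ‖b‖) * ‖x - x₀‖ ≤ 3 * C * M * r := by gcongr; linarith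
    linarith
  have hqbar : ∀ x, ‖x - x₀‖ ≤ r / 2 → 0 ≤ σ x →
      |q x| ≤ Cb * (M * (r ^ 2 * R)) * (σ x / (r / 2)) := by
    intro x hx hx0
    have hs : closedBall x (r / 2) ⊆ closedBall x₀ r :=
      closedBall_subset_closedBall' (by rw [dist_eq_norm]; linarith)
    refine HB σ q x (r / 2) _ (by positivity) (by linarith) (by positivity) ?_ hx0 ?_ ?_ ?_ ?_
    · intro y hy
      have hy1 := hsub (hs hy)
      refine ⟨H.contDiff.contDiffAt, ?_, ?_, H.le_norm_fderiv y hy1⟩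
      · have h1 := H.abs_le_of_mem hC0.le hr₁' hy1
        have h2 := hs hy
        rw [mem_closedBall_iff_norm] at h2
        refine h1.trans ?_
        calc 2 * C * ‖y - x₀‖ ≤ 2 * C * r := by gcongr
          _ = _ := by ring
      · linarith [H.lapl_le y hy1]
    · exact (H.continuousOn.mono (inter_subset_inter_left _ (hs.trans hsub))).sub
        hmc.continuous.continuousOn
    · exact fun y hy hy0 => hq y (hs hy) hy0
    · intro y hy hy0
      simp [hqd, bdryModel, hy0, H.eq_zero y (hsub (hs hy)) hy0]
    · intro y hy hy0
      obtain ⟨h1, h2⟩ := hqC y (hs hy) hy0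
      refine ⟨h1, h2.trans ?_⟩
      have : M * (r ^ 2 * R) / (r / 2) ^ 2 = 4 * M * R := by field_simp; ring
      rw [this]
      calc 4 * C * M * r = 4 * M * R * (C * R) := by rw [hRr]; ring
        _ ≤ 4 * M * R * 1 := by gcongr
        _ = _ := by ring
  set m := M * (r ^ 2 * R) with hm
  have hm0 : 0 < m := by rw [hm]; positivity
  set h : EuclideanSpace ℝ ι → ℝ := fun y => m⁻¹ * q (x₀ + r • y) with hh
  set D : Set (EuclideanSpace ℝ ι) := {y | 0 < σ (x₀ + r • y)} with hD
  have hδ0 : 0 < K * R := by positivity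
  have hcr : C * r ≤ s0 * (K * R) := by
    have h1 : C = κ * c := by rw [hκ]; field_simp
    calc C * r ≤ κ * c * R := by rw [← h1]; gcongr
      _ ≤ κ * s0 * R := by gcongr
      _ ≤ s0 * (K * R) := by
        rw [hK]
        have : 0 ≤ s0 * (4 * C * R) := by positivity
        linarith
  have hI : ∃ (A : ℝ) (Bv : EuclideanSpace ℝ ι), |A| ≤ Ci ∧ ‖Bv‖ ≤ Ci ∧ ⟪Bv, e⟫ = 0 ∧
      ∀ x ∈ D, ‖x‖ ≤ 1 / 8 → |h x - A * ⟪x, e⟫ - ⟪Bv, x⟫ * ⟪x, e⟫|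
        ≤ Ci * (‖x‖ ^ 3 + √(K * R)) := by
    refine HI (K * R) e D h hδ0 hr2.le hen ?_ ?_ ?_ ?_
    · intro y hy hye
      have h1 := (abs_le.1 (hty y hy.le)).1
      have h2 : s0 * r * (K * R) < s0 * r * ⟪y, e⟫ := by gcongr
      have h3 : C * r * r ≤ s0 * (K * R) * r := by gcongr
      show 0 < σ (x₀ + r • y)
      linarith
    · intro y hyD hy
      have h1 := (abs_le.1 (hty y hy.le)).2
      have h0 : 0 < σ (x₀ + r • y) := hyD
      have h3 : C * r * r ≤ s0 * (K * R) * r := by gcongr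
      have h4 : 0 < s0 * r * (⟪y, e⟫ + K * R) := by linarith
      have := pos_of_mul_pos_right h4 (by positivity)
      linarith
    · intro y hyD hy
      have hb := hball y hy.le
      obtain ⟨h1, h2⟩ := hqC _ hb hyD
      have h3 : ContDiffAt ℝ 2 (fun y => q (x₀ + r • y)) y := by
        have h4 : ContDiffAt ℝ 2 (fun y : EuclideanSpace ℝ ι => x₀ + r • y) y := by fun_prop
        exact ContDiffAt.comp (g := q) (f := fun y : EuclideanSpace ℝ ι => x₀ + r • y) y h1 h4
      refine ⟨contDiffAt_const.mul h3, ?_, ?_⟩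
      · rw [hh]
        simp only [abs_mul, abs_inv, abs_of_pos hm0]
        rw [inv_mul_le_iff₀ hm0, mul_one]
        exact hq _ hb (le_of_lt hyD)
      · rw [hh, lapl_const_mul _ h3, lapl_comp_affine x₀ r h1, abs_mul, abs_inv, abs_of_pos hm0,
          inv_mul_le_iff₀ hm0, abs_mul, abs_of_pos (by positivity : 0 < r ^ 2)]
        calc r ^ 2 * |lapl q (x₀ + r • y)| ≤ r ^ 2 * (4 * C * M * r) := by gcongr
          _ = M * (r ^ 2 * R) * (4 * C * R) := by rw [hRr]; ring
          _ ≤ M * (r ^ 2 * R) * (K * R) := by gcongr; linarith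
    · intro y hyD hy
      have h0 : 0 < σ (x₀ + r • y) := hyD
      have h1 := hqbar (x₀ + r • y) (by
        rw [add_sub_cancel_left, norm_smul, Real.norm_eq_abs, abs_of_pos hr0]
        linarith [mul_le_mul_of_nonneg_left hy.le hr0.le]) h0.le
      rw [hh]
      simp only [abs_mul, abs_inv, abs_of_pos hm0]
      rw [inv_mul_le_iff₀ hm0]
      refine h1.trans ?_
      have h2 := (abs_le.1 (hty y (by linarith))).2
      have h3 : s0 * r * ⟪y, e⟫ ≤ C * r * |⟪y, e⟫| := by
        calc s0 * r * ⟪y, e⟫ ≤ s0 * r * |⟪y, e⟫| := by gcongr; exact le_abs_self _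
          _ ≤ _ := by gcongr
      have h4 : r ≤ K * R := by
        have : 1 ≤ K := by rw [hK]; linarith
        exact hrR.trans (le_mul_of_one_le_left hR0.le this)
      have h5 : C * r ^ 2 ≤ C * r * (K * R) := by rw [sq, ← mul_assoc]; gcongr
      have h6 : σ (x₀ + r • y) ≤ C * r * (|⟪y, e⟫| + K * R) := by linarith
      calc Cb * m * (σ (x₀ + r • y) / (r / 2))
          ≤ Cb * m * (C * r * (|⟪y, e⟫| + K * R) / (r / 2)) := by gcongr
        _ = _ := by field_simp
  obtain ⟨A, Bv, hA, hBv, hBe, hexp⟩ := hI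
  obtain ⟨τ, hτ⟩ : ∃ τ, τ = -(A * r * lapl σ x₀ / (2 * s0)) := ⟨_, rfl⟩
  have hx₀ : x₀ ∈ closedBall x₀ r₁ := mem_closedBall_self hr₁.le
  have hτb : |τ| ≤ Ci * κ * r := by
    rw [hτ, abs_neg, abs_div, abs_mul, abs_mul, abs_of_pos hr0,
      abs_of_pos (by positivity : 0 < 2 * s0), div_le_iff₀ (by positivity)]
    have h1 : C = κ * c := by rw [hκ]; field_simp
    calc |A| * r * |lapl σ x₀| ≤ Ci * r * C := by
          gcongr
          exact H.lapl_le x₀ hx₀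
      _ = Ci * κ * r * c := by rw [h1]; ring
      _ ≤ Ci * κ * r * (2 * s0) := by gcongr; linarith
  have hee : ⟪e, e⟫ = 1 := by rw [real_inner_self_eq_norm_sq, hen]; norm_num
  have hτ1 : |τ| ≤ Ci * κ := hτb.trans (by
    calc Ci * κ * r ≤ Ci * κ * 1 := by gcongr
      _ = _ := mul_one _)
  refine ⟨a + M * (r * R) / s0 * A, b + (M * R / s0) • (Bv + τ • e), ?_, ?_, ?_, ?_⟩
  · have h1 : ⟪b + (M * R / s0) • (Bv + τ • e), g⟫ = ⟪b, g⟫ + M * R * τ := by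
      rw [inner_add_left, inner_smul_left, hge, inner_smul_right (Bv + τ • e), inner_add_left, hBe,
        inner_smul_left, hee]
      simp only [conj_trivial]
      field_simp
      ring
    rw [h1, ← hab, hτ]
    field_simp
    ring
  · rw [add_sub_cancel_left, abs_mul, abs_of_pos (by positivity)]
    calc M * (r * R) / s0 * |A| ≤ M * (r * R) / c * (Ci + Ci * κ) := by
          gcongr
          have : 0 ≤ Ci * κ := by positivity
          linarith
      _ = _ := by ring
  · rw [add_sub_cancel_left, norm_smul, Real.norm_eq_abs, abs_of_pos (by positivity)]
    calc M * R / s0 * ‖Bv + τ • e‖ ≤ M * R / c * (Ci + Ci * κ) := by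
          gcongr
          refine (norm_add_le _ _).trans (add_le_add hBv ?_)
          rw [norm_smul, hen, mul_one]; exact hτ1
      _ = _ := by ring
  · intro x hx hx0
    have hs2 : s ^ 2 ≤ 1 / 64 := (pow_le_pow_left₀ hs0.le hs8 2).trans_eq (by norm_num)
    rcases hx0.eq_or_lt with hx0 | hx0
    · have hx1 : x ∈ closedBall x₀ r₁ :=
        closedBall_subset_closedBall (by
          exact (mul_le_of_le_one_left hr0.le (by linarith)).trans hrr₁) hx
      rw [bdryModel, ← hx0, H.eq_zero x hx1 hx0.symm]
      simp only [zero_mul, sub_self, abs_zero]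
      positivity
    obtain ⟨y, rfl⟩ : ∃ y, x = x₀ + r • y :=
      ⟨r⁻¹ • (x - x₀), by rw [smul_smul, mul_inv_cancel₀ hr0.ne', one_smul, add_sub_cancel]⟩
    have hy : ‖y‖ ≤ s ^ 2 := by
      rw [mem_closedBall_iff_norm, add_sub_cancel_left, norm_smul, Real.norm_eq_abs,
        abs_of_pos hr0, mul_comm] at hx
      exact le_of_mul_le_mul_right hx hr0
    have hy1 : ‖y‖ ≤ 1 := by linarith
    have h1 := hexp y hx0 (by linarith)
    obtain ⟨S, hS⟩ : ∃ S, S = σ (x₀ + r • y) / (s0 * r) := ⟨_, rfl⟩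
    have hSb : |S - ⟪y, e⟫| ≤ κ * r := by
      have : S - ⟪y, e⟫ = (σ (x₀ + r • y) - s0 * r * ⟪y, e⟫) / (s0 * r) := by
        rw [hS]; field_simp
      rw [this, abs_div, abs_of_pos (by positivity : 0 < s0 * r), div_le_iff₀ (by positivity)]
      refine (hty y hy1).trans ?_
      have h1 : C = κ * c := by rw [hκ]; field_simp
      calc C * r ^ 2 = κ * r * (c * r) := by rw [h1]; ring
        _ ≤ _ := by gcongr
    have hte : |⟪y, e⟫| ≤ 1 := (abs_real_inner_le_norm _ _).trans (by rw [hen, mul_one]; exact hy1)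
    have key : v (x₀ + r • y) - bdryModel σ x₀ (a + M * (r * R) / s0 * A)
        (b + (M * R / s0) • (Bv + τ • e)) (x₀ + r • y)
        = m * ((h y - A * ⟪y, e⟫ - ⟪Bv, y⟫ * ⟪y, e⟫)
          - ((S - ⟪y, e⟫) * (A + ⟪Bv, y⟫ + τ * ⟪y, e⟫) + τ * ⟪y, e⟫ * ⟪y, e⟫)) := by
      have e1 : σ (x₀ + r • y) = s0 * r * S := by rw [hS]; field_simp
      have e2 : m * h y = q (x₀ + r • y) := by rw [hh]; field_simp
      rw [mul_sub, mul_sub, mul_sub, e2, hqd]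
      simp only [bdryModel, add_sub_cancel_left, inner_add_left, inner_smul_left, inner_smul_right,
        conj_trivial]
      rw [e1, hm, real_inner_comm y e]
      field_simp
      ring
    rw [key, abs_mul, abs_of_pos hm0]
    have hBy : |⟪Bv, y⟫| ≤ Ci := (abs_real_inner_le_norm _ _).trans (by
      simpa using mul_le_mul hBv hy1 (norm_nonneg y) (by positivity))
    have hτt : |τ * ⟪y, e⟫| ≤ Ci * κ * r := by
      rw [abs_mul]
      calc |τ| * |⟪y, e⟫| ≤ Ci * κ * r * 1 := mul_le_mul hτb hte (abs_nonneg _) (by positivity)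
        _ = _ := mul_one _
    have hτt1 : |τ * ⟪y, e⟫| ≤ Ci * κ := hτt.trans (by
      calc Ci * κ * r ≤ Ci * κ * 1 := by gcongr
        _ = _ := mul_one _)
    have g1 : |(S - ⟪y, e⟫) * (A + ⟪Bv, y⟫ + τ * ⟪y, e⟫)| ≤ κ * r * (2 * Ci + Ci * κ) := by
      rw [abs_mul]
      refine mul_le_mul hSb ?_ (abs_nonneg _) (by positivity)
      refine (abs_add_three _ _ _).trans ?_
      linarith
    have g2 : |τ * ⟪y, e⟫ * ⟪y, e⟫| ≤ Ci * κ * r := by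
      rw [abs_mul]
      calc |τ * ⟪y, e⟫| * |⟪y, e⟫| ≤ Ci * κ * r * 1 :=
            mul_le_mul hτt hte (abs_nonneg _) (by positivity)
        _ = _ := mul_one _
    have g3 : Ci * ‖y‖ ^ 3 ≤ s ^ 5 / 8 := by
      calc Ci * ‖y‖ ^ 3 ≤ Ci * (s ^ 2) ^ 3 := by gcongr
        _ = Ci * s * s ^ 5 := by ring
        _ ≤ 1 / 8 * s ^ 5 := by gcongr
        _ = _ := by ring
    have g4 : |(h y - A * ⟪y, e⟫ - ⟪Bv, y⟫ * ⟪y, e⟫)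
          - ((S - ⟪y, e⟫) * (A + ⟪Bv, y⟫ + τ * ⟪y, e⟫) + τ * ⟪y, e⟫ * ⟪y, e⟫)| ≤ s ^ 5 := by
      refine (abs_sub _ _).trans ?_
      have := abs_add_le ((S - ⟪y, e⟫) * (A + ⟪Bv, y⟫ + τ * ⟪y, e⟫)) (τ * ⟪y, e⟫ * ⟪y, e⟫)
      have hs5 : 0 < s ^ 5 := by positivity
      have hK'r : K' * r = κ * r * (2 * Ci + Ci * κ) + Ci * κ * r := by rw [hK']; ring
      linarith
    calc m * _ ≤ m * s ^ 5 := by gcongr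
      _ = _ := by rw [hm]; ring

end boundary_expansion

section boundary_iteration

theorem exists_seq_of_step {α : Type*} {P : ℕ → α → Prop} {R : ℕ → α → α → Prop} {a : α}
    (h0 : P 0 a) (hs : ∀ k a, P k a → ∃ a', P (k + 1) a' ∧ R k a a') :
    ∃ s : ℕ → α, (∀ k, P k (s k)) ∧ ∀ k, R k (s k) (s (k + 1)) := by
  choose! next h1 h2 using hs
  set s : ℕ → α := fun n => Nat.rec a (fun k x => next k x) n with hsd
  have hP : ∀ k, P k (s k) := fun k => by
    induction k with
    | zero => exact h0
    | succ k ih => exact h1 k _ ih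
  exact ⟨s, hP, fun k => h2 k _ (hP k)⟩

set_option maxHeartbeats 1000000 in
theorem exists_boundary_expansion (ι : Type*) [Fintype ι] {c C r₁ : ℝ} (hc : 0 < c) (hC : 1 ≤ C)
    (hr₁ : 0 < r₁) (hr₁' : r₁ ≤ 1) :
    ∃ r₀ > 0, r₀ ≤ r₁ ∧ ∃ C' : ℝ, 0 ≤ C' ∧
    ∀ (σ v : EuclideanSpace ℝ ι → ℝ) (γ : ℝ) (x₀ g : EuclideanSpace ℝ ι),
    BdryData c C r₁ σ v γ x₀ g → ∃ (a : ℝ) (b : EuclideanSpace ℝ ι), |a| ≤ C' ∧ ‖b‖ ≤ C' ∧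
      a * lapl σ x₀ + 2 * ⟪b, g⟫ = γ ∧
      ∀ x ∈ closedBall x₀ r₀, 0 ≤ σ x →
        |v x - bdryModel σ x₀ a b x| ≤ C' * (‖x - x₀‖ ^ 2 * √‖x - x₀‖) := by
  obtain ⟨s, ri, B, hs0, hs1, hri, hri1, hB, HI⟩ := exists_improvement ι hc hC hr₁ hr₁'
  have hC0 : 0 < C := by linarith
  have h1s : 0 < 1 - s := by linarith
  obtain ⟨r₀, hr₀, hr₀i, hQ⟩ : ∃ r₀ > 0, r₀ ≤ ri ∧ 4 * B * √r₀ ≤ 1 - s := by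
    have h : Tendsto (fun r : ℝ => 4 * B * √r) (𝓝[>] 0) (𝓝 0) := by
      have : Continuous fun r : ℝ => 4 * B * √r := by fun_prop
      simpa using (this.tendsto 0).mono_left nhdsWithin_le_nhds
    obtain ⟨r, h1, h2⟩ := ((h.eventually_lt_const h1s).and (Ioc_mem_nhdsGT hri)).exists
    exact ⟨r, h2.1, h2.2, h1.le⟩
  obtain ⟨Q, hQd⟩ : ∃ Q, Q = √r₀ := ⟨_, rfl⟩
  have hQ0 : 0 < Q := by rw [hQd]; positivity
  rw [← hQd] at hQ
  have hr₀₁ : r₀ ≤ r₁ := hr₀i.trans hri1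
  have hr₀' : r₀ ≤ 1 := hr₀₁.trans hr₁'
  have hs3 : s ^ 3 < 1 := pow_lt_one₀ hs0.le hs1 (by norm_num)
  have h1s3 : 0 < 1 - s ^ 3 := by linarith
  obtain ⟨M, hM⟩ : ∃ M, M = 2 * (1 + C / c) + (C + 2 * C * (C / c)) / (r₀ ^ 2 * Q) := ⟨_, rfl⟩
  have hM0 : 0 < M := by rw [hM]; positivity
  obtain ⟨Ea, hEa⟩ : ∃ Ea, Ea = B * M * (r₀ * Q) / (1 - s ^ 3) := ⟨_, rfl⟩
  obtain ⟨Eb, hEb⟩ : ∃ Eb, Eb = B * M * Q / (1 - s) := ⟨_, rfl⟩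
  have hEa0 : 0 ≤ Ea := by rw [hEa]; positivity
  have hEb0 : 0 ≤ Eb := by rw [hEb]; positivity
  obtain ⟨W, hW⟩ : ∃ W, W = (M * (r₀ ^ 2 * Q) + 2 * C * r₀ * (Ea + Eb * r₀)) / (s ^ 5 * (r₀ ^ 2 * Q)) :=
    ⟨_, rfl⟩
  have hW0 : 0 ≤ W := by rw [hW]; positivity
  refine ⟨r₀, hr₀, hr₀₁, M + W, by positivity, ?_⟩
  intro σ v γ x₀ g H
  have hg0 : 0 < ‖g‖ := hc.trans_le H.le_norm
  have hrk : ∀ k : ℕ, 0 < (s ^ 2) ^ k * r₀ ∧ (s ^ 2) ^ k * r₀ ≤ r₀ := fun k => by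
    have : (s ^ 2) ^ k ≤ 1 := pow_le_one₀ (by positivity) (pow_le_one₀ hs0.le hs1.le)
    exact ⟨by positivity, by nlinarith⟩
  have hsq : ∀ k : ℕ, √((s ^ 2) ^ k * r₀) = s ^ k * Q := fun k => by
    rw [Real.sqrt_mul (by positivity), hQd, ← pow_mul, mul_comm 2 k, pow_mul,
      Real.sqrt_sq (by positivity)]
  let P : ℕ → ℝ × EuclideanSpace ℝ ι → Prop := fun k p =>
    p.1 * lapl σ x₀ + 2 * ⟪p.2, g⟫ = γ ∧ 1 + |p.1| + ‖p.2‖ ≤ M * (1 - s ^ k / 2) ∧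
    ∀ x ∈ closedBall x₀ ((s ^ 2) ^ k * r₀), 0 ≤ σ x →
      |v x - bdryModel σ x₀ p.1 p.2 x| ≤ M * (((s ^ 2) ^ k * r₀) ^ 2 * √((s ^ 2) ^ k * r₀))
  let R : ℕ → ℝ × EuclideanSpace ℝ ι → ℝ × EuclideanSpace ℝ ι → Prop := fun k p p' =>
    dist p.1 p'.1 ≤ B * M * (r₀ * Q) * (s ^ 3) ^ k ∧ dist p.2 p'.2 ≤ B * M * Q * s ^ k
  have h0 : P 0 (0, (γ / (2 * ‖g‖ ^ 2)) • g) := by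
    have hb : ‖(γ / (2 * ‖g‖ ^ 2)) • g‖ ≤ C / c := by
      rw [norm_smul, Real.norm_eq_abs, abs_div, abs_of_pos (by positivity : 0 < 2 * ‖g‖ ^ 2)]
      calc |γ| / (2 * ‖g‖ ^ 2) * ‖g‖ = |γ| / (2 * ‖g‖) := by field_simp
        _ ≤ C / c := by
          gcongr
          · exact H.abs_le
          · linarith [H.le_norm]
    refine ⟨?_, ?_, ?_⟩
    · simp only [zero_mul, zero_add]
      rw [inner_smul_left, real_inner_self_eq_norm_sq]
      simp only [conj_trivial]
      field_simp
    · simp only [abs_zero, pow_zero]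
      have : 0 ≤ (C + 2 * C * (C / c)) / (r₀ ^ 2 * Q) := by positivity
      linarith
    · intro x hx hx0
      rw [pow_zero, one_mul] at hx
      rw [pow_zero, one_mul, ← hQd]
      have hx1 : x ∈ closedBall x₀ r₁ := closedBall_subset_closedBall hr₀₁ hx
      have h1 := H.abs_v_le x hx1 hx0
      have h2 := H.abs_le_of_mem hC0.le hr₁' hx1
      rw [mem_closedBall_iff_norm] at hx
      have hd : ‖x - x₀‖ ≤ 1 := by linarith
      have h3 : |bdryModel σ x₀ 0 ((γ / (2 * ‖g‖ ^ 2)) • g) x| ≤ 2 * C * (C / c) := by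
        rw [bdryModel, zero_add, abs_mul]
        refine mul_le_mul (h2.trans (by nlinarith [norm_nonneg (x - x₀)])) ?_ (abs_nonneg _) (by positivity)
        refine (abs_real_inner_le_norm _ _).trans ?_
        calc _ ≤ C / c * 1 := mul_le_mul hb hd (norm_nonneg _) (by positivity)
          _ = _ := mul_one _
      refine (abs_sub _ _).trans ((add_le_add h1 h3).trans ?_)
      rw [← div_le_iff₀ (by positivity), hM]
      have : 0 ≤ 2 * (1 + C / c) := by positivity
      linarith
  have hstep : ∀ k p, P k p → ∃ p', P (k + 1) p' ∧ R k p p' := by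
    rintro k ⟨a, b⟩ ⟨h1, h2, h3⟩
    have hsk : 0 < s ^ k := by positivity
    obtain ⟨a', b', e1, e2, e3, e4⟩ := HI σ v γ x₀ g H _ a b M (hrk k).1 ((hrk k).2.trans hr₀i)
      (h2.trans (by nlinarith)) h1 h3
    rw [hsq] at e2 e3 e4
    refine ⟨(a', b'), ⟨e1, ?_, ?_⟩, ?_, ?_⟩
    · have f1 : |a'| ≤ |a| + B * M * (s ^ k * Q) := by
        have := abs_add_le a (a' - a)
        rw [add_sub_cancel] at this
        have h4 : (s ^ 2) ^ k * r₀ * (s ^ k * Q) ≤ 1 * (s ^ k * Q) := by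
          gcongr; linarith [(hrk k).2]
        have h5 : B * M * ((s ^ 2) ^ k * r₀ * (s ^ k * Q)) ≤ B * M * (1 * (s ^ k * Q)) := by gcongr
        linarith
      have f2 : ‖b'‖ ≤ ‖b‖ + B * M * (s ^ k * Q) := by
        have := norm_add_le b (b' - b)
        rw [add_sub_cancel] at this
        linarith
      have f3 : 2 * (B * M * (s ^ k * Q)) ≤ M * s ^ k * (1 - s) / 2 := by
        have : M * s ^ k * (4 * B * Q) ≤ M * s ^ k * (1 - s) := by gcongr
        linarith
      simp only at h2 ⊢
      have f4 : M * (1 - s ^ (k + 1) / 2) = M * (1 - s ^ k / 2) + M * s ^ k * (1 - s) / 2 := by ring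
      linarith
    · intro x hx hx0
      have := e4 x (by convert hx using 2; ring) hx0
      refine this.trans (le_of_eq ?_)
      rw [hsq]; ring
    · simp only
      rw [dist_comm, Real.dist_eq]
      refine e2.trans (le_of_eq ?_)
      ring
    · simp only
      rw [dist_comm, dist_eq_norm]
      refine e3.trans (le_of_eq ?_)
      ring
  obtain ⟨S, hS, hSR⟩ := exists_seq_of_step h0 hstep
  have ca := cauchySeq_of_le_geometric (f := fun k => (S k).1) _ _ hs3 fun k => (hSR k).1
  have cb := cauchySeq_of_le_geometric (f := fun k => (S k).2) _ _ hs1 fun k => (hSR k).2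
  obtain ⟨a, ha⟩ := cauchySeq_tendsto_of_complete ca
  obtain ⟨b, hb⟩ := cauchySeq_tendsto_of_complete cb
  have da := dist_le_of_le_geometric_of_tendsto (f := fun k => (S k).1) _ _ hs3
    (fun k => (hSR k).1) ha
  have db := dist_le_of_le_geometric_of_tendsto (f := fun k => (S k).2) _ _ hs1
    (fun k => (hSR k).2) hb
  have hMk : ∀ k, |(S k).1| ≤ M ∧ ‖(S k).2‖ ≤ M := fun k => by
    have h1 := (hS k).2.1
    have h2 : 0 < s ^ k := by positivity
    constructor <;> nlinarith [abs_nonneg (S k).1, norm_nonneg (S k).2]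
  refine ⟨a, b, ?_, ?_, ?_, ?_⟩
  · have := le_of_tendsto' ha.abs fun k => (hMk k).1
    linarith
  · have := le_of_tendsto' hb.norm fun k => (hMk k).2
    linarith
  · refine tendsto_nhds_unique ?_ (tendsto_const_nhds (x := γ) (f := atTop (α := ℕ)))
    refine Tendsto.congr (fun k => (hS k).1) ?_
    exact (ha.mul_const _).add ((hb.inner tendsto_const_nhds).const_mul 2)
  · intro x hx hx0
    rcases eq_or_ne x x₀ with rfl | hne
    · rw [bdryModel, H.zero, H.eq_zero x (mem_closedBall_self hr₁.le) H.zero]; simp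
    have hx1 : x ∈ closedBall x₀ r₁ := closedBall_subset_closedBall hr₀₁ hx
    have hσ := H.abs_le_of_mem hC0.le hr₁' hx1
    rw [mem_closedBall_iff_norm] at hx
    set d := ‖x - x₀‖ with hd
    have hd0 : 0 < d := by rw [hd, norm_pos_iff, sub_ne_zero]; exact hne
    obtain ⟨k, hk1, hk2⟩ := exists_nat_pow_near_of_lt_one (x := d / r₀) (y := s ^ 2) (by positivity)
      (by rw [div_le_one hr₀]; exact hx) (by positivity) (pow_lt_one₀ hs0.le hs1 (by norm_num))
    rw [lt_div_iff₀ hr₀] at hk1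
    rw [div_le_iff₀ hr₀] at hk2
    have h1 := (hS k).2.2 x (by rw [mem_closedBall_iff_norm]; exact hk2) hx0
    rw [hsq] at h1
    have h2 : |bdryModel σ x₀ (S k).1 (S k).2 x - bdryModel σ x₀ a b x|
        ≤ 2 * C * ((s ^ 2) ^ k * r₀) * (Ea * (s ^ 3) ^ k + Eb * s ^ k * ((s ^ 2) ^ k * r₀)) := by
      have e1 : bdryModel σ x₀ (S k).1 (S k).2 x - bdryModel σ x₀ a b x
          = σ x * (((S k).1 - a) + ⟪(S k).2 - b, x - x₀⟫) := by
        simp only [bdryModel, inner_sub_left]; ring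
      rw [e1, abs_mul]
      have f1 : |(S k).1 - a| ≤ Ea * (s ^ 3) ^ k := by
        have := da k
        rw [Real.dist_eq] at this
        refine this.trans (le_of_eq ?_)
        rw [hEa]; ring
      have f2 : ‖(S k).2 - b‖ ≤ Eb * s ^ k := by
        have := db k
        rw [dist_eq_norm] at this
        refine this.trans (le_of_eq ?_)
        rw [hEb]; ring
      refine mul_le_mul (hσ.trans (by gcongr)) ?_ (abs_nonneg _) (by positivity)
      refine (abs_add_le _ _).trans (add_le_add f1 ?_)
      exact (abs_real_inner_le_norm _ _).trans (mul_le_mul f2 hk2 (norm_nonneg _) (by positivity))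
    have h3 : |v x - bdryModel σ x₀ a b x| ≤ W * (s ^ 5 * s ^ (5 * k) * (r₀ ^ 2 * Q)) := by
      have e1 : v x - bdryModel σ x₀ a b x = (v x - bdryModel σ x₀ (S k).1 (S k).2 x)
          + (bdryModel σ x₀ (S k).1 (S k).2 x - bdryModel σ x₀ a b x) := by ring
      rw [e1]
      refine (abs_add_le _ _).trans ((add_le_add h1 h2).trans (le_of_eq ?_))
      rw [hW]
      field_simp
      ring
    have h4 : s ^ 5 * s ^ (5 * k) * (r₀ ^ 2 * Q) ≤ d ^ 2 * √d := by
      have h5 := hsq (k + 1)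
      have h6 : √((s ^ 2) ^ (k + 1) * r₀) ≤ √d := Real.sqrt_le_sqrt hk1.le
      rw [h5] at h6
      calc s ^ 5 * s ^ (5 * k) * (r₀ ^ 2 * Q)
          = ((s ^ 2) ^ (k + 1) * r₀) ^ 2 * (s ^ (k + 1) * Q) := by ring
        _ ≤ d ^ 2 * √d := by gcongr
    refine h3.trans ?_
    have h5 : 0 ≤ d ^ 2 * √d := by positivity
    calc _ ≤ W * (d ^ 2 * √d) := by gcongr
      _ ≤ _ := by nlinarith

end boundary_iteration

section boundary_regularity

variable {ι : Type*} [Fintype ι]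

/-- Uniform boundary hypotheses for the domain `{0 < σ}` and a function `v` on it. -/
structure BdryReg (c C r : ℝ) (σ v : EuclideanSpace ℝ ι → ℝ) (γ : ℝ) : Prop where
  data : ∀ z, σ z = 0 → ∃ g, BdryData c C r σ v γ z g
  fderiv_le : ∀ z, σ z = 0 → ∀ y ∈ closedBall z r, ‖fderiv ℝ σ y‖ ≤ C
  hess_le : ∀ z, σ z = 0 → ∀ y ∈ closedBall z r, ‖hess σ y‖ ≤ C
  fderiv_lip : ∀ z, σ z = 0 → ∀ y ∈ closedBall z r, ∀ y' ∈ closedBall z r,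
    ‖fderiv ℝ σ y - fderiv ℝ σ y'‖ ≤ C * ‖y - y'‖
  lapl_lip : ∀ z, σ z = 0 → ∀ y ∈ closedBall z r, ∀ y' ∈ closedBall z r,
    |lapl σ y - lapl σ y'| ≤ C * ‖y - y'‖
  lapl_v : ∀ z, σ z = 0 → ∀ y ∈ closedBall z r, ∀ w ∈ closedBall z r, 0 < σ y → 0 < σ w →
    |lapl v y - lapl v w| ≤ C * |v y - v w|

/-- `v` has the second order expansion `bdryModel σ z a b` at the boundary point `z`. -/
structure BdryExpansion (K r : ℝ) (σ v : EuclideanSpace ℝ ι → ℝ) (γ : ℝ)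
    (z : EuclideanSpace ℝ ι) (a : ℝ) (b : EuclideanSpace ℝ ι) : Prop where
  abs_le : |a| ≤ K
  norm_le : ‖b‖ ≤ K
  lapl_le : ∀ y ∈ closedBall z r, |lapl (bdryModel σ z a b) y - γ| ≤ K * ‖y - z‖
  approx : ∀ x ∈ closedBall z r, 0 ≤ σ x →
    |v x - bdryModel σ z a b x| ≤ K * (‖x - z‖ ^ 2 * √‖x - z‖)

theorem hasFDerivAt_bdryModel {σ : EuclideanSpace ℝ ι → ℝ} (hσ : ContDiff ℝ 2 σ)
    (z : EuclideanSpace ℝ ι) (a : ℝ) (b x : EuclideanSpace ℝ ι) :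
    HasFDerivAt (bdryModel σ z a b)
      (σ x • innerSL ℝ b + (a + ⟪b, x - z⟫) • fderiv ℝ σ x) x :=
  (hσ.differentiable (by norm_num) x).hasFDerivAt.mul (hasFDerivAt_affine z a b x)

theorem norm_fderiv_bdryModel_le {σ : EuclideanSpace ℝ ι → ℝ} (hσ : ContDiff ℝ 2 σ)
    (z : EuclideanSpace ℝ ι) (a : ℝ) (b x : EuclideanSpace ℝ ι) :
    ‖fderiv ℝ (bdryModel σ z a b) x‖
      ≤ |σ x| * ‖b‖ + (|a| + ‖b‖ * ‖x - z‖) * ‖fderiv ℝ σ x‖ := by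
  rw [(hasFDerivAt_bdryModel hσ z a b x).fderiv]
  refine (norm_add_le _ _).trans ?_
  rw [norm_smul, norm_smul, innerSL_apply_norm, Real.norm_eq_abs, Real.norm_eq_abs]
  gcongr
  exact (abs_add_le _ _).trans (by gcongr; exact abs_real_inner_le_norm _ _)

theorem norm_hess_bdryModel_le {σ : EuclideanSpace ℝ ι → ℝ} (hσ : ContDiff ℝ 2 σ)
    (z : EuclideanSpace ℝ ι) (a : ℝ) (b x : EuclideanSpace ℝ ι) :
    ‖hess (bdryModel σ z a b) x‖
      ≤ (|a| + ‖b‖ * ‖x - z‖) * ‖hess σ x‖ + 2 * (‖b‖ * ‖fderiv ℝ σ x‖) := by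
  refine ContinuousLinearMap.opNorm_le_bound₂ _ (by positivity) fun u w => ?_
  have h0 : hess (fun y => a + ⟪b, y - z⟫) x = 0 :=
    hess_eq_of_hasFDerivAt (w' := fun _ => innerSL ℝ b)
      (Eventually.of_forall fun y => hasFDerivAt_affine z a b y) (hasFDerivAt_const _ _)
  have h1 : |a + ⟪b, x - z⟫| ≤ |a| + ‖b‖ * ‖x - z‖ :=
    (abs_add_le _ _).trans (by gcongr; exact abs_real_inner_le_norm _ _)
  have e := hess_mul_apply (x := x) hσ.contDiffAt
    (contDiff_affine z a b (n := 2)).contDiffAt u w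
  rw [h0, (hasFDerivAt_affine z a b x).fderiv] at e
  have e' : hess (bdryModel σ z a b) x u w = (a + ⟪b, x - z⟫) * hess σ x u w
      + fderiv ℝ σ x u * ⟪b, w⟫ + ⟪b, u⟫ * fderiv ℝ σ x w := by
    unfold bdryModel
    rw [e]; simp
  rw [e', Real.norm_eq_abs]
  refine (abs_add_three _ _ _).trans ?_
  rw [abs_mul, abs_mul, abs_mul]
  have t1 : |hess σ x u w| ≤ ‖hess σ x‖ * ‖u‖ * ‖w‖ := (hess σ x).le_opNorm₂ u w
  have t2 : |fderiv ℝ σ x u| ≤ ‖fderiv ℝ σ x‖ * ‖u‖ := (fderiv ℝ σ x).le_opNorm u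
  have t3 : |fderiv ℝ σ x w| ≤ ‖fderiv ℝ σ x‖ * ‖w‖ := (fderiv ℝ σ x).le_opNorm w
  calc _ ≤ (|a| + ‖b‖ * ‖x - z‖) * (‖hess σ x‖ * ‖u‖ * ‖w‖)
        + ‖fderiv ℝ σ x‖ * ‖u‖ * (‖b‖ * ‖w‖) + ‖b‖ * ‖u‖ * (‖fderiv ℝ σ x‖ * ‖w‖) := by
          gcongr
          · exact abs_real_inner_le_norm _ _
          · exact abs_real_inner_le_norm _ _
    _ = _ := by ring

theorem pos_of_forall_zero_le {σ : EuclideanSpace ℝ ι → ℝ} (hσ : Continuous σ)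
    {x : EuclideanSpace ℝ ι} {d : ℝ} (hx : 0 < σ x) (hd : ∀ z, σ z = 0 → d ≤ ‖z - x‖)
    {y : EuclideanSpace ℝ ι} (hy : ‖y - x‖ < d) : 0 < σ y := by
  by_contra! h
  have hd0 : 0 < d := (norm_nonneg _).trans_lt hy
  obtain ⟨z, hz, hz0⟩ := (convex_ball x d).isPreconnected.intermediate_value
    (mem_ball_iff_norm.2 hy) (mem_ball_self hd0) hσ.continuousOn ⟨h, hx.le⟩
  have := hd z hz0
  rw [mem_ball_iff_norm] at hz
  linarith

theorem sqrt_two_mul_le {t : ℝ} : √(2 * t) ≤ 2 * √t := by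
  rw [Real.sqrt_mul (by norm_num)]
  have : √(2 : ℝ) ≤ 2 := by rw [Real.sqrt_le_left] <;> norm_num
  gcongr

set_option maxHeartbeats 1000000 in
/-- Derivative bounds for `v` minus its expansion at a nearest boundary point. -/
theorem BdryReg.exists_nearest_bound {c C r : ℝ} {σ v : EuclideanSpace ℝ ι → ℝ} {γ : ℝ}
    (H : BdryReg c C r σ v γ) (hC : 0 ≤ C) (hr1 : r ≤ 1) {K r₀ : ℝ}
    (hK : 0 ≤ K) (hr₀ : r₀ ≤ r) :
    ∃ C₂ : ℝ, 0 ≤ C₂ ∧ ∀ x z a b, 0 < σ x → σ z = 0 → BdryExpansion K r₀ σ v γ z a b →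
    2 * ‖x - z‖ ≤ r₀ → (∀ y, σ y = 0 → ‖x - z‖ ≤ ‖y - x‖) →
    ‖fderiv ℝ v x - fderiv ℝ (bdryModel σ z a b) x‖ ≤ C₂ * (‖x - z‖ * √‖x - z‖) ∧
    ‖hess v x - hess (bdryModel σ z a b) x‖ ≤ C₂ * √‖x - z‖ := by
  obtain ⟨Cg, hCg1, hCg⟩ := exists_gradient_bound ι
  obtain ⟨Ch, hCh1, hCh⟩ := exists_hessian_bound ι
  obtain ⟨G, hG⟩ : ∃ G, G = 2 * (C + K) := ⟨_, rfl⟩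
  have hG0 : 0 ≤ G := by rw [hG]; positivity
  obtain ⟨A, hA⟩ : ∃ A, A = Cg * (64 * K + G) := ⟨_, rfl⟩
  have hA0 : 0 ≤ A := by rw [hA]; positivity
  obtain ⟨L, hL⟩ : ∃ L, L = C * (A + 4 * C * K) + 5 * C * K := ⟨_, rfl⟩
  have hL0 : 0 ≤ L := by rw [hL]; positivity
  refine ⟨A + Ch * (512 * K + G + L), by positivity, ?_⟩
  intro x z a b hx hz hE hd hn
  obtain ⟨g, hD⟩ := H.data z hz
  obtain ⟨d, hdd⟩ : ∃ d, d = ‖x - z‖ := ⟨_, rfl⟩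
  rw [← hdd] at hd hn ⊢
  have hxz : x ≠ z := by rintro rfl; linarith
  have hd0 : 0 < d := by rw [hdd, norm_pos_iff, sub_ne_zero]; exact hxz
  have hd1 : d ≤ 1 := by linarith
  have hdz : d ≤ √d := by
    have h1 := Real.mul_self_sqrt hd0.le
    have h2 := Real.sqrt_le_one.2 hd1
    nlinarith [Real.sqrt_nonneg d]
  have hs0 : 0 < √d := Real.sqrt_pos.2 hd0
  have hb : ∀ y ∈ closedBall x (d / 2), ‖y - z‖ ≤ 2 * d ∧ y ∈ closedBall z r₀ ∧ y ∈ closedBall z r ∧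
      0 < σ y := by
    intro y hy
    rw [mem_closedBall_iff_norm] at hy
    have h1 : ‖y - z‖ ≤ 2 * d := by
      have := norm_add_le (y - x) (x - z)
      rw [sub_add_sub_cancel] at this
      linarith
    refine ⟨h1, ?_, ?_, pos_of_forall_zero_le hD.contDiff.continuous hx hn (by linarith)⟩ <;>
    · rw [mem_closedBall_iff_norm]; linarith
  have hmc := contDiff_bdryModel hD.contDiff z a b
  set p := bdryModel σ z a b with hp
  set w : EuclideanSpace ℝ ι → ℝ := fun y => v y - p y with hw
  have hvC : ∀ y ∈ closedBall x (d / 2), ContDiffAt ℝ 2 v y := fun y hy =>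
    (hD.interior y (hb y hy).2.2.1 (hb y hy).2.2.2).1
  have hwC : ∀ y ∈ closedBall x (d / 2), ContDiffAt ℝ 2 w y := fun y hy =>
    (hvC y hy).sub hmc.contDiffAt
  have hwb : ∀ y ∈ closedBall x (d / 2), |w y| ≤ 8 * K * (d ^ 2 * √d) := by
    intro y hy
    obtain ⟨h1, h2, h3, h4⟩ := hb y hy
    refine (hE.approx y h2 h4.le).trans ?_
    have h5 : √‖y - z‖ ≤ 2 * √d := (Real.sqrt_le_sqrt h1).trans sqrt_two_mul_le
    calc K * (‖y - z‖ ^ 2 * √‖y - z‖) ≤ K * ((2 * d) ^ 2 * (2 * √d)) := by gcongr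
      _ = _ := by ring
  have hwl : ∀ y ∈ closedBall x (d / 2), |lapl w y| ≤ G * d := by
    intro y hy
    obtain ⟨h1, h2, h3, h4⟩ := hb y hy
    rw [hw, lapl_sub (hvC y hy) hmc.contDiffAt]
    have e : lapl v y - lapl p y = (lapl v y - γ) - (lapl p y - γ) := by ring
    rw [e]
    refine (abs_sub _ _).trans ((add_le_add (hD.interior y h3 h4).2 (hE.lapl_le y h2)).trans ?_)
    rw [hG, ← add_mul]
    calc (C + K) * ‖y - z‖ ≤ (C + K) * (2 * d) := by gcongr
      _ = _ := by ring
  have hgr : ∀ y ∈ closedBall x (d / 4), ‖fderiv ℝ w y‖ ≤ A * (d * √d) := by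
    intro y hy
    have hs : closedBall y (2 * (d / 8)) ⊆ closedBall x (d / 2) :=
      closedBall_subset_closedBall' (by rw [mem_closedBall] at hy; linarith)
    refine (hCg w y (d / 8) _ _ (by positivity) (fun q hq => hwC q (hs hq))
      (fun q hq => hwb q (hs hq)) (fun q hq => hwl q (hs hq))).trans ?_
    have h1 : 8 * K * (d ^ 2 * √d) / (d / 8) = 64 * K * (d * √d) := by field_simp; ring
    have h2 : G * d * (d / 8) ≤ G * (d * √d) := by
      calc G * d * (d / 8) ≤ G * d * √d := by gcongr; linarith
        _ = _ := by ring
    rw [h1, hA, mul_assoc Cg]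
    gcongr
    linarith
  have hwfd : ∀ y ∈ closedBall x (d / 2), fderiv ℝ w y = fderiv ℝ v y - fderiv ℝ p y :=
    fun y hy => fderiv_sub ((hvC y hy).differentiableAt (by norm_num))
      (hmc.differentiable (by norm_num) y)
  have h42 : closedBall x (d / 4) ⊆ closedBall x (d / 2) :=
    closedBall_subset_closedBall (by linarith)
  have hxm : x ∈ closedBall x (d / 2) := mem_closedBall_self (by positivity)
  have hxm4 : x ∈ closedBall x (d / 4) := mem_closedBall_self (by positivity)
  have hpf : ∀ y ∈ closedBall x (d / 2), ‖fderiv ℝ p y‖ ≤ 4 * C * K := by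
    intro y hy
    obtain ⟨h1, h2, h3, h4⟩ := hb y hy
    have h5 : ‖y - z‖ ≤ 1 := h1.trans (by linarith)
    have h6 : |σ y| ≤ 2 * C := (hD.abs_le_of_mem hC hr1 h3).trans (by nlinarith [norm_nonneg (y - z)])
    refine (norm_fderiv_bdryModel_le hD.contDiff z a b y).trans ?_
    calc |σ y| * ‖b‖ + (|a| + ‖b‖ * ‖y - z‖) * ‖fderiv ℝ σ y‖
        ≤ 2 * C * K + (K + K * 1) * C := by
          gcongr
          · exact hE.norm_le
          · exact hE.abs_le
          · exact hE.norm_le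
          · exact H.fderiv_le z hz y h3
      _ = _ := by ring
  have hvf : ∀ y ∈ closedBall x (d / 4), ‖fderiv ℝ v y‖ ≤ A + 4 * C * K := by
    intro y hy
    have h1 : fderiv ℝ v y = fderiv ℝ w y + fderiv ℝ p y := by rw [hwfd y (h42 hy)]; abel
    rw [h1]
    refine (norm_add_le _ _).trans (add_le_add ((hgr y hy).trans ?_) (hpf y (h42 hy)))
    have : d * √d ≤ 1 * 1 := by gcongr; exact Real.sqrt_le_one.2 hd1
    nlinarith
  have hvlip : ∀ y ∈ closedBall x (d / 4), ∀ y' ∈ closedBall x (d / 4),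
      |v y - v y'| ≤ (A + 4 * C * K) * ‖y - y'‖ := by
    intro y hy y' hy'
    exact (convex_closedBall x (d / 4)).norm_image_sub_le_of_norm_fderiv_le
      (fun q hq => (hvC q (h42 hq)).differentiableAt (by norm_num)) hvf hy' hy
  have hlip : ∀ y ∈ closedBall x (2 * (d / 8)), ∀ y' ∈ closedBall x (2 * (d / 8)),
      |lapl w y - lapl w y'| ≤ L * ‖y - y'‖ := by
    intro y hy y' hy'
    have e : 2 * (d / 8) = d / 4 := by ring
    rw [e] at hy hy'
    obtain ⟨h1, h2, h3, h4⟩ := hb y (h42 hy)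
    obtain ⟨h1', h2', h3', h4'⟩ := hb y' (h42 hy')
    rw [hw, lapl_sub (hvC y (h42 hy)) hmc.contDiffAt, lapl_sub (hvC y' (h42 hy')) hmc.contDiffAt]
    have t1 : |lapl v y - lapl v y'| ≤ C * ((A + 4 * C * K) * ‖y - y'‖) :=
      (H.lapl_v z hz y h3 y' h3' h4 h4').trans (by gcongr; exact hvlip y hy y' hy')
    have t2 : |lapl p y - lapl p y'| ≤ 5 * C * K * ‖y - y'‖ := by
      rw [hp, lapl_bdryModel hD.contDiff, lapl_bdryModel hD.contDiff]
      have e1 : (a + ⟪b, y - z⟫) * lapl σ y + 2 * fderiv ℝ σ y b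
          - ((a + ⟪b, y' - z⟫) * lapl σ y' + 2 * fderiv ℝ σ y' b)
          = (a + ⟪b, y - z⟫) * (lapl σ y - lapl σ y') + ⟪b, y - y'⟫ * lapl σ y'
            + 2 * (fderiv ℝ σ y - fderiv ℝ σ y') b := by
        rw [sub_apply, ← sub_sub_sub_cancel_right y y' z, inner_sub_right b (y - z)]
        ring
      rw [e1]
      have s1 : |a + ⟪b, y - z⟫| ≤ 2 * K := by
        refine (abs_add_le _ _).trans ?_
        have h5 : ‖y - z‖ ≤ 1 := h1.trans (by linarith)
        have : |⟪b, y - z⟫| ≤ K * 1 := (abs_real_inner_le_norm _ _).trans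
          (mul_le_mul hE.norm_le h5 (norm_nonneg _) hK)
        linarith [hE.abs_le]
      have s2 : |⟪b, y - y'⟫| ≤ K * ‖y - y'‖ := (abs_real_inner_le_norm _ _).trans
        (mul_le_mul_of_nonneg_right hE.norm_le (norm_nonneg _))
      have s3 : |(fderiv ℝ σ y - fderiv ℝ σ y') b| ≤ C * ‖y - y'‖ * K :=
        ((fderiv ℝ σ y - fderiv ℝ σ y').le_opNorm b).trans
          (mul_le_mul (H.fderiv_lip z hz y h3 y' h3') hE.norm_le (norm_nonneg _) (by positivity))
      refine (abs_add_three _ _ _).trans ?_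
      rw [abs_mul, abs_mul, abs_mul 2, abs_of_pos (by norm_num : (0:ℝ) < 2)]
      calc _ ≤ 2 * K * (C * ‖y - y'‖) + K * ‖y - y'‖ * C + 2 * (C * ‖y - y'‖ * K) := by
            gcongr
            · exact H.lapl_lip z hz y h3 y' h3'
            · exact hD.lapl_le y' h3'
        _ = _ := by ring
    have e2 : lapl v y - lapl p y - (lapl v y' - lapl p y')
        = (lapl v y - lapl v y') - (lapl p y - lapl p y') := by ring
    rw [e2, hL]
    refine (abs_sub _ _).trans ((add_le_add t1 t2).trans (le_of_eq ?_))
    ring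
  have hs : closedBall x (2 * (d / 8)) ⊆ closedBall x (d / 2) :=
    closedBall_subset_closedBall (by linarith)
  have hh := hCh w x (d / 8) _ _ L (by positivity) (fun q hq => hwC q (hs hq))
      (fun q hq => hwb q (hs hq)) (fun q hq => hwl q (hs hq)) hL0 hlip
  constructor
  · rw [← hwfd x hxm]
    refine (hgr x hxm4).trans ?_
    gcongr
    have : 0 ≤ Ch * (512 * K + G + L) := by positivity
    linarith
  · rw [← hess_sub (hvC x hxm) hmc.contDiffAt]
    refine hh.trans ?_
    have h1 : 8 * K * (d ^ 2 * √d) / (d / 8) ^ 2 = 512 * K * √d := by field_simp; ring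
    have h2 : G * d ≤ G * √d := by gcongr
    have h3 : L * (d / 8) ≤ L * √d := by gcongr; linarith
    rw [h1]
    calc Ch * (512 * K * √d + G * d + L * (d / 8))
        ≤ Ch * (512 * K * √d + G * √d + L * √d) := by gcongr
      _ ≤ _ := by nlinarith

end boundary_regularity

section boundary_comparison

variable {ι : Type*} [Fintype ι]

theorem bdryModel_sub_bdryModel (σ : EuclideanSpace ℝ ι → ℝ) (x₀ z : EuclideanSpace ℝ ι) (a a' : ℝ)
    (b b' y : EuclideanSpace ℝ ι) :
    bdryModel σ x₀ a' b' y - bdryModel σ z a b y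
      = bdryModel σ z (a' + ⟪b', z - x₀⟫ - a) (b' - b) y := by
  unfold bdryModel
  have e : ⟪b', y - x₀⟫ = ⟪b', y - z⟫ + ⟪b', z - x₀⟫ := by
    rw [← inner_add_right, sub_add_sub_cancel]
  rw [e, inner_sub_left]
  ring

theorem norm_le_of_affine_bound {A M t : ℝ} {b z p : EuclideanSpace ℝ ι} (ht : 0 < t)
    (h : ∀ y ∈ closedBall p (t / 2), |A + ⟪b, y - z⟫| ≤ M) : ‖b‖ * t ≤ 4 * M := by
  rcases eq_or_ne b 0 with rfl | hb
  · have := (abs_nonneg _).trans (h p (mem_closedBall_self (by positivity)))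
    simpa using this
  have hb0 : 0 < ‖b‖ := norm_pos_iff.2 hb
  have h1 := h p (mem_closedBall_self (by positivity))
  have h2 := h (p + (t / 2 / ‖b‖) • b) (by
    rw [mem_closedBall_iff_norm, add_sub_cancel_left, norm_smul, Real.norm_of_nonneg (by positivity)]
    exact le_of_eq (by field_simp))
  have e : p + (t / 2 / ‖b‖) • b - z = (p - z) + (t / 2 / ‖b‖) • b := by abel
  have e2 : t / 2 / ‖b‖ * ‖b‖ ^ 2 = t / 2 * ‖b‖ := by field_simp
  rw [e, inner_add_right, real_inner_smul_right, real_inner_self_eq_norm_sq, e2] at h2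
  rw [abs_le] at h1 h2
  linarith [h1.1, h2.2]

theorem BdryReg.exists_compare {c C r : ℝ} {σ v : EuclideanSpace ℝ ι → ℝ} {γ : ℝ}
    (H : BdryReg c C r σ v γ) (hc : 0 < c) (hC : 1 ≤ C) {K r₀ : ℝ}
    (hK : 0 ≤ K) (h0 : 0 < r₀) (hr₀ : r₀ ≤ r) :
    ∃ r₃ > 0, r₃ ≤ r₀ ∧ ∃ E : ℝ, 0 ≤ E ∧ ∀ x₀ z a b a' b' t, σ z = 0 → σ x₀ = 0 →
      BdryExpansion K r₀ σ v γ z a b → BdryExpansion K r₀ σ v γ x₀ a' b' →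
      0 < t → t ≤ r₃ → ‖x₀ - z‖ ≤ 2 * t →
      ‖b' - b‖ ≤ E * √t ∧ |a' + ⟪b', z - x₀⟫ - a| ≤ E * (t * √t) := by
  refine ⟨min (r₀ / 4) (c / (9 * C)), by positivity, (min_le_left _ _).trans (by linarith),
    5 * (256 * K / c), by positivity, ?_⟩
  intro x₀ z a b a' b' t hz hx₀ hE hE' ht htr hxz
  have ht4 : 4 * t ≤ r₀ := by linarith [htr.trans (min_le_left _ _)]
  have htc : 9 * C * t ≤ c := by
    have := htr.trans (min_le_right _ _)
    rw [le_div_iff₀ (by positivity)] at this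
    linarith
  obtain ⟨g, hD⟩ := H.data z hz
  have hg0 : 0 < ‖g‖ := hc.trans_le hD.le_norm
  set M := 256 * K / c * (t * √t) with hM
  have hb : ∀ y ∈ closedBall (z + (t / ‖g‖) • g) (t / 2),
      |a' + ⟪b', z - x₀⟫ - a + ⟪b' - b, y - z⟫| ≤ M := by
    intro y hy
    obtain ⟨q, hq⟩ : ∃ q, q = y - (z + (t / ‖g‖) • g) := ⟨_, rfl⟩
    rw [mem_closedBall_iff_norm, ← hq] at hy
    have e1 : y - z = (t / ‖g‖) • g + q := by rw [hq]; abel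
    have h1 : ‖y - z‖ ≤ 3 / 2 * t := by
      rw [e1]
      refine (norm_add_le _ _).trans ?_
      rw [norm_smul, Real.norm_of_nonneg (by positivity), div_mul_cancel₀ _ hg0.ne']
      linarith
    have h2 : ‖y - x₀‖ ≤ 4 * t := by
      have := norm_sub_le (y - z) (x₀ - z)
      rw [sub_sub_sub_cancel_right] at this
      linarith
    have hyz : y ∈ closedBall z r₀ := by rw [mem_closedBall_iff_norm]; linarith
    have hyx : y ∈ closedBall x₀ r₀ := by rw [mem_closedBall_iff_norm]; linarith
    have h3 : c * t / 2 ≤ ⟪g, y - z⟫ := by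
      rw [e1, inner_add_right, real_inner_smul_right, real_inner_self_eq_norm_sq]
      have e2 : t / ‖g‖ * ‖g‖ ^ 2 = t * ‖g‖ := by field_simp
      rw [e2]
      have h4 := neg_le_of_abs_le (abs_real_inner_le_norm g q)
      have h5 : ‖g‖ * ‖q‖ ≤ ‖g‖ * (t / 2) := by gcongr
      nlinarith [hD.le_norm]
    have h4 : c * t / 4 ≤ σ y := by
      have := (abs_le.1 (hD.taylor y (closedBall_subset_closedBall hr₀ hyz))).1
      have h5 : C * ‖y - z‖ ^ 2 ≤ C * (3 / 2 * t) ^ 2 := by gcongr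
      nlinarith
    have hσ0 : 0 < σ y := lt_of_lt_of_le (by positivity) h4
    have hs : √(4 * t) = 2 * √t := by
      rw [show (4 : ℝ) * t = 2 ^ 2 * t by ring, Real.sqrt_mul (by positivity),
        Real.sqrt_sq (by norm_num)]
    have k1 : |v y - bdryModel σ z a b y| ≤ 32 * K * (t ^ 2 * √t) := by
      refine (hE.approx y hyz hσ0.le).trans ?_
      have : √‖y - z‖ ≤ 2 * √t := (Real.sqrt_le_sqrt (by linarith)).trans hs.le
      calc K * (‖y - z‖ ^ 2 * √‖y - z‖) ≤ K * ((4 * t) ^ 2 * (2 * √t)) := by gcongr; linarith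
        _ = _ := by ring
    have k2 : |v y - bdryModel σ x₀ a' b' y| ≤ 32 * K * (t ^ 2 * √t) := by
      refine (hE'.approx y hyx hσ0.le).trans ?_
      have : √‖y - x₀‖ ≤ 2 * √t := (Real.sqrt_le_sqrt h2).trans hs.le
      calc K * (‖y - x₀‖ ^ 2 * √‖y - x₀‖) ≤ K * ((4 * t) ^ 2 * (2 * √t)) := by gcongr
        _ = _ := by ring
    have k3 : |bdryModel σ x₀ a' b' y - bdryModel σ z a b y| ≤ 64 * K * (t ^ 2 * √t) := by
      have e3 : bdryModel σ x₀ a' b' y - bdryModel σ z a b y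
        = (v y - bdryModel σ z a b y) - (v y - bdryModel σ x₀ a' b' y) := by ring
      rw [e3]
      refine (abs_sub _ _).trans ?_
      linarith
    rw [bdryModel_sub_bdryModel, bdryModel, abs_mul, abs_of_pos hσ0] at k3
    have k4 : c * t / 4 * |a' + ⟪b', z - x₀⟫ - a + ⟪b' - b, y - z⟫| ≤ c * t / 4 * M := by
      refine (mul_le_mul_of_nonneg_right h4 (abs_nonneg _)).trans (k3.trans (le_of_eq ?_))
      rw [hM]; field_simp; ring
    exact le_of_mul_le_mul_left k4 (by positivity)
  have k1 := norm_le_of_affine_bound ht hb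
  have hM0 : 0 ≤ 256 * K / c := by positivity
  have k2 : ‖b' - b‖ ≤ 4 * (256 * K / c) * √t := by
    refine le_of_mul_le_mul_right (k1.trans (le_of_eq ?_)) ht
    rw [hM]; ring
  constructor
  · refine k2.trans ?_
    gcongr
    norm_num
  · have k3 := hb _ (mem_closedBall_self (by positivity))
    rw [add_sub_cancel_left] at k3
    have k4 : |⟪b' - b, (t / ‖g‖) • g⟫| ≤ 4 * M := by
      refine ((abs_real_inner_le_norm _ _).trans (le_of_eq ?_)).trans k1
      rw [norm_smul, Real.norm_of_nonneg (by positivity), div_mul_cancel₀ _ hg0.ne']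
    have := abs_sub (a' + ⟪b', z - x₀⟫ - a + ⟪b' - b, (t / ‖g‖) • g⟫) ⟪b' - b, (t / ‖g‖) • g⟫
    rw [add_sub_cancel_right] at this
    calc _ ≤ M + 4 * M := by linarith
      _ = _ := by rw [hM]; ring

/-- First derivative of `v` up to the boundary. -/
noncomputable def bdryFDeriv (σ v : EuclideanSpace ℝ ι → ℝ) (a : EuclideanSpace ℝ ι → ℝ)
    (b : EuclideanSpace ℝ ι → EuclideanSpace ℝ ι) (x : EuclideanSpace ℝ ι) :
    EuclideanSpace ℝ ι →L[ℝ] ℝ :=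
  open Classical in
  if σ x = 0 then fderiv ℝ (bdryModel σ x (a x) (b x)) x else fderiv ℝ v x

/-- Second derivative of `v` up to the boundary. -/
noncomputable def bdryHess (σ v : EuclideanSpace ℝ ι → ℝ) (a : EuclideanSpace ℝ ι → ℝ)
    (b : EuclideanSpace ℝ ι → EuclideanSpace ℝ ι) (x : EuclideanSpace ℝ ι) :
    EuclideanSpace ℝ ι →L[ℝ] EuclideanSpace ℝ ι →L[ℝ] ℝ :=
  open Classical in
  if σ x = 0 then hess (bdryModel σ x (a x) (b x)) x else hess v x

theorem norm_sub_self_le {F : Type*} [NormedAddCommGroup F] (x : F) {K : ℝ} (hK : 0 ≤ K) :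
    ‖x - x‖ ≤ K := by simpa

theorem norm_sub_le_of_norm_sub_le {F : Type*} [NormedAddCommGroup F] {x y z w : F} {K K' : ℝ}
    (h : ‖x - y‖ ≤ K) (e : y - z = w) (h' : ‖w‖ ≤ K') : ‖x - z‖ ≤ K + K' := by
  rw [← sub_add_sub_cancel x y z, e]
  exact (norm_add_le _ _).trans (add_le_add h h')

theorem continuousWithinAt_of_norm_sub_le {E F : Type*} [NormedAddCommGroup E]
    [NormedAddCommGroup F] {G P : E → F} {s : Set E} {z : E} {K r : ℝ} (hr : 0 < r)
    (hP : ContinuousAt P z) (h : ∀ x ∈ s, ‖x - z‖ ≤ r → ‖G x - P x‖ ≤ K * √‖x - z‖)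
    (hz : G z = P z) : ContinuousWithinAt G s z := by
  have hdif : Tendsto (fun y => G y - P y) (𝓝[s] z) (𝓝 0) := by
    refine squeeze_zero_norm' (a := fun y => K * √‖y - z‖) ?_ ?_
    · filter_upwards [self_mem_nhdsWithin, nhdsWithin_le_nhds (closedBall_mem_nhds z hr)]
        with y hy hy'
      rw [mem_closedBall_iff_norm] at hy'
      exact h y hy hy'
    · have hcont : Continuous fun y : E => K * √‖y - z‖ := by fun_prop
      have := (hcont.tendsto z).mono_left (nhdsWithin_le_nhds (s := s))
      simpa using this
  have := hdif.add (hP.mono_left nhdsWithin_le_nhds)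
  simpa [ContinuousWithinAt, hz] using this

theorem BdryReg.exists_derivative_compare {c C r : ℝ} {σ v : EuclideanSpace ℝ ι → ℝ} {γ : ℝ}
    (H : BdryReg c C r σ v γ) (hc : 0 < c) (hC : 1 ≤ C) (hr1 : r ≤ 1) {K r₀ : ℝ}
    (hK : 0 ≤ K) (h0 : 0 < r₀) (hr₀ : r₀ ≤ r) {a : EuclideanSpace ℝ ι → ℝ}
    {b : EuclideanSpace ℝ ι → EuclideanSpace ℝ ι}
    (hE : ∀ z, σ z = 0 → BdryExpansion K r₀ σ v γ z (a z) (b z)) :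
    ∃ r₄ > 0, r₄ ≤ r₀ ∧ ∃ C₃ : ℝ, 0 ≤ C₃ ∧ ∀ x z, σ z = 0 → 0 ≤ σ x → ‖x - z‖ ≤ r₄ →
      ‖bdryFDeriv σ v a b x - fderiv ℝ (bdryModel σ z (a z) (b z)) x‖
        ≤ C₃ * (‖x - z‖ * √‖x - z‖) ∧
      ‖bdryHess σ v a b x - hess (bdryModel σ z (a z) (b z)) x‖ ≤ C₃ * √‖x - z‖ := by
  obtain ⟨C₂, hC₂, h2⟩ := H.exists_nearest_bound (by linarith) hr1 hK hr₀
  obtain ⟨r₃, hr₃, hr₃', E, hE0, h3⟩ := H.exists_compare hc hC hK h0 hr₀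
  refine ⟨min r₃ (r₀ / 2), by positivity, (min_le_left _ _).trans hr₃', C₂ + 4 * C * E,
    by positivity, ?_⟩
  intro x z hz hx hxz
  obtain ⟨g, hD⟩ := H.data z hz
  have hσ := hD.contDiff
  rcases eq_or_ne x z with rfl | hne
  · rw [bdryFDeriv, bdryHess, if_pos hz, if_pos hz]
    exact ⟨norm_sub_self_le _ (by positivity), norm_sub_self_le
      (F := EuclideanSpace ℝ ι →L[ℝ] EuclideanSpace ℝ ι →L[ℝ] ℝ) _ (by positivity)⟩
  have ht0 : 0 < ‖x - z‖ := by rwa [norm_pos_iff, sub_ne_zero]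
  have ht1 : ‖x - z‖ ≤ 1 := by linarith [hxz.trans (min_le_left _ _)]
  obtain ⟨x₀, hx₀, hd, k1, k2⟩ : ∃ x₀, σ x₀ = 0 ∧ ‖x - x₀‖ ≤ ‖x - z‖ ∧
      ‖bdryFDeriv σ v a b x - fderiv ℝ (bdryModel σ x₀ (a x₀) (b x₀)) x‖
        ≤ C₂ * (‖x - x₀‖ * √‖x - x₀‖) ∧
      ‖bdryHess σ v a b x - hess (bdryModel σ x₀ (a x₀) (b x₀)) x‖ ≤ C₂ * √‖x - x₀‖ := by
    rcases hx.eq_or_lt with hx0 | hx0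
    · rw [bdryFDeriv, bdryHess, if_pos hx0.symm, if_pos hx0.symm]
      exact ⟨x, hx0.symm, by simp, norm_sub_self_le _ (by positivity),
        norm_sub_self_le (F := EuclideanSpace ℝ ι →L[ℝ] EuclideanSpace ℝ ι →L[ℝ] ℝ) _ (by positivity)⟩
    · obtain ⟨x₀, hx₀, hmin⟩ := (isClosed_singleton.preimage hσ.continuous :
        IsClosed (σ ⁻¹' {0})).exists_infDist_eq_dist ⟨z, hz⟩ x
      have hm : ∀ y, σ y = 0 → ‖x - x₀‖ ≤ ‖y - x‖ := by
        intro y hy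
        rw [← dist_eq_norm, ← hmin, ← dist_eq_norm, dist_comm]
        exact infDist_le_dist_of_mem hy
      have hd : ‖x - x₀‖ ≤ ‖x - z‖ := by rw [norm_sub_rev x z]; exact hm z hz
      refine ⟨x₀, hx₀, hd, ?_⟩
      rw [bdryFDeriv, bdryHess, if_neg hx0.ne', if_neg hx0.ne']
      exact h2 x x₀ _ _ hx0 hx₀ (hE x₀ hx₀)
        (by linarith [hxz.trans (min_le_right _ _)]) hm
  obtain ⟨kb, ka⟩ := h3 x₀ z (a z) (b z) (a x₀) (b x₀) ‖x - z‖ hz hx₀ (hE z hz) (hE x₀ hx₀) ht0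
    (hxz.trans (min_le_left _ _)) (by
      have := norm_sub_le (x - z) (x - x₀)
      rw [sub_sub_sub_cancel_left] at this
      linarith)
  have hfun : (fun y => bdryModel σ x₀ (a x₀) (b x₀) y - bdryModel σ z (a z) (b z) y)
      = bdryModel σ z (a x₀ + ⟪b x₀, z - x₀⟫ - a z) (b x₀ - b z) :=
    funext fun y => bdryModel_sub_bdryModel σ x₀ z _ _ _ _ y
  have m1 := contDiff_bdryModel hσ x₀ (a x₀) (b x₀)
  have m2 := contDiff_bdryModel hσ z (a z) (b z)
  have ef : fderiv ℝ (bdryModel σ x₀ (a x₀) (b x₀)) x - fderiv ℝ (bdryModel σ z (a z) (b z)) x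
      = fderiv ℝ (bdryModel σ z (a x₀ + ⟪b x₀, z - x₀⟫ - a z) (b x₀ - b z)) x := by
    rw [← hfun]
    exact (fderiv_sub (m1.differentiable (by norm_num) x) (m2.differentiable (by norm_num) x)).symm
  have eh : hess (bdryModel σ x₀ (a x₀) (b x₀)) x - hess (bdryModel σ z (a z) (b z)) x
      = hess (bdryModel σ z (a x₀ + ⟪b x₀, z - x₀⟫ - a z) (b x₀ - b z)) x := by
    rw [← hfun]
    exact (hess_sub m1.contDiffAt m2.contDiffAt).symm
  have hxm : x ∈ closedBall z r := by
    rw [mem_closedBall_iff_norm]; linarith [hxz.trans (min_le_left _ _)]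
  have q1 : |σ x| ≤ 2 * C * ‖x - z‖ := hD.abs_le_of_mem (by linarith) hr1 hxm
  have q2 := H.fderiv_le z hz x hxm
  have q3 := H.hess_le z hz x hxm
  have ds : √‖x - x₀‖ ≤ √‖x - z‖ := Real.sqrt_le_sqrt hd
  constructor
  · rw [add_mul]
    refine norm_sub_le_of_norm_sub_le (k1.trans (by gcongr)) ef ?_
    refine (norm_fderiv_bdryModel_le hσ _ _ _ _).trans ?_
    calc _ ≤ 2 * C * ‖x - z‖ * (E * √‖x - z‖)
          + (E * (‖x - z‖ * √‖x - z‖) + E * √‖x - z‖ * ‖x - z‖) * C := by gcongr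
      _ = _ := by ring
  · rw [add_mul]
    refine norm_sub_le_of_norm_sub_le (F := EuclideanSpace ℝ ι →L[ℝ] EuclideanSpace ℝ ι →L[ℝ] ℝ)
      (k2.trans (by gcongr)) eh ?_
    refine (norm_hess_bdryModel_le hσ _ _ _ _).trans ?_
    calc _ ≤ (E * (1 * √‖x - z‖) + E * √‖x - z‖ * 1) * C + 2 * (E * √‖x - z‖ * C) := by
          gcongr
          exact ka.trans (by gcongr)
      _ = _ := by ring

theorem hasFDerivWithinAt_of_norm_sub_le {E F : Type*} [NormedAddCommGroup E] [NormedSpace ℝ E]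
    [NormedAddCommGroup F] [NormedSpace ℝ F] {G P : E → F} {P' : E →L[ℝ] F} {s : Set E} {z : E}
    {K r : ℝ} (hr : 0 < r) (hP : HasFDerivAt P P' z)
    (h : ∀ x ∈ s, ‖x - z‖ ≤ r → ‖G x - P x‖ ≤ K * (‖x - z‖ * √‖x - z‖)) (hz : z ∈ s) :
    HasFDerivWithinAt G P' s z := by
  have hz0 : G z = P z := by
    have := h z hz (by simpa using hr.le)
    simpa [sub_eq_zero] using this
  have h1 : HasFDerivWithinAt (fun x => G x - P x) (0 : E →L[ℝ] F) s z := by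
    rw [hasFDerivWithinAt_iff_isLittleO]
    have hO : (fun x => G x - P x) =O[𝓝[s] z] fun x => ‖x - z‖ * √‖x - z‖ := by
      refine Asymptotics.IsBigO.of_bound K ?_
      filter_upwards [self_mem_nhdsWithin, nhdsWithin_le_nhds (closedBall_mem_nhds z hr)] with x hx hx'
      rw [mem_closedBall_iff_norm] at hx'
      refine (h x hx hx').trans (le_of_eq ?_)
      rw [Real.norm_of_nonneg (by positivity)]
    have ho : (fun x => ‖x - z‖ * √‖x - z‖) =o[𝓝[s] z] fun x => x - z := by
      have : (fun x => √‖x - z‖) =o[𝓝[s] z] fun _ => (1 : ℝ) := by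
        rw [Asymptotics.isLittleO_one_iff]
        have hcont : Continuous fun x : E => √‖x - z‖ := by fun_prop
        have := (hcont.tendsto z).mono_left (nhdsWithin_le_nhds (s := s))
        simpa using this
      have h2 := (Asymptotics.isBigO_refl (fun x : E => ‖x - z‖) (𝓝[s] z)).mul_isLittleO this
      simp only [mul_one] at h2
      exact h2.of_norm_right
    have := hO.trans_isLittleO ho
    simpa [hz0] using this
  have := h1.add hP.hasFDerivWithinAt
  rw [zero_add] at this
  exact this.congr_of_eventuallyEq (Eventually.of_forall fun x => by simp) (by simp)

/-- Second order regularity up to the boundary. -/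
theorem BdryReg.contDiffOn {c C r : ℝ} {σ v : EuclideanSpace ℝ ι → ℝ} {γ : ℝ}
    (H : BdryReg c C r σ v γ) (hc : 0 < c) (hC : 1 ≤ C) (hr : 0 < r) (hr1 : r ≤ 1)
    (hσ : ContDiff ℝ 2 σ) (hv : ∀ x, 0 < σ x → ContDiffAt ℝ 2 v x) :
    ContDiffOn ℝ 2 v {x | 0 ≤ σ x} := by
  obtain ⟨r₀, hr₀, hr₀r, C', hC', hexp⟩ := exists_boundary_expansion ι hc hC hr hr1
  have hex : ∀ z, ∃ a b, σ z = 0 → BdryExpansion (C' + 6 * C * C') r₀ σ v γ z a b := by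
    intro z
    by_cases hz : σ z = 0
    swap
    · exact ⟨0, 0, fun h => absurd h hz⟩
    obtain ⟨g, hD⟩ := H.data z hz
    obtain ⟨a, b, ha, hb, hab, happ⟩ := hexp σ v γ z g hD
    have hle : C' ≤ C' + 6 * C * C' := by
      have : 0 ≤ 6 * C * C' := by positivity
      linarith
    refine ⟨a, b, fun _ => ⟨ha.trans hle, hb.trans hle, ?_, ?_⟩⟩
    · intro y hy
      refine (hD.abs_lapl_model_sub_le (by linarith) hab
        (closedBall_subset_closedBall hr₀r hy)).trans ?_
      gcongr
      calc 3 * C * (|a| + ‖b‖) ≤ 3 * C * (C' + C') := by gcongr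
        _ ≤ _ := by linarith
    · intro x hx hx0
      exact (happ x hx hx0).trans (by gcongr)
  choose a b hE using hex
  obtain ⟨r₄, hr₄, hr₄', C₃, hC₃, hcmp⟩ := H.exists_derivative_compare hc hC hr1
    (by positivity) hr₀ hr₀r hE
  have hO : IsOpen {x | 0 < σ x} := isOpen_lt continuous_const hσ.continuous
  have hin1 : ∀ x, 0 < σ x → bdryFDeriv σ v a b =ᶠ[𝓝 x] fderiv ℝ v := fun x hx => by
    filter_upwards [hO.mem_nhds hx] with y (hy : 0 < σ y)
    rw [bdryFDeriv, if_neg hy.ne']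
  have hin2 : ∀ x, 0 < σ x → bdryHess σ v a b =ᶠ[𝓝 x] hess v := fun x hx => by
    filter_upwards [hO.mem_nhds hx] with y (hy : 0 < σ y)
    rw [bdryHess, if_neg hy.ne']
  refine contDiffOn_two_of_hasFDerivWithinAt (g₁ := bdryFDeriv σ v a b) (g₂ := bdryHess σ v a b)
    ?_ ?_ ?_
  · intro x hx
    rcases (show 0 ≤ σ x from hx).eq_or_lt with h | h
    · rw [bdryFDeriv, if_pos h.symm]
      refine hasFDerivWithinAt_of_norm_sub_le hr₄ (K := C' + 6 * C * C')
        ((contDiff_bdryModel hσ x (a x) (b x)).differentiable (by norm_num) x).hasFDerivAt ?_ hx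
      intro y hy hyx
      have hyr : y ∈ closedBall x r₀ := by rw [mem_closedBall_iff_norm]; linarith
      rw [Real.norm_eq_abs]
      refine ((hE x h.symm).approx y hyr hy).trans ?_
      have h1 : ‖y - x‖ ^ 2 ≤ ‖y - x‖ := by nlinarith [norm_nonneg (y - x)]
      gcongr
    · rw [(hin1 x h).eq_of_nhds]
      exact ((hv x h).differentiableAt (by norm_num)).hasFDerivAt.hasFDerivWithinAt
  · intro x hx
    rcases (show 0 ≤ σ x from hx).eq_or_lt with h | h
    · rw [bdryHess, if_pos h.symm]
      exact hasFDerivWithinAt_of_norm_sub_le hr₄ (K := C₃)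
        (contDiff_bdryModel hσ x (a x) (b x)).contDiffAt.hasFDerivAt_fderiv
        (fun y hy hyx => (hcmp y x h.symm hy hyx).1) hx
    · rw [(hin2 x h).eq_of_nhds]
      exact ((hv x h).hasFDerivAt_fderiv.congr_of_eventuallyEq (hin1 x h)).hasFDerivWithinAt
  · intro x hx
    rcases (show 0 ≤ σ x from hx).eq_or_lt with h | h
    · refine continuousWithinAt_of_norm_sub_le hr₄ (P := hess (bdryModel σ x (a x) (b x))) ?_
        (fun y hy hyx => (hcmp y x h.symm hy hyx).2) (by rw [bdryHess, if_pos h.symm])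
      exact (((contDiff_bdryModel hσ x (a x) (b x)).fderiv_right (m := 1)
        (by norm_num)).continuous_fderiv (by norm_num)).continuousAt
    · refine ContinuousAt.continuousWithinAt (ContinuousAt.congr ?_ (hin2 x h).symm)
      exact (((hv x h).fderiv_right (m := 1) (by norm_num)).fderiv_right (m := 0)
        (by norm_num)).continuousAt

end boundary_comparison

section uniform_constants

variable {ι : Type*} [Fintype ι]

theorem exists_lipschitz_bound {E F : Type*} [NormedAddCommGroup E] [NormedSpace ℝ E]
    [NormedAddCommGroup F] [NormedSpace ℝ F] {w : E → F} (hw : ContDiff ℝ 1 w) {s : Set E}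
    (hs : IsCompact s) (hc : Convex ℝ s) :
    ∃ K : ℝ, ∀ x ∈ s, ∀ y ∈ s, ‖w x - w y‖ ≤ K * ‖x - y‖ := by
  obtain ⟨K, hK⟩ := hs.exists_bound_of_continuousOn (hw.continuous_fderiv (by norm_num)).continuousOn
  exact ⟨K, fun x hx y hy => hc.norm_image_sub_le_of_norm_fderiv_le
    (fun z _ => hw.differentiable (by norm_num) z) hK hy hx⟩

theorem contDiff_lapl {σ : EuclideanSpace ℝ ι → ℝ} (hσ : ContDiff ℝ 3 σ) :
    ContDiff ℝ 1 (lapl σ) := by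
  have h1 : ContDiff ℝ 2 (fderiv ℝ σ) := hσ.fderiv_right (by norm_num)
  have h2 : ContDiff ℝ 1 (fderiv ℝ (fderiv ℝ σ)) := h1.fderiv_right (by norm_num)
  unfold lapl hess
  fun_prop

/-- Uniform bounds for a defining function near its zero set. -/
structure DefiningBounds (c C r : ℝ) (σ : EuclideanSpace ℝ ι → ℝ) : Prop where
  contDiff : ContDiff ℝ 2 σ
  le_norm_fderiv : ∀ z, σ z = 0 → ∀ y ∈ closedBall z r, c ≤ ‖fderiv ℝ σ y‖
  fderiv_le : ∀ z, σ z = 0 → ∀ y ∈ closedBall z r, ‖fderiv ℝ σ y‖ ≤ C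
  hess_le : ∀ z, σ z = 0 → ∀ y ∈ closedBall z r, ‖hess σ y‖ ≤ C
  lapl_le : ∀ z, σ z = 0 → ∀ y ∈ closedBall z r, |lapl σ y| ≤ C
  fderiv_lip : ∀ z, σ z = 0 → ∀ y ∈ closedBall z r, ∀ y' ∈ closedBall z r,
    ‖fderiv ℝ σ y - fderiv ℝ σ y'‖ ≤ C * ‖y - y'‖
  lapl_lip : ∀ z, σ z = 0 → ∀ y ∈ closedBall z r, ∀ y' ∈ closedBall z r,
    |lapl σ y - lapl σ y'| ≤ C * ‖y - y'‖

theorem exists_definingBounds {σ : EuclideanSpace ℝ ι → ℝ} (hσ : ContDiff ℝ 3 σ)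
    (hb : Bornology.IsBounded {x | 0 ≤ σ x}) (hd : ∀ x, σ x = 0 → fderiv ℝ σ x ≠ 0) :
    ∃ c > 0, ∃ C ≥ 1, ∃ r > 0, r ≤ 1 ∧ DefiningBounds c C r σ := by
  obtain ⟨R, hR⟩ := hb.subset_closedBall 0
  have hσ2 : ContDiff ℝ 2 σ := hσ.of_le (by norm_num)
  have hf2 : ContDiff ℝ 2 (fderiv ℝ σ) := hσ.fderiv_right (by norm_num)
  have hf1 : ContDiff ℝ 1 (fderiv ℝ σ) := hf2.of_le (by norm_num)
  have hh : Continuous (hess σ) := hf1.continuous_fderiv (by norm_num)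
  have hZ : IsCompact {x | σ x = 0} :=
    Metric.isCompact_of_isClosed_isBounded (isClosed_eq hσ.continuous continuous_const)
      (hb.subset fun x (hx : σ x = 0) => hx.ge)
  obtain ⟨c, hc, hcl⟩ := hZ.exists_forall_le' (f := fun x => ‖fderiv ℝ σ x‖) (a := 0)
    hf1.continuous.norm.continuousOn fun x hx => norm_pos_iff.2 (hd x hx)
  have hB : IsCompact (closedBall (0 : EuclideanSpace ℝ ι) (R + 1)) := isCompact_closedBall _ _
  have hcv := convex_closedBall (0 : EuclideanSpace ℝ ι) (R + 1)
  obtain ⟨C₁, h1⟩ := hB.exists_bound_of_continuousOn hf1.continuous.continuousOn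
  obtain ⟨C₂, h2⟩ := hB.exists_bound_of_continuousOn
    (E := EuclideanSpace ℝ ι →L[ℝ] EuclideanSpace ℝ ι →L[ℝ] ℝ) hh.continuousOn
  obtain ⟨C₃, h3⟩ := hB.exists_bound_of_continuousOn (continuous_lapl hσ2).continuousOn
  obtain ⟨C₄, h4⟩ := exists_lipschitz_bound hf1 hB hcv
  obtain ⟨C₅, h5⟩ := exists_lipschitz_bound (contDiff_lapl hσ) hB hcv
  obtain ⟨C, hC⟩ : ∃ C, C = 1 + |C₁| + |C₂| + |C₃| + |C₄| + |C₅| := ⟨_, rfl⟩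
  have hC1 : 1 ≤ C := by
    rw [hC]
    linarith [abs_nonneg C₁, abs_nonneg C₂, abs_nonneg C₃, abs_nonneg C₄, abs_nonneg C₅]
  have hCi : C₁ ≤ C ∧ C₂ ≤ C ∧ C₃ ≤ C ∧ C₄ ≤ C ∧ C₅ ≤ C := by
    rw [hC]
    refine ⟨?_, ?_, ?_, ?_, ?_⟩ <;> linarith [abs_nonneg C₁, abs_nonneg C₂, abs_nonneg C₃,
      abs_nonneg C₄, abs_nonneg C₅, le_abs_self C₁, le_abs_self C₂, le_abs_self C₃,
      le_abs_self C₄, le_abs_self C₅]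
  have hsub : ∀ z, σ z = 0 → ∀ s ≤ 1, closedBall z s ⊆ closedBall 0 (R + 1) := by
    intro z hz s hs
    refine closedBall_subset_closedBall' ?_
    have := mem_closedBall.1 (hR (show 0 ≤ σ z from hz.ge))
    linarith
  refine ⟨c / 2, by positivity, C, hC1, min 1 (c / (2 * C)), by positivity, min_le_left _ _, hσ2,
    ?_, ?_, ?_, ?_, ?_, ?_⟩
  · intro z hz y hy
    have hy' := hsub z hz _ (min_le_left _ _) hy
    have hz' := hsub z hz 1 le_rfl (mem_closedBall_self zero_le_one)
    have k1 : ‖fderiv ℝ σ z - fderiv ℝ σ y‖ ≤ c / 2 := by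
      refine (h4 z hz' y hy').trans ?_
      rw [mem_closedBall_iff_norm'] at hy
      have k2 : C₄ * ‖z - y‖ ≤ C * ‖z - y‖ := by gcongr; exact hCi.2.2.2.1
      have k3 : C * ‖z - y‖ ≤ C * (c / (2 * C)) := by gcongr; exact hy.trans (min_le_right _ _)
      refine k2.trans (k3.trans (le_of_eq ?_))
      field_simp
    have k4 := norm_sub_norm_le (fderiv ℝ σ z) (fderiv ℝ σ y)
    have := hcl z hz
    linarith
  · exact fun z hz y hy => (h1 y (hsub z hz _ (min_le_left _ _) hy)).trans hCi.1
  · exact fun z hz y hy => (h2 y (hsub z hz _ (min_le_left _ _) hy)).trans hCi.2.1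
  · exact fun z hz y hy => (h3 y (hsub z hz _ (min_le_left _ _) hy)).trans hCi.2.2.1
  · intro z hz y hy y' hy'
    refine (h4 y (hsub z hz _ (min_le_left _ _) hy) y' (hsub z hz _ (min_le_left _ _) hy')).trans ?_
    gcongr
    exact hCi.2.2.2.1
  · intro z hz y hy y' hy'
    refine (h5 y (hsub z hz _ (min_le_left _ _) hy) y' (hsub z hz _ (min_le_left _ _) hy')).trans ?_
    gcongr
    exact hCi.2.2.2.2

theorem DefiningBounds.taylor {c C r : ℝ} {σ : EuclideanSpace ℝ ι → ℝ}
    (H : DefiningBounds c C r σ) (hC : 0 ≤ C) {z y : EuclideanSpace ℝ ι} (hz : σ z = 0)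
    (hy : y ∈ closedBall z r) : |σ y - fderiv ℝ σ z (y - z)| ≤ C * ‖y - z‖ ^ 2 := by
  have hy' := mem_closedBall_iff_norm.1 hy
  have hsub : closedBall z ‖y - z‖ ⊆ closedBall z r := closedBall_subset_closedBall hy'
  have h := (convex_closedBall z ‖y - z‖).norm_image_sub_le_of_norm_fderiv_le'
    (f := σ) (φ := fderiv ℝ σ z) (C := C * ‖y - z‖)
    (fun x _ => H.contDiff.differentiable (by norm_num) x)
    (fun x hx => (H.fderiv_lip z hz x (hsub hx) z
      (mem_closedBall_self ((norm_nonneg _).trans hy'))).trans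
        (mul_le_mul_of_nonneg_left (mem_closedBall_iff_norm.1 hx) hC))
    (mem_closedBall_self (norm_nonneg _)) (mem_closedBall_iff_norm.2 le_rfl)
  rw [hz, sub_zero, Real.norm_eq_abs] at h
  rw [pow_two, ← mul_assoc]
  exact h

theorem DefiningBounds.abs_le {c C r : ℝ} {σ : EuclideanSpace ℝ ι → ℝ}
    (H : DefiningBounds c C r σ) {z y : EuclideanSpace ℝ ι} (hz : σ z = 0)
    (hy : y ∈ closedBall z r) : |σ y| ≤ C * ‖y - z‖ := by
  have h := (convex_closedBall z r).norm_image_sub_le_of_norm_fderiv_le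
    (f := σ) (fun x _ => H.contDiff.differentiable (by norm_num) x) (H.fderiv_le z hz)
    (mem_closedBall_self (dist_nonneg.trans hy)) hy
  rwa [hz, sub_zero, Real.norm_eq_abs] at h

theorem IsBddSol.exists_bdryReg {f : ℝ → ℝ} (hf : ContDiff ℝ 1 f) {M B c C r : ℝ}
    {σ v : EuclideanSpace ℝ ι → ℝ} (H : DefiningBounds c C r σ) (hC : 1 ≤ C) (hr : 0 ≤ r)
    (hv : IsBddSol f M {x | 0 < σ x} v) (hcont : ContinuousOn v {x | 0 ≤ σ x})
    (hv0 : ∀ x, σ x = 0 → v x = 0) (hM : 0 ≤ M) (hB : 0 ≤ B)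
    (hvB : ∀ z, σ z = 0 → ∀ y ∈ closedBall z r, 0 ≤ σ y → |v y| ≤ B * σ y) :
    ∃ C' ≥ 1, BdryReg c C' r σ v (-f 0) := by
  obtain ⟨L, hL, hL1, -, hL3⟩ := exists_bound_lipschitz hf M
  have hM0 : |(0 : ℝ)| ≤ M := by simpa
  obtain ⟨C', hC'⟩ : ∃ C', C' = C + L + M + L * (B * C) := ⟨_, rfl⟩
  have hLBC : 0 ≤ L * (B * C) := by positivity
  have hCC : C ≤ C' := by rw [hC']; linarith
  have hvM : ∀ y, 0 ≤ σ y → |v y| ≤ M := by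
    intro y hy
    rcases hy.eq_or_lt with h | h
    · rw [hv0 y h.symm]; exact hM0
    · exact (hv y h).2.1
  refine ⟨C', hC.trans hCC, ?_, ?_, ?_, ?_, ?_, ?_⟩
  · intro z hz
    refine ⟨(InnerProductSpace.toDual ℝ (EuclideanSpace ℝ ι)).symm (fderiv ℝ σ z), ?_⟩
    have hzm : z ∈ closedBall z r := mem_closedBall_self hr
    refine ⟨H.contDiff, hz, ?_, ?_, ?_, ?_, H.le_norm_fderiv z hz, ?_, ?_, ?_, ?_, ?_, ?_, ?_, ?_⟩
    · intro y
      rw [InnerProductSpace.toDual_symm_apply]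
    · rw [LinearIsometryEquiv.norm_map]
      exact H.le_norm_fderiv z hz z hzm
    · rw [LinearIsometryEquiv.norm_map]
      exact (H.fderiv_le z hz z hzm).trans hCC
    · rw [abs_neg, hC']
      linarith [hL1 0 hM0]
    · intro y hy
      rw [InnerProductSpace.toDual_symm_apply]
      exact (H.taylor (by linarith) hz hy).trans (by gcongr)
    · exact fun y hy => (H.fderiv_lip z hz y hy z hzm).trans (by gcongr)
    · exact fun y hy => (H.lapl_le z hz y hy).trans hCC
    · exact fun y hy => (H.lapl_lip z hz y hy z hzm).trans (by gcongr)
    · exact hcont.mono inter_subset_right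
    · exact fun y _ => hv0 y
    · intro y _ hy
      refine (hvM y hy).trans ?_
      rw [hC']; linarith
    · intro y hy hy0
      obtain ⟨k1, k2, k3⟩ := hv y hy0
      refine ⟨k1, ?_⟩
      have e : lapl v y - -f 0 = -(f (v y) - f 0) := by rw [k3]; ring
      rw [e, abs_neg]
      refine (hL3 _ _ k2 hM0).trans ?_
      rw [sub_zero]
      calc L * |v y| ≤ L * (B * σ y) := by gcongr; exact hvB z hz y hy hy0.le
        _ ≤ L * (B * (C * ‖y - z‖)) := by
            gcongr
            exact (le_abs_self _).trans (H.abs_le hz hy)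
        _ = L * (B * C) * ‖y - z‖ := by ring
        _ ≤ C' * ‖y - z‖ := by
            gcongr
            rw [hC']; linarith
  · exact fun z hz y hy => (H.fderiv_le z hz y hy).trans hCC
  · exact fun z hz y hy => (H.hess_le z hz y hy).trans hCC
  · exact fun z hz y hy y' hy' => (H.fderiv_lip z hz y hy y' hy').trans (by gcongr)
  · exact fun z hz y hy y' hy' => (H.lapl_lip z hz y hy y' hy').trans (by gcongr)
  · intro z hz y hy y' hy' h0 h0'
    rw [(hv y h0).2.2, (hv y' h0').2.2]
    have e : -f (v y) - -f (v y') = -(f (v y) - f (v y')) := by ring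
    rw [e, abs_neg]
    refine (hL3 _ _ (hv y h0).2.1 (hv y' h0').2.1).trans ?_
    gcongr
    rw [hC']; linarith

end uniform_constants

section cylinder

variable {ι : Type*} [Fintype ι]

/-- The projection of the cylinder onto its cross-section. -/
noncomputable def cylFst (ι : Type*) [Fintype ι] :
    EuclideanSpace ℝ (Option ι) →L[ℝ] EuclideanSpace ℝ ι :=
  LinearMap.toContinuousLinearMap
    { toFun := fun y => WithLp.toLp 2 fun i => y (some i)
      map_add' := fun _ _ => rfl
      map_smul' := fun _ _ => rfl }

/-- The inclusion of the cross-section into the cylinder at height zero. -/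
noncomputable def cylInl (ι : Type*) [Fintype ι] :
    EuclideanSpace ℝ ι →L[ℝ] EuclideanSpace ℝ (Option ι) :=
  LinearMap.toContinuousLinearMap
    { toFun := fun x => WithLp.toLp 2 fun o => o.elim 0 x
      map_add' := fun x y => by ext (_ | i) <;> simp
      map_smul' := fun r x => by ext (_ | i) <;> simp }

/-- The vertical unit vector of the cylinder. -/
noncomputable def cylUp (ι : Type*) [Fintype ι] : EuclideanSpace ℝ (Option ι) :=
  EuclideanSpace.basisFun (Option ι) ℝ none

theorem cylFst_apply (y : EuclideanSpace ℝ (Option ι)) (i : ι) : cylFst ι y i = y (some i) := rfl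

theorem cylInl_none (x : EuclideanSpace ℝ ι) : cylInl ι x none = 0 := rfl

theorem cylInl_some (x : EuclideanSpace ℝ ι) (i : ι) : cylInl ι x (some i) = x i := rfl

theorem cylFst_cylInl (x : EuclideanSpace ℝ ι) : cylFst ι (cylInl ι x) = x := rfl

theorem cylFst_basisFun_some (i : ι) :
    cylFst ι (EuclideanSpace.basisFun (Option ι) ℝ (some i)) = EuclideanSpace.basisFun ι ℝ i := by
  classical
  ext j
  simp [cylFst_apply]

theorem cylFst_cylUp : cylFst ι (cylUp ι) = 0 := by
  classical
  ext j
  simp [cylFst_apply, cylUp]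

theorem cylInl_add_smul_cylUp (y : EuclideanSpace ℝ (Option ι)) :
    cylInl ι (cylFst ι y) + y none • cylUp ι = y := by
  classical
  ext (_ | i) <;> simp [cylInl_none, cylInl_some, cylFst_apply, cylUp]

theorem norm_cylFst_le (y : EuclideanSpace ℝ (Option ι)) : ‖cylFst ι y‖ ≤ ‖y‖ := by
  rw [EuclideanSpace.norm_eq, EuclideanSpace.norm_eq, Fintype.sum_option]
  refine Real.sqrt_le_sqrt ?_
  simp only [cylFst_apply]
  linarith [sq_nonneg ‖y none‖]

theorem norm_cylInl (x : EuclideanSpace ℝ ι) : ‖cylInl ι x‖ = ‖x‖ := by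
  rw [EuclideanSpace.norm_eq, EuclideanSpace.norm_eq, Fintype.sum_option]
  simp [cylInl_none, cylInl_some]

theorem lapl_comp_cylFst {w : EuclideanSpace ℝ ι → ℝ} {y : EuclideanSpace ℝ (Option ι)}
    (hw : ContDiffAt ℝ 2 w (cylFst ι y)) :
    lapl (fun y => w (cylFst ι y)) y = lapl w (cylFst ι y) := by
  simp only [lapl, hess_comp_clm (cylFst ι) hw, Fintype.sum_option, cylFst_basisFun_some]
  have : cylFst ι (EuclideanSpace.basisFun (Option ι) ℝ none) = 0 := cylFst_cylUp
  rw [this]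
  simp

theorem norm_fderiv_le_comp_cylFst {w : EuclideanSpace ℝ ι → ℝ} {y : EuclideanSpace ℝ (Option ι)}
    (hw : DifferentiableAt ℝ w (cylFst ι y)) :
    ‖fderiv ℝ w (cylFst ι y)‖ ≤ ‖fderiv ℝ (fun y => w (cylFst ι y)) y‖ := by
  have h : HasFDerivAt (fun y => w (cylFst ι y)) ((fderiv ℝ w (cylFst ι y)).comp (cylFst ι)) y :=
    hw.hasFDerivAt.comp y (cylFst ι).hasFDerivAt
  rw [h.fderiv]
  refine ContinuousLinearMap.opNorm_le_bound _ (norm_nonneg _) fun x => ?_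
  have := ((fderiv ℝ w (cylFst ι y)).comp (cylFst ι)).le_opNorm (cylInl ι x)
  rwa [ContinuousLinearMap.comp_apply, cylFst_cylInl, norm_cylInl] at this

theorem DefiningBounds.mono {c C r s : ℝ} {σ : EuclideanSpace ℝ ι → ℝ}
    (H : DefiningBounds c C r σ) (hs : s ≤ r) : DefiningBounds c C s σ := by
  have h : ∀ z : EuclideanSpace ℝ ι, closedBall z s ⊆ closedBall z r :=
    fun z => closedBall_subset_closedBall hs
  exact ⟨H.contDiff, fun z hz y hy => H.le_norm_fderiv z hz y (h z hy),
    fun z hz y hy => H.fderiv_le z hz y (h z hy), fun z hz y hy => H.hess_le z hz y (h z hy),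
    fun z hz y hy => H.lapl_le z hz y (h z hy),
    fun z hz y hy y' hy' => H.fderiv_lip z hz y (h z hy) y' (h z hy'),
    fun z hz y hy y' hy' => H.lapl_lip z hz y (h z hy) y' (h z hy')⟩

theorem DefiningBounds.exists_cylinder_barrier {c C r : ℝ} {σ : EuclideanSpace ℝ ι → ℝ}
    (H : DefiningBounds c C r σ) (hc : 0 < c) (hC : 1 ≤ C) (hr : 0 < r) (hr1 : r ≤ 1) {M : ℝ}
    (hM : 0 ≤ M) :
    ∃ s > 0, s ≤ r ∧ ∃ B : ℝ, 0 ≤ B ∧ ∀ h : EuclideanSpace ℝ (Option ι) → ℝ,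
    ContinuousOn h {y | 0 ≤ σ (cylFst ι y)} → (∀ y, 0 ≤ σ (cylFst ι y) → |h y| ≤ M) →
    (∀ y, σ (cylFst ι y) = 0 → h y = 0) →
    (∀ y, 0 < σ (cylFst ι y) → ContDiffAt ℝ 2 h y ∧ |lapl h y| ≤ M) →
    ∀ z, σ z = 0 → ∀ y, cylFst ι y ∈ closedBall z s → 0 ≤ σ (cylFst ι y) →
    |h y| ≤ B * σ (cylFst ι y) := by
  obtain ⟨r₀, hr₀, B, hB, hbar⟩ := exists_barrier_bound (Option ι) hc
    (show 0 < 2 * C by linarith)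
  obtain ⟨s, hs⟩ : ∃ s, s = min r₀ (r / 2) := ⟨_, rfl⟩
  have hs0 : 0 < s := by rw [hs]; positivity
  have hsr : 2 * s ≤ r := by
    have : s ≤ r / 2 := by rw [hs]; exact min_le_right _ _
    linarith
  refine ⟨s, hs0, by linarith, B * M / s, by positivity, ?_⟩
  intro h hcont hhM hh0 hhl z hz y hy hy0
  have hq : ∀ q ∈ closedBall y s, cylFst ι q ∈ closedBall z r ∧ ‖cylFst ι q - z‖ ≤ 2 * s := by
    intro q hq
    rw [mem_closedBall_iff_norm] at hq hy
    have h1 : ‖cylFst ι q - cylFst ι y‖ ≤ s := by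
      rw [← map_sub]; exact (norm_cylFst_le _).trans hq
    have h2 := norm_add_le (cylFst ι q - cylFst ι y) (cylFst ι y - z)
    rw [sub_add_sub_cancel] at h2
    exact ⟨by rw [mem_closedBall_iff_norm]; linarith, by linarith⟩
  have key := hbar (fun y => σ (cylFst ι y)) h y s M hs0 (by rw [hs]; exact min_le_left _ _) hM
    (fun q hqs => by
      obtain ⟨k1, k2⟩ := hq q hqs
      refine ⟨H.contDiff.contDiffAt.comp q (cylFst ι).contDiff.contDiffAt, ?_, ?_, ?_⟩
      · calc |σ (cylFst ι q)| ≤ C * ‖cylFst ι q - z‖ := H.abs_le hz k1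
          _ ≤ C * (2 * s) := by gcongr
          _ = _ := by ring
      · rw [lapl_comp_cylFst H.contDiff.contDiffAt]
        linarith [H.lapl_le z hz _ k1]
      · exact (H.le_norm_fderiv z hz _ k1).trans
          (norm_fderiv_le_comp_cylFst (H.contDiff.differentiable (by norm_num) _)))
    hy0 (hcont.mono inter_subset_right) (fun q _ => hhM q) (fun q _ => hh0 q)
    (fun q _ hq0 => by
      obtain ⟨k1, k2⟩ := hhl q hq0
      refine ⟨k1, k2.trans ?_⟩
      rw [le_div_iff₀ (by positivity)]
      have : s ^ 2 ≤ 1 := by nlinarith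
      nlinarith)
  refine key.trans (le_of_eq ?_)
  ring

theorem exists_cylinder_limit {f : ℝ → ℝ} (hf : ContDiff ℝ 1 f) {M : ℝ}
    {σ : EuclideanSpace ℝ ι → ℝ} (hσ : ContDiff ℝ 3 σ)
    (hb : Bornology.IsBounded {x | 0 ≤ σ x}) (hd : ∀ x, σ x = 0 → fderiv ℝ σ x ≠ 0)
    {U : EuclideanSpace ℝ (Option ι) → ℝ} (hM : 0 ≤ M)
    (hU : IsBddSol f M {y | 0 < σ (cylFst ι y)} U)
    (hcont : ContinuousOn U {y | 0 ≤ σ (cylFst ι y)})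
    (h0 : ∀ y, σ (cylFst ι y) = 0 → U y = 0)
    (hmono : ∀ x, 0 ≤ σ x → Monotone fun t : ℝ => U (cylInl ι x + t • cylUp ι)) :
    ∃ W : EuclideanSpace ℝ ι → ℝ,
      (∀ x, 0 ≤ σ x → Tendsto (fun t : ℝ => U (cylInl ι x + t • cylUp ι)) atTop (𝓝 (W x))) ∧
      TendstoUniformlyOn (fun (t : ℝ) x => U (cylInl ι x + t • cylUp ι)) W atTop {x | 0 ≤ σ x} ∧
      ContDiffOn ℝ 2 W {x | 0 ≤ σ x} ∧ IsBddSol f M {x | 0 < σ x} W ∧ ∀ x, σ x = 0 → W x = 0 := by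
  obtain ⟨c, hc, C, hC, r, hr, hr1, H⟩ := exists_definingBounds hσ hb hd
  have hfst : ∀ x (t : ℝ), cylFst ι (cylInl ι x + t • cylUp ι) = x := by
    intro x t
    rw [map_add, map_smul, cylFst_cylUp, smul_zero, add_zero, cylFst_cylInl]
  have hUM : ∀ y, 0 ≤ σ (cylFst ι y) → |U y| ≤ M := by
    intro y hy
    rcases hy.eq_or_lt with h | h
    · rw [h0 y h.symm]; simpa
    · exact (hU y h).2.1
  obtain ⟨W, hW⟩ : ∃ W : EuclideanSpace ℝ ι → ℝ, ∀ x, 0 ≤ σ x →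
      Tendsto (fun t : ℝ => U (cylInl ι x + t • cylUp ι)) atTop (𝓝 (W x)) := by
    refine ⟨fun x => ⨆ t : ℝ, U (cylInl ι x + t • cylUp ι), fun x hx =>
      tendsto_atTop_ciSup (hmono x hx) ⟨M, ?_⟩⟩
    rintro _ ⟨t, rfl⟩
    exact (abs_le.1 (hUM _ (by rwa [hfst]))).2
  have hW0 : ∀ x, σ x = 0 → W x = 0 := by
    intro x hx
    refine tendsto_nhds_unique (hW x hx.ge) ?_
    refine tendsto_const_nhds.congr fun t => ?_
    rw [h0 _ (by rwa [hfst])]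
  obtain ⟨L, hL, hL1, -, -⟩ := exists_bound_lipschitz hf M
  obtain ⟨s, hs, hsr, B, hB, hbar⟩ := H.exists_cylinder_barrier hc hC hr hr1 (M := M + L)
    (by linarith)
  have hUB := hbar U hcont (fun y hy => (hUM y hy).trans (by linarith)) h0 (fun y hy => by
    obtain ⟨k1, k2, k3⟩ := hU y hy
    refine ⟨k1, ?_⟩
    rw [k3, abs_neg]
    linarith [hL1 _ k2])
  have hWB : ∀ z, σ z = 0 → ∀ x ∈ closedBall z s, 0 ≤ σ x → |W x| ≤ B * σ x := by
    intro z hz x hx hx0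
    refine le_of_tendsto (hW x hx0).abs (Eventually.of_forall fun t => ?_)
    have := hUB z hz (cylInl ι x + t • cylUp ι)
    rw [hfst] at this
    exact this hx hx0
  have hO : IsOpen {y : EuclideanSpace ℝ (Option ι) | 0 < σ (cylFst ι y)} :=
    isOpen_lt continuous_const (hσ.continuous.comp (cylFst ι).continuous)
  have hlim : IsBddSol f M {y | 0 < σ (cylFst ι y)} fun y => W (cylFst ι y) := by
    refine isBddSol_of_tendsto hf hO (u := fun (k : ℕ) y => U ((k : ℝ) • cylUp ι + (1 : ℝ) • y))
      ?_ ?_ ?_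
    · intro k y hy
      have hm : (k : ℝ) • cylUp ι + (1 : ℝ) • y ∈ {y | 0 < σ (cylFst ι y)} := by
        rw [mem_ofPred_eq, map_add, map_smul, map_smul, cylFst_cylUp, smul_zero, one_smul, zero_add]
        exact hy
      obtain ⟨k1, k2, k3⟩ := hU _ hm
      refine ⟨?_, k2, ?_⟩
      · exact ContDiffAt.comp y k1 (by fun_prop)
      · rw [lapl_comp_affine _ _ k1, k3]; ring
    · intro y hy k l hkl
      have e : ∀ k : ℕ, (k : ℝ) • cylUp ι + (1 : ℝ) • y
          = cylInl ι (cylFst ι y) + ((k : ℝ) + y none) • cylUp ι := by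
        intro k
        conv_lhs => rw [← cylInl_add_smul_cylUp y]
        rw [one_smul, add_smul]; abel
      simp only [e]
      have hkl' : (k : ℝ) ≤ l := by exact_mod_cast hkl
      exact hmono _ (le_of_lt hy) (by linarith)
    · intro y hy
      have e : ∀ k : ℕ, (k : ℝ) • cylUp ι + (1 : ℝ) • y
          = cylInl ι (cylFst ι y) + ((k : ℝ) + y none) • cylUp ι := by
        intro k
        conv_lhs => rw [← cylInl_add_smul_cylUp y]
        rw [one_smul, add_smul]; abel
      simp only [e]
      exact (hW _ (le_of_lt hy)).comp
        (tendsto_atTop_add_const_right _ _ tendsto_natCast_atTop_atTop)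
  have hsol : IsBddSol f M {x | 0 < σ x} W := by
    intro x hx
    obtain ⟨k1, k2, k3⟩ := hlim (cylInl ι x) hx
    have k4 : ContDiffAt ℝ 2 W x :=
      ContDiffAt.comp (f := cylInl ι) (g := fun y => W (cylFst ι y)) x k1
        (cylInl ι).contDiff.contDiffAt
    refine ⟨k4, k2, ?_⟩
    have : lapl (fun y => W (cylFst ι y)) (cylInl ι x) = lapl W x := lapl_comp_cylFst k4
    rw [← this, k3]
    rfl
  have hWc : ContinuousOn W {x | 0 ≤ σ x} := by
    intro x hx
    rcases (show 0 ≤ σ x from hx).eq_or_lt with h | h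
    · rw [ContinuousWithinAt, hW0 x h.symm]
      refine squeeze_zero_norm' (a := fun y => B * σ y) ?_ ?_
      · filter_upwards [self_mem_nhdsWithin, nhdsWithin_le_nhds (closedBall_mem_nhds x hs)]
          with y hy hy'
        exact hWB x h.symm y hy' hy
      · have hBc : Continuous fun y => B * σ y := continuous_const.mul hσ.continuous
        have := (hBc.tendsto x).mono_left (nhdsWithin_le_nhds (s := {x | 0 ≤ σ x}))
        simpa [← h] using this
    · exact (hsol x h).1.continuousAt.continuousWithinAt
  have hcpt : IsCompact {x | 0 ≤ σ x} := Metric.isCompact_of_isClosed_isBounded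
    (isClosed_le continuous_const hσ.continuous) hb
  refine ⟨W, hW, ?_, ?_, hsol, hW0⟩
  · refine Monotone.tendstoUniformlyOn_of_forall_tendsto hcpt (fun t => ?_) hmono hWc hW
    refine hcont.comp (by fun_prop) fun x hx => ?_
    rwa [mem_ofPred_eq, hfst]
  · obtain ⟨C', hC', hreg⟩ := hsol.exists_bdryReg hf (H.mono hsr) hC hs.le hWc hW0 hM hB hWB
    exact hreg.contDiffOn hc hC' hs (hsr.trans hr1) H.contDiff fun x hx => (hsol x hx).1

end cylinder

section transfer

theorem fderiv_fderiv_apply {E : Type*} [NormedAddCommGroup E] [NormedSpace ℝ E] {g : E → ℝ} {x : E}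
    (hg : ContDiffAt ℝ 2 g x) (v w : E) :
    fderiv ℝ (fun y => fderiv ℝ g y v) x w = hess g x w v := by
  have h := (ContinuousLinearMap.apply ℝ ℝ v).hasFDerivAt.comp x hg.hasFDerivAt_fderiv
  have h' : HasFDerivAt (fun y => fderiv ℝ g y v)
    ((ContinuousLinearMap.apply ℝ ℝ v).comp (hess g x)) x := h
  rw [h'.fderiv]
  rfl

variable {m : ℕ}

theorem lap_eq_lapl {W : EuclideanSpace ℝ (Fin m) → ℝ} {x : Fin m → ℝ}
    (hW : ContDiffAt ℝ 2 W ((EuclideanSpace.equiv (Fin m) ℝ).symm x)) :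
    lap (fun x => W ((EuclideanSpace.equiv (Fin m) ℝ).symm x)) x
      = lapl W ((EuclideanSpace.equiv (Fin m) ℝ).symm x) := by
  have hc : ContDiffAt ℝ 2 (fun x => W ((EuclideanSpace.equiv (Fin m) ℝ).symm x)) x :=
    hW.comp x (EuclideanSpace.equiv (Fin m) ℝ).symm.contDiff.contDiffAt
  unfold lap lapl
  refine Finset.sum_congr rfl fun i _ => ?_
  unfold pd
  rw [fderiv_fderiv_apply hc]
  refine (hess_comp_clm ((EuclideanSpace.equiv (Fin m) ℝ).symm :
    (Fin m → ℝ) →L[ℝ] EuclideanSpace ℝ (Fin m)) hW _ _).trans ?_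
  have : ((EuclideanSpace.equiv (Fin m) ℝ).symm : (Fin m → ℝ) →L[ℝ] EuclideanSpace ℝ (Fin m))
      (Pi.single i 1) = EuclideanSpace.basisFun (Fin m) ℝ i := by
    rw [EuclideanSpace.basisFun_apply]
    rfl
  rw [this]
  rfl

/-- Cartesian coordinates on the cylinder. -/
noncomputable def cylCoord (m : ℕ) : EuclideanSpace ℝ (Option (Fin m)) →L[ℝ] (Fin m → ℝ) × ℝ :=
  ((EuclideanSpace.equiv (Fin m) ℝ : EuclideanSpace ℝ (Fin m) →L[ℝ] (Fin m → ℝ)).comp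
    (cylFst (Fin m))).prod (EuclideanSpace.proj none)

theorem cylCoord_basisFun_some (i : Fin m) :
    cylCoord m (EuclideanSpace.basisFun (Option (Fin m)) ℝ (some i)) = (Pi.single i 1, 0) := by
  have h1 : EuclideanSpace.equiv (Fin m) ℝ (cylFst (Fin m)
      (EuclideanSpace.basisFun (Option (Fin m)) ℝ (some i))) = Pi.single i 1 := by
    rw [cylFst_basisFun_some, EuclideanSpace.basisFun_apply]
    rfl
  have h2 : EuclideanSpace.basisFun (Option (Fin m)) ℝ (some i) none = 0 := by simp
  exact Prod.ext h1 h2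

theorem cylCoord_cylUp : cylCoord m (cylUp (Fin m)) = (0, 1) := by
  have h1 : EuclideanSpace.equiv (Fin m) ℝ (cylFst (Fin m) (cylUp (Fin m))) = 0 := by
    rw [cylFst_cylUp, map_zero]
  have h2 : cylUp (Fin m) none = 1 := by simp [cylUp]
  exact Prod.ext h1 h2

theorem cylCoord_add_smul (x : EuclideanSpace ℝ (Fin m)) (t : ℝ) :
    cylCoord m (cylInl (Fin m) x + t • cylUp (Fin m)) = (EuclideanSpace.equiv (Fin m) ℝ x, t) := by
  have h : cylCoord m (cylInl (Fin m) x) = (EuclideanSpace.equiv (Fin m) ℝ x, 0) := rfl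
  rw [map_add, map_smul, cylCoord_cylUp, h]
  simp

theorem lapC_eq_lapl {u : (Fin m → ℝ) × ℝ → ℝ} {y : EuclideanSpace ℝ (Option (Fin m))}
    (hu : ContDiffAt ℝ 2 u (cylCoord m y)) :
    lapC u (cylCoord m y) = lapl (fun y => u (cylCoord m y)) y := by
  have h : cylCoord m (EuclideanSpace.basisFun (Option (Fin m)) ℝ none) = (0, 1) := cylCoord_cylUp
  simp only [lapl, hess_comp_clm (cylCoord m) hu, Fintype.sum_option, cylCoord_basisFun_some, h]
  unfold lapC pdX pdT
  simp only [fderiv_fderiv_apply hu]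
  rw [add_comm]

end transfer

theorem exists_cylinder_profile {m : ℕ} {ω : Set (Fin m → ℝ)} (hωo : IsOpen ω)
    (hωb : Bornology.IsBounded ω) (hωs : HasSmoothBoundary ω) {f : ℝ → ℝ} (hf : ContDiff ℝ 1 f)
    {u : (Fin m → ℝ) × ℝ → ℝ} (hubd : ∃ M : ℝ, ∀ p ∈ closure ω ×ˢ (univ : Set ℝ), |u p| ≤ M)
    (huC : ContDiffOn ℝ 2 u (closure ω ×ˢ (univ : Set ℝ)))
    (heq : ∀ x ∈ ω, ∀ t : ℝ, -lapC u (x, t) = f (u (x, t)))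
    (hbd : ∀ x ∈ frontier ω, ∀ t : ℝ, u (x, t) = 0)
    (hmono : ∀ x ∈ ω, ∀ t : ℝ, 0 ≤ pdT u (x, t)) :
    ∃ ubar : (Fin m → ℝ) → ℝ,
      (∀ x ∈ closure ω, Tendsto (fun t : ℝ => u (x, t)) atTop (𝓝 (ubar x))) ∧
      TendstoUniformlyOn (fun (t : ℝ) x => u (x, t)) ubar atTop (closure ω) ∧
      ContDiffOn ℝ 2 ubar (closure ω) ∧
      (∀ x ∈ ω, -lap ubar x = f (ubar x)) ∧
      (∀ x ∈ frontier ω, ubar x = 0) := by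
  obtain ⟨ρ, hρ, hω, hfr, hdρ⟩ := hωs
  obtain ⟨M, hM⟩ := hubd
  have hmem : ∀ x, x ∈ ω ↔ ρ x < 0 := fun x => by rw [hω]; rfl
  have hfmem : ∀ x, x ∈ frontier ω ↔ ρ x = 0 := fun x => by rw [hfr]; rfl
  have hcl : ∀ x, x ∈ closure ω ↔ ρ x ≤ 0 := fun x => by
    rw [closure_eq_interior_union_frontier ω, hωo.interior_eq, mem_union, hmem, hfmem, le_iff_lt_or_eq]
  set e := EuclideanSpace.equiv (Fin m) ℝ with he
  have hfst : ∀ y, (cylCoord m y).1 = e (cylFst (Fin m) y) := fun y => rfl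
  have hσ : ContDiff ℝ 3 fun x => -ρ (e x) :=
    (ContDiff.comp (contDiff_infty.1 hρ 3) e.contDiff).neg
  have hb : Bornology.IsBounded {x | 0 ≤ -ρ (e x)} := by
    refine (e.symm.lipschitz.isBounded_image hωb.closure).subset fun x hx => ?_
    exact ⟨e x, (hcl _).2 (by simpa using hx), e.symm_apply_apply x⟩
  have hd : ∀ x, -ρ (e x) = 0 → fderiv ℝ (fun x => -ρ (e x)) x ≠ 0 := by
    intro x hx h
    have hρd : HasFDerivAt ρ (fderiv ℝ ρ (e x)) (e x) :=
      (hρ.differentiable (by simp)).differentiableAt.hasFDerivAt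
    have h' := (hρd.comp x e.hasFDerivAt).neg
    have h'' : fderiv ℝ (fun x => -ρ (e x)) x = _ := h'.fderiv
    rw [h''] at h
    refine hdρ (e x) ((hfmem _).2 (neg_eq_zero.1 hx)) (ContinuousLinearMap.ext fun v => ?_)
    have h3 := DFunLike.congr_fun (neg_eq_zero.1 h) (e.symm v)
    simpa using h3
  have hin_ω : ∀ {y}, 0 < -ρ (e (cylFst (Fin m) y)) → (cylCoord m y).1 ∈ ω :=
    fun h => (hmem _).2 (by rw [hfst]; linarith)
  have hclo : ∀ {y}, 0 ≤ -ρ (e (cylFst (Fin m) y)) →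
      cylCoord m y ∈ closure ω ×ˢ (univ : Set ℝ) :=
    fun h => ⟨(hcl _).2 (by rw [hfst]; linarith), mem_univ _⟩
  have huat : ∀ p : (Fin m → ℝ) × ℝ, p.1 ∈ ω → ContDiffAt ℝ 2 u p := fun p hp =>
    huC.contDiffAt (mem_of_superset ((hωo.prod isOpen_univ).mem_nhds ⟨hp, mem_univ _⟩)
      (prod_mono subset_closure Subset.rfl))
  have hU : IsBddSol f (max M 0) {y | 0 < -ρ (e (cylFst (Fin m) y))}
      (fun y => u (cylCoord m y)) := by
    intro y hy
    refine ⟨(huat _ (hin_ω hy)).comp y (cylCoord m).contDiff.contDiffAt,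
      (hM _ (hclo (le_of_lt hy))).trans (le_max_left _ _), ?_⟩
    rw [← lapC_eq_lapl (huat _ (hin_ω hy))]
    have := heq _ (hin_ω hy) (cylCoord m y).2
    rw [Prod.mk.eta] at this
    linarith
  obtain ⟨W, h1, h2, h3, h4, h5⟩ := exists_cylinder_limit (σ := fun x => -ρ (e x)) hf hσ hb hd
    (le_max_right M 0) hU
    (huC.continuousOn.comp (cylCoord m).continuous.continuousOn fun y hy => hclo hy)
    (fun y hy => hbd _ ((hfmem _).2 (neg_eq_zero.1 hy)) (cylCoord m y).2)
    (fun x hx => by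
      simp only [cylCoord_add_smul]
      rcases hx.eq_or_lt with hx | hx
      · have : ∀ t, u (e x, t) = 0 := hbd _ ((hfmem _).2 (neg_eq_zero.1 hx.symm))
        simp only [← he, this]
        exact monotone_const
      · have hxω : e x ∈ ω := (hmem _).2 (neg_pos.1 hx)
        have hder : ∀ t : ℝ, HasDerivAt (fun t : ℝ => u (e x, t)) (pdT u (e x, t)) t := fun t =>
          HasFDerivAt.comp_hasDerivAt (f := fun t : ℝ => (e x, t)) t
            ((huat (e x, t) hxω).differentiableAt (by norm_num)).hasFDerivAt
            ((hasDerivAt_const t (e x)).prodMk (hasDerivAt_id t))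
        exact monotone_of_deriv_nonneg (fun t => (hder t).differentiableAt)
          fun t => (hder t).deriv ▸ hmono _ hxω t)
  simp only [cylCoord_add_smul, ← he] at h1 h2
  have hsub : MapsTo e.symm (closure ω) {x | 0 ≤ -ρ (e x)} := fun x hx => by
    have := (hcl x).1 hx
    simpa using this
  refine ⟨fun x => W (e.symm x), fun x hx => ?_, ?_, ?_, fun x hx => ?_, fun x hx => ?_⟩
  · simpa using h1 (e.symm x) (hsub hx)
  · have := (h2.comp e.symm).mono (s' := closure ω) hsub
    simpa [Function.comp_def] using this
  · exact h3.comp e.symm.contDiff.contDiffOn hsub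
  · have hx' := (hmem x).1 hx
    obtain ⟨hc, -, hl⟩ := h4 (e.symm x) (by simpa using hx')
    rw [lap_eq_lapl hc, hl, neg_neg]
  · exact h5 _ (by simpa using (hfmem x).1 hx)

end

/-- a bounded solution on the cylinder which is nondecreasing in the last
variable has a limit profile `ū` as `t → +∞`: the convergence holds pointwise on `cl ω`, is
uniform on `cl ω`, and `ū` is a `C²` solution of the sectional problem vanishing on `∂ω`. -/
theorem upstream_limit_exists (N : ℕ) (hN : 2 ≤ N)
    (ω : Set (Fin (N - 1) → ℝ)) (hωo : IsOpen ω) (hωb : Bornology.IsBounded ω)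
    (hωs : HasSmoothBoundary ω)
    (f : ℝ → ℝ) (hf : ContDiff ℝ 1 f)
    (u : (Fin (N - 1) → ℝ) × ℝ → ℝ)
    (hubd : ∃ M : ℝ, ∀ p ∈ closure ω ×ˢ (Set.univ : Set ℝ), |u p| ≤ M)
    (huC : ContDiffOn ℝ 2 u (closure ω ×ˢ (Set.univ : Set ℝ)))
    (heq : ∀ x' ∈ ω, ∀ t : ℝ, -lapC u (x', t) = f (u (x', t)))
    (hbd : ∀ x' ∈ frontier ω, ∀ t : ℝ, u (x', t) = 0)
    (hmono : ∀ x' ∈ ω, ∀ t : ℝ, 0 ≤ pdT u (x', t)) :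
    ∃ ubar : (Fin (N - 1) → ℝ) → ℝ,
      (∀ x' ∈ closure ω,
        Filter.Tendsto (fun t : ℝ => u (x', t)) Filter.atTop (nhds (ubar x'))) ∧
      (∀ ε > (0:ℝ), ∃ T : ℝ, ∀ t ≥ T, ∀ x' ∈ closure ω, |u (x', t) - ubar x'| < ε) ∧
      ContDiffOn ℝ 2 ubar (closure ω) ∧
      (∀ x ∈ ω, -lap ubar x = f (ubar x)) ∧
      (∀ x ∈ frontier ω, ubar x = 0) := by
  obtain ⟨ubar, h1, h2, h3⟩ := exists_cylinder_profile hωo hωb hωs hf hubd huC heq hbd hmono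
  refine ⟨ubar, h1, fun ε hε => ?_, h3⟩
  obtain ⟨T, hT⟩ := Filter.eventually_atTop.1 (Metric.tendstoUniformlyOn_iff.1 h2 ε hε)
  refine ⟨T, fun t ht x hx => ?_⟩
  rw [abs_sub_comm]
  exact hT t ht x hx
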